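/- Let X be a noetherian scheme. Then D_qc(X) is generated by a single compact object which is a perfect complex: there exists a perfect complex E• of O_X-modules with quasi-coherent homology such that E• is a compact object of D_qc(X) and, for every F• ∈ D_qc(X), if Hom_{D_qc(X)}(E•[i], F•) = 0 for all i ∈ ℤ then F• ≅ 0. (This is the case of the paper's main Theorem 2.7 for an ordinary noetherian scheme, regarded as a noetherian formal scheme with discrete adic topology, for which D_qct = D_qc.) -/

import Mathlib

/-!
STATEMENT 13: Let `X` be a noetherian scheme. Then `D_qc(X)` is generated by a single
compact object which is a perfect complex: there exists a perfect complex `E•` of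
`O_X`-modules with quasi-coherent homology such that `E•` is a compact object of `D_qc(X)`
and, for every `F• ∈ D_qc(X)`, if `Hom(E•[i], F•) = 0` for all `i ∈ ℤ` then `F• ≅ 0`.

Here sheaves of modules on an open `V ⊆ X` are realized as sheaves of modules over the
restricted sheaf of rings `O_X.over V` on the localized site, restriction being
`SheafOfModules.pushforward (𝟙 _)`; a complex is perfect if every point has an open
neighbourhood `V` on which its restriction becomes isomorphic, in the derived category, to
a bounded complex of locally free finite type modules.
-/

universe w' w u

open CategoryTheory Limits AlgebraicGeometry TopologicalSpace

variable (X : Scheme.{u})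

/-- The restriction functor from sheaves of modules on `X` to sheaves of modules on an
open subset `V`. -/
noncomputable def resF (V : Opens X) :
    X.Modules ⥤ SheafOfModules.{u} (X.ringCatSheaf.over V) :=
  SheafOfModules.pushforward (𝟙 _)

instance (V : Opens X) : (resF X V).Additive := by
  constructor
  intro M N f g
  apply SheafOfModules.hom_ext
  apply PresheafOfModules.Hom.ext
  ext x
  rfl

/-- A sheaf of modules on an open `V ⊆ X` is locally free of finite type if there is a
covering family on which it restricts to free modules of finite rank. -/
noncomputable def IsLocFreeFin {V : Opens X}
    (M : SheafOfModules.{u} (X.ringCatSheaf.over V)) : Prop :=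
  ∃ (ι : Type u) (W : ι → Over V)
    (_ : (((Opens.grothendieckTopology X)).over V).CoversTop W) (n : ι → ℕ),
    ∀ i : ι, Nonempty (M.over (W i) ≅ SheafOfModules.free (ULift.{u} (Fin (n i))))

/-- A cochain complex of `O_X`-modules is perfect if every point of `X` has an open
neighbourhood `V` such that the restriction of the complex to `V` is isomorphic, in the
derived category of `O_V`-modules, to a bounded complex of locally free finite type
`O_V`-modules. -/
noncomputable def IsPerfectCplx
    [∀ V : Opens X, HasDerivedCategory.{w'} (SheafOfModules.{u} (X.ringCatSheaf.over V))]
    (K : CochainComplex X.Modules ℤ) : Prop :=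
  ∀ x : X, ∃ V : Opens X, x ∈ V ∧
    ∃ L : CochainComplex (SheafOfModules.{u} (X.ringCatSheaf.over V)) ℤ,
      (∃ a b : ℤ, ∀ n : ℤ, (n < a ∨ b < n) → IsZero (L.X n)) ∧
      (∀ n : ℤ, IsLocFreeFin X (L.X n)) ∧
      Nonempty (DerivedCategory.Q.obj
          (((resF X V).mapHomologicalComplex (ComplexShape.up ℤ)).obj K) ≅
        DerivedCategory.Q.obj L)

/-- `D_qc(X)`: complexes of `O_X`-modules with quasi-coherent homology. -/
def DqcX [HasDerivedCategory.{w} X.Modules] : DerivedCategory X.Modules → Prop :=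
  fun M => ∀ n : ℤ, ((DerivedCategory.homologyFunctor X.Modules n).obj M).IsQuasicoherent

/-- The canonical comparison map `⨁ⱼ Hom(E, Y j) →+ Hom(E, ∐ Y)`. -/
noncomputable def coproductComparison {T : Type (u + 1)} [Category.{w} T] [Preadditive T]
    (E : T) {J : Type u} [DecidableEq J] (Y : J → T) [HasCoproduct Y] :
    DirectSum J (fun j => E ⟶ Y j) →+ (E ⟶ ∐ Y) :=
  DirectSum.toAddMonoid (fun j => AddMonoidHom.mk' (fun f => f ≫ Sigma.ι Y j)
    (fun f g => by simp [Preadditive.add_comp]))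

/-- An object `E` of a full subcategory `S` (whose Hom's and coproducts are computed in
the ambient category `T`) is a compact object of `S` if `Hom(E, −)` commutes with
arbitrary coproducts of families of objects of `S`. -/
def IsCompactObjIn {T : Type (u + 1)} [Category.{w} T] [Preadditive T] (S : T → Prop)
    (E : T) : Prop :=
  ∀ (J : Type u) [DecidableEq J] (Y : J → T) [HasCoproduct Y],
    (∀ j : J, S (Y j)) → Function.Bijective (coproductComparison E Y)

namespace AlgebraicGeometry.Scheme.Modules

variable {X}

/-- Restriction of sections of an `𝒪_X`-module. -/
noncomputable def res (M : X.Modules) {U V : X.Opens} (h : U ≤ V) : Γ(M, V) →+ Γ(M, U) :=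
  (M.presheaf.map (homOfLE h).op).hom

section Sections

variable {M N : X.Modules} {U V W : X.Opens}

@[simp]
lemma res_res (h : U ≤ V) (h' : V ≤ W) (s : Γ(M, W)) :
    M.res h (M.res h' s) = M.res (h.trans h') s := by
  have := congr($(M.presheaf.map_comp (homOfLE h').op (homOfLE h).op) s)
  exact this.symm

@[simp]
lemma res_rfl (h : U ≤ U) (s : Γ(M, U)) : M.res h s = s :=
  congr($(M.presheaf.map_id (.op U)) s)

@[simp]
lemma res_smul (h : U ≤ V) (r : Γ(X, V)) (s : Γ(M, V)) :
    M.res h (r • s) = X.presheaf.map (homOfLE h).op r • M.res h s :=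
  M.map_smul (homOfLE h) r s

@[simp]
lemma app_res (φ : M ⟶ N) (h : U ≤ V) (s : Γ(M, V)) :
    φ.app U (M.res h s) = N.res h (φ.app V s) :=
  congr($(φ.mapPresheaf.naturality (homOfLE h).op) s)

@[simp]
lemma app_zero_sec (φ : M ⟶ N) (U : X.Opens) : φ.app U 0 = 0 := map_zero (φ.app U).hom

@[simp]
lemma app_add_sec (φ : M ⟶ N) (U : X.Opens) (s t : Γ(M, U)) :
    φ.app U (s + t) = φ.app U s + φ.app U t := map_add (φ.app U).hom s t

lemma eq_of_res {ι : Type*} {U : ι → X.Opens} (hU : ∀ i, U i ≤ V) (hV : V ≤ iSup U)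
    {s t : Γ(M, V)} (h : ∀ i, M.res (hU i) s = M.res (hU i) t) : s = t :=
  TopCat.Sheaf.eq_of_locally_eq' ⟨M.presheaf, M.isSheaf⟩ U V (fun i => homOfLE (hU i)) hV s t h

lemma eq_of_res_mem {s t : Γ(M, V)}
    (h : ∀ x ∈ V, ∃ (W : X.Opens) (hW : W ≤ V), x ∈ W ∧ M.res hW s = M.res hW t) : s = t := by
  choose W hW hx h using fun x : V => h x.1 x.2
  exact eq_of_res hW (fun x hx' => Opens.mem_iSup.mpr ⟨⟨x, hx'⟩, hx _⟩) h

lemma exists_glue {ι : Type*} {U : ι → X.Opens} (hU : ∀ i, U i ≤ V) (hV : V ≤ iSup U)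
    (s : ∀ i, Γ(M, U i))
    (hs : ∀ i j, M.res (inf_le_left : U i ⊓ U j ≤ U i) (s i) = M.res inf_le_right (s j)) :
    ∃ t : Γ(M, V), ∀ i, M.res (hU i) t = s i :=
  (TopCat.Sheaf.existsUnique_gluing' ⟨M.presheaf, M.isSheaf⟩ U V (fun i => homOfLE (hU i)) hV
    s hs).exists

lemma exists_glue₂ {U₁ U₂ : X.Opens} (h₁ : U₁ ≤ V) (h₂ : U₂ ≤ V) (hV : V ≤ U₁ ⊔ U₂)
    (s₁ : Γ(M, U₁)) (s₂ : Γ(M, U₂))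
    (hs : M.res (inf_le_left : U₁ ⊓ U₂ ≤ U₁) s₁ = M.res inf_le_right s₂) :
    ∃ t : Γ(M, V), M.res h₁ t = s₁ ∧ M.res h₂ t = s₂ := by
  have key : ∀ i j : Bool,
      M.res (inf_le_left : cond i U₁ U₂ ⊓ cond j U₁ U₂ ≤ cond i U₁ U₂)
        (Bool.rec s₂ s₁ i : Γ(M, cond i U₁ U₂)) =
      M.res (inf_le_right : cond i U₁ U₂ ⊓ cond j U₁ U₂ ≤ cond j U₁ U₂)
        (Bool.rec s₂ s₁ j : Γ(M, cond j U₁ U₂)) := by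
    rintro (_ | _) (_ | _)
    · rfl
    · have h := congr(M.res (le_inf inf_le_right inf_le_left : U₂ ⊓ U₁ ≤ U₁ ⊓ U₂) $hs)
      simp only [res_res] at h
      exact h.symm
    · exact hs
    · rfl
  obtain ⟨t, ht⟩ := exists_glue (M := M) (V := V) (U := fun i : Bool => cond i U₁ U₂)
    (by rintro (_ | _) <;> assumption)
    (hV.trans (sup_le (le_iSup (fun i : Bool => cond i U₁ U₂) true)
      (le_iSup (fun i : Bool => cond i U₁ U₂) false))) (fun i => Bool.rec s₂ s₁ i) key
  exact ⟨t, ht true, ht false⟩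

lemma eq_of_res₂ {U₁ U₂ : X.Opens} (h₁ : U₁ ≤ V) (h₂ : U₂ ≤ V) (hV : V ≤ U₁ ⊔ U₂)
    {s t : Γ(M, V)} (e₁ : M.res h₁ s = M.res h₁ t) (e₂ : M.res h₂ s = M.res h₂ t) : s = t :=
  TopCat.Sheaf.eq_of_locally_eq₂ ⟨M.presheaf, M.isSheaf⟩ (homOfLE h₁) (homOfLE h₂) hV s t e₁ e₂

/-- Construct a morphism of `𝒪_X`-modules from a compatible family of linear maps. -/
noncomputable def homMk' (f : ∀ U : X.Opens, Γ(M, U) →ₗ[Γ(X, U)] Γ(N, U))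
    (hf : ∀ (U V : X.Opens) (h : U ≤ V) (s : Γ(M, V)), f U (M.res h s) = N.res h (f V s)) :
    M ⟶ N :=
  ⟨PresheafOfModules.homMk (M₁ := M.val) (M₂ := N.val)
    { app U := AddCommGrpCat.ofHom (f U.unop).toAddMonoidHom
      naturality U V i := by
        ext s
        exact hf V.unop U.unop i.unop.le s }
    (fun U r m => (f U.unop).map_smul r m)⟩

lemma hom_ext' {f g : M ⟶ N} (h : ∀ (U : X.Opens) (s : Γ(M, U)), f.app U s = g.app U s) :
    f = g := by
  ext U s; exact h U s

lemma isIso_of_bijective (f : M ⟶ N) (h : ∀ U, Function.Bijective (f.app U)) : IsIso f := by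
  rw [Hom.isIso_iff_isIso_app]
  intro U
  exact (ConcreteCategory.isIso_iff_bijective _).mpr (h U)

lemma bijective_of_isIso (f : M ⟶ N) [IsIso f] (U : X.Opens) : Function.Bijective (f.app U) :=
  (ConcreteCategory.isIso_iff_bijective _).mp inferInstance

end Sections

/-- A local family of submodules of the sections of an `𝒪_X`-module. -/
structure LocalSubmodule (M : X.Modules) where
  /-- the submodule of sections over an open subset -/
  sec (U : X.Opens) : Submodule Γ(X, U) Γ(M, U)
  res_mem {U V : X.Opens} (h : U ≤ V) {s : Γ(M, V)} (hs : s ∈ sec V) : M.res h s ∈ sec U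
  local_mem {V : X.Opens} (s : Γ(M, V))
    (hs : ∀ x ∈ V, ∃ (W : X.Opens) (hW : W ≤ V), x ∈ W ∧ M.res hW s ∈ sec W) : s ∈ sec V

namespace LocalSubmodule

variable {M : X.Modules} (S : M.LocalSubmodule)

/-- The underlying presheaf of submodules. -/
def toPresheafSubmodule : PresheafOfModules.Submodule M.val where
  obj U := S.sec U.unop
  map f _ hs := S.res_mem f.unop.le hs

/-- The sheaf of modules attached to a local family of submodules. -/
noncomputable def toModules : X.Modules where
  val := S.toPresheafSubmodule.toPresheafOfModules
  isSheaf := by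
    refine (TopCat.Presheaf.isSheaf_iff_isSheafUniqueGluing (X := X.toTopCat)
      (F := S.toPresheafSubmodule.toPresheafOfModules.presheaf)).mpr ?_
    intro ι U s hs
    obtain ⟨t, ht⟩ := exists_glue (M := M) (fun i => le_iSup U i) le_rfl (fun i => (s i).1)
      (fun i j => congr($(hs i j).1))
    refine ⟨⟨t, S.local_mem t fun x hx => ?_⟩, fun i => Subtype.ext (ht i), fun t' ht' => ?_⟩
    · obtain ⟨i, hi⟩ := Opens.mem_iSup.mp hx
      exact ⟨U i, le_iSup U i, hi, by rw [ht i]; exact (s i).2⟩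
    · refine Subtype.ext (eq_of_res (M := M) (fun i => le_iSup U i) le_rfl fun i => ?_)
      exact congr($(ht' i).1).trans (ht i).symm

/-- The inclusion. -/
noncomputable def ι : S.toModules ⟶ M := ⟨S.toPresheafSubmodule.ι⟩

lemma ι_injective (U : X.Opens) : Function.Injective (S.ι.app U) := Subtype.val_injective

lemma ι_mem {U : X.Opens} (s : Γ(S.toModules, U)) : S.ι.app U s ∈ S.sec U := s.2

lemma exists_of_mem {U : X.Opens} {s : Γ(M, U)} (hs : s ∈ S.sec U) :
    ∃ t : Γ(S.toModules, U), S.ι.app U t = s := ⟨⟨s, hs⟩, rfl⟩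

/-- Factor a morphism through a local submodule. -/
noncomputable def lift {N : X.Modules} (f : N ⟶ M) (hf : ∀ U s, f.app U s ∈ S.sec U) :
    N ⟶ S.toModules :=
  homMk' (fun U =>
    { toFun s := ⟨f.app U s, hf U s⟩
      map_add' s t := Subtype.ext ((f.app U).hom.map_add s t)
      map_smul' r s := Subtype.ext (f.app_smul r s) })
    (fun _ _ h s => Subtype.ext (app_res f h s))

lemma lift_ι {N : X.Modules} (f : N ⟶ M) (hf : ∀ U s, f.app U s ∈ S.sec U) :
    S.lift f hf ≫ S.ι = f := rfl

end LocalSubmodule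

end AlgebraicGeometry.Scheme.Modules

namespace AlgebraicGeometry.Scheme.Modules

section Exactness

variable {X} {M N : X.Modules}

lemma mono_of_injective (f : M ⟶ N) (h : ∀ U, Function.Injective (f.app U)) : Mono f :=
  ⟨fun _ _ e => hom_ext' fun U s => h U congr(($e).app U s)⟩

/-- The kernel of a morphism as a local submodule. -/
def kerSub (f : M ⟶ N) : M.LocalSubmodule where
  sec U :=
    { carrier := {s | f.app U s = 0}
      zero_mem' := map_zero (f.app U).hom
      add_mem' {s t} hs ht := by
        have := (f.app U).hom.map_add s t
        rw [show (f.app U).hom s = 0 from hs, show (f.app U).hom t = 0 from ht, add_zero] at this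
        exact this
      smul_mem' r s hs := by
        have := f.app_smul r s
        rw [show f.app U s = 0 from hs, smul_zero] at this
        exact this }
  res_mem {U V} h s hs := by
    change f.app U _ = 0
    rw [app_res, show f.app V s = 0 from hs, map_zero]
  local_mem {V} s hs := eq_of_res_mem fun x hx => by
    obtain ⟨W, hW, hx, h⟩ := hs x hx
    refine ⟨W, hW, hx, ?_⟩
    rw [map_zero, ← app_res]
    exact h

lemma mem_kerSub (f : M ⟶ N) {U : X.Opens} (s : Γ(M, U)) :
    s ∈ (kerSub f).sec U ↔ f.app U s = 0 := Iff.rfl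

lemma injective_of_mono (f : M ⟶ N) [Mono f] (U : X.Opens) : Function.Injective (f.app U) := by
  have h0 : (kerSub f).ι = 0 := by
    rw [← cancel_mono f, zero_comp]
    exact hom_ext' fun U s => (kerSub f).ι_mem s
  refine (injective_iff_map_eq_zero (f.app U).hom).mpr fun s hs => ?_
  obtain ⟨t, ht⟩ := (kerSub f).exists_of_mem ((mem_kerSub f s).mpr hs)
  rw [← ht, h0]
  rfl

/-- The image of a morphism as a local submodule. -/
def imageSub (f : M ⟶ N) : N.LocalSubmodule where
  sec U :=
    { carrier := {s | ∀ x ∈ U, ∃ (W : X.Opens) (hW : W ≤ U) (t : Γ(M, W)),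
        x ∈ W ∧ f.app W t = N.res hW s}
      zero_mem' x hx := ⟨U, le_rfl, 0, hx, by simp⟩
      add_mem' {s s'} hs hs' x hx := by
        obtain ⟨W, hW, t, hx₁, e⟩ := hs x hx
        obtain ⟨W', hW', t', hx₂, e'⟩ := hs' x hx
        refine ⟨W ⊓ W', inf_le_left.trans hW, M.res inf_le_left t + M.res inf_le_right t',
          ⟨hx₁, hx₂⟩, ?_⟩
        rw [app_add_sec, app_res, app_res, e, e']
        simp
      smul_mem' r s hs x hx := by
        obtain ⟨W, hW, t, hx₁, e⟩ := hs x hx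
        refine ⟨W, hW, X.presheaf.map (homOfLE hW).op r • t, hx₁, ?_⟩
        rw [Hom.app_smul, e, res_smul] }
  res_mem {U V} h s hs x hx := by
    obtain ⟨W, hW, t, hx₁, e⟩ := hs x (h hx)
    refine ⟨W ⊓ U, inf_le_right, M.res inf_le_left t, ⟨hx₁, hx⟩, ?_⟩
    rw [app_res, e]
    simp
  local_mem {V} s hs x hx := by
    obtain ⟨W, hW, hx₁, h⟩ := hs x hx
    obtain ⟨W', hW', t, hx₂, e⟩ := h x hx₁
    exact ⟨W', hW'.trans hW, t, hx₂, by rw [e, res_res]⟩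

/-- Epimorphisms of `𝒪_X`-modules are locally surjective. -/
lemma locally_surjective_of_epi (f : M ⟶ N) [Epi f] {U : X.Opens} (s : Γ(N, U)) {x : X}
    (hx : x ∈ U) :
    ∃ (W : X.Opens) (hW : W ≤ U) (t : Γ(M, W)), x ∈ W ∧ f.app W t = N.res hW s := by
  have hf : ∀ U s, f.app U s ∈ (imageSub f).sec U := fun U s x hx =>
    ⟨U, le_rfl, s, hx, (res_rfl _ _).symm⟩
  have : Mono (imageSub f).ι := mono_of_injective _ (imageSub f).ι_injective
  have : Epi (imageSub f).ι := epi_of_epi_fac ((imageSub f).lift_ι f hf)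
  have : IsIso (imageSub f).ι := isIso_of_mono_of_epi _
  obtain ⟨t, rfl⟩ := (bijective_of_isIso (imageSub f).ι U).2 s
  exact (imageSub f).ι_mem t x hx

lemma epi_of_locally_surjective (f : M ⟶ N)
    (h : ∀ (U : X.Opens) (s : Γ(N, U)), ∀ x ∈ U, ∃ (W : X.Opens) (hW : W ≤ U) (t : Γ(M, W)),
      x ∈ W ∧ f.app W t = N.res hW s) : Epi f := by
  refine ⟨fun {K} a b e => hom_ext' fun U s => eq_of_res_mem fun x hx => ?_⟩
  obtain ⟨W, hW, t, hx', ht⟩ := h U s x hx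
  refine ⟨W, hW, hx', ?_⟩
  rw [← app_res, ← app_res, ← ht]
  exact congr(($e).app W t)

/-- Exactness of a sequence of `𝒪_X`-modules on sections. -/
lemma exact_of_locally (S : ShortComplex X.Modules)
    (h : ∀ (U : X.Opens) (s : Γ(S.X₂, U)), S.g.app U s = 0 → ∀ x ∈ U,
      ∃ (W : X.Opens) (hW : W ≤ U) (t : Γ(S.X₁, W)), x ∈ W ∧ S.f.app W t = S.X₂.res hW s) :
    S.Exact := by
  have hι : (kerSub S.g).ι ≫ S.g = 0 := hom_ext' fun U s => (kerSub S.g).ι_mem s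
  have : Mono (kerSub S.g).ι := mono_of_injective _ (kerSub S.g).ι_injective
  have hf : ∀ U s, S.f.app U s ∈ (kerSub S.g).sec U := fun U s => congr(($(S.zero)).app U s)
  let S' : ShortComplex X.Modules := ShortComplex.mk (kerSub S.g).ι S.g hι
  have hS' : S'.Exact := ShortComplex.exact_of_f_is_kernel S' <|
    KernelFork.IsLimit.ofι' _ _ fun {A} k hk =>
      ⟨(kerSub S.g).lift k fun U s => congr(($hk).app U s), LocalSubmodule.lift_ι _ _ _⟩
  let φ : S ⟶ S' := { τ₁ := (kerSub S.g).lift S.f hf, τ₂ := 𝟙 _, τ₃ := 𝟙 _ }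
  have : Epi φ.τ₁ := by
    refine epi_of_locally_surjective _ fun U s x hx => ?_
    obtain ⟨W, hW, t, hx', e⟩ := h U ((kerSub S.g).ι.app U s) ((kerSub S.g).ι_mem s) x hx
    refine ⟨W, hW, t, hx', (kerSub S.g).ι_injective W ?_⟩
    rw [app_res, ← e]
    rfl
  have : IsIso φ.τ₂ := inferInstanceAs (IsIso (𝟙 _))
  have : Mono φ.τ₃ := inferInstanceAs (Mono (𝟙 _))
  exact (ShortComplex.exact_iff_of_epi_of_isIso_of_mono φ).mpr hS'

lemma locally_exact {S : ShortComplex X.Modules} (hS : S.Exact) {U : X.Opens} (s : Γ(S.X₂, U))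
    (hs : S.g.app U s = 0) {x : X} (hx : x ∈ U) :
    ∃ (W : X.Opens) (hW : W ≤ U) (t : Γ(S.X₁, W)), x ∈ W ∧ S.f.app W t = S.X₂.res hW s := by
  have hι : (kerSub S.g).ι ≫ S.g = 0 := hom_ext' fun U s => (kerSub S.g).ι_mem s
  obtain ⟨A, π, _, t, ht⟩ := hS.exact_up_to_refinements _ hι
  obtain ⟨s', hs'⟩ := (kerSub S.g).exists_of_mem ((mem_kerSub S.g s).mpr hs)
  obtain ⟨W, hW, a, hx', e⟩ := locally_surjective_of_epi π s' hx
  refine ⟨W, hW, t.app W a, hx', ?_⟩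
  have := congr(($ht).app W a)
  rw [← hs', ← app_res, ← e]
  exact this.symm

end Exactness

section ExtendByZero

variable {X}

/-- The sections of `M` which vanish locally outside of `V`. -/
def suppSub (V : X.Opens) (M : X.Modules) : M.LocalSubmodule where
  sec U :=
    { carrier := {s | ∃ (W : X.Opens) (hW : W ≤ U), U ≤ V ⊔ W ∧ M.res hW s = 0}
      zero_mem' := ⟨U, le_rfl, le_sup_right, map_zero _⟩
      add_mem' {s t} := by
        rintro ⟨W, hW, h, e⟩ ⟨W', hW', h', e'⟩
        refine ⟨W ⊓ W', inf_le_left.trans hW, ?_, ?_⟩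
        · rw [sup_inf_left]; exact le_inf h h'
        · rw [map_add, ← res_res (inf_le_left : W ⊓ W' ≤ W) hW, e,
            ← res_res (inf_le_right : W ⊓ W' ≤ W') hW', e', map_zero, map_zero, add_zero]
      smul_mem' r s := by
        rintro ⟨W, hW, h, e⟩
        exact ⟨W, hW, h, by rw [res_smul, e, smul_zero]⟩ }
  res_mem {U U'} h s := by
    rintro ⟨W, hW, h', e⟩
    refine ⟨W ⊓ U, inf_le_right, ?_, ?_⟩
    · rw [sup_inf_left]; exact le_inf (h.trans h') le_sup_right
    · rw [res_res, ← res_res (inf_le_left : W ⊓ U ≤ W) hW, e, map_zero]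
  local_mem {U} s hs := by
    choose W hW hx W' hW' h e using fun x : U => hs x.1 x.2
    refine ⟨⨆ x, W' x, iSup_le fun x => (hW' x).trans (hW x), fun x hx' => ?_, ?_⟩
    · rcases h ⟨x, hx'⟩ (hx ⟨x, hx'⟩) with h | h
      · exact Or.inl h
      · exact Or.inr (Opens.mem_iSup.mpr ⟨_, h⟩)
    · refine eq_of_res (fun x => le_iSup W' x) le_rfl fun x => ?_
      rw [map_zero, res_res, ← e x, res_res]

lemma app_mem_suppSub {V : X.Opens} {M N : X.Modules} (f : M ⟶ N) {U : X.Opens} {s : Γ(M, U)}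
    (hs : s ∈ (suppSub V M).sec U) : f.app U s ∈ (suppSub V N).sec U := by
  obtain ⟨W, hW, h, e⟩ := hs
  refine ⟨W, hW, h, ?_⟩
  rw [← app_res, e, app_zero_sec]

/-- The extension by zero of the restriction of a module to an open subset `V`. -/
noncomputable def zeroExt (V : X.Opens) : X.Modules ⥤ X.Modules where
  obj M := (suppSub V M).toModules
  map {M N} f := (suppSub V N).lift ((suppSub V M).ι ≫ f) fun _ s =>
    app_mem_suppSub f ((suppSub V M).ι_mem s)

/-- The inclusion of the extension by zero. -/
noncomputable def zeroExtι (V : X.Opens) : zeroExt V ⟶ 𝟭 X.Modules where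
  app M := (suppSub V M).ι

variable (V : X.Opens)

lemma zeroExtι_injective (M : X.Modules) (U : X.Opens) :
    Function.Injective (((zeroExtι V).app M).app U) := (suppSub V M).ι_injective U

instance (M : X.Modules) : Mono ((zeroExtι V).app M) :=
  mono_of_injective _ (zeroExtι_injective V M)

lemma zeroExt_map_app {M N : X.Modules} (f : M ⟶ N) {U : X.Opens} (s : Γ((zeroExt V).obj M, U)) :
    ((zeroExtι V).app N).app U (((zeroExt V).map f).app U s) =
      f.app U (((zeroExtι V).app M).app U s) := rfl

lemma zeroExtι_mem {M : X.Modules} {U : X.Opens} (s : Γ((zeroExt V).obj M, U)) :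
    ∃ (W : X.Opens) (hW : W ≤ U), U ≤ V ⊔ W ∧ ((zeroExt V).obj M).res hW s = 0 := by
  obtain ⟨W, hW, h, e⟩ := (suppSub V M).ι_mem s
  refine ⟨W, hW, h, (suppSub V M).ι_injective W ?_⟩
  exact (app_res (suppSub V M).ι hW s).trans (e.trans (app_zero_sec _ _).symm)

lemma exists_zeroExtι_eq {M : X.Modules} {U : X.Opens} (s : Γ(M, U)) (W : X.Opens) (hW : W ≤ U)
    (h : U ≤ V ⊔ W) (e : M.res hW s = 0) :
    ∃ t : Γ((zeroExt V).obj M, U), ((zeroExtι V).app M).app U t = s :=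
  (suppSub V M).exists_of_mem ⟨W, hW, h, e⟩

variable {V}

lemma section_bot (M : X.Modules) (s t : Γ(M, (⊥ : X.Opens))) : s = t :=
  eq_of_res_mem fun _ hx => hx.elim

lemma zeroExtι_bijective {M : X.Modules} {U : X.Opens} (h : U ≤ V) :
    Function.Bijective (((zeroExtι V).app M).app U) :=
  ⟨zeroExtι_injective V M U, fun s => exists_zeroExtι_eq V s ⊥ bot_le (h.trans le_sup_left)
    (section_bot M _ _)⟩

instance : (zeroExt V).Additive where
  map_add := hom_ext' fun U _ => zeroExtι_injective V _ U rfl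

/-- Morphisms out of `zeroExt V M` are determined by the sections over open subsets of `V`. -/
lemma zeroExt_hom_ext {M N : X.Modules} {f g : (zeroExt V).obj M ⟶ N}
    (h : ∀ (U : X.Opens), U ≤ V → ∀ s, f.app U s = g.app U s) : f = g := by
  refine hom_ext' fun U s => ?_
  obtain ⟨W, hW, hU, e⟩ := zeroExtι_mem V s
  refine eq_of_res₂ (inf_le_left : U ⊓ V ≤ U) hW
    (by rw [sup_comm] at hU; rw [sup_comm, sup_inf_left]; exact le_inf le_sup_right hU) ?_ ?_
  · rw [← app_res, ← app_res, h _ inf_le_right]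
  · rw [← app_res, ← app_res, e, app_zero_sec, app_zero_sec]

end ExtendByZero
end AlgebraicGeometry.Scheme.Modules

namespace AlgebraicGeometry.Scheme.Modules

section ExactFunctors

variable {X} (V : X.Opens)

lemma mem_of_le_sup {U V W : X.Opens} (h : U ≤ V ⊔ W) {x : X} (hx : x ∈ U) : x ∈ V ∨ x ∈ W := h hx

lemma zeroExt_map_exact (S : ShortComplex X.Modules) (hS : S.Exact) :
    (S.map (zeroExt V)).Exact := by
  refine exact_of_locally _ fun U s hs x hx => ?_
  change Γ((zeroExt V).obj S.X₂, U) at s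
  have hs' : S.g.app U (((zeroExtι V).app S.X₂).app U s) = 0 := by
    rw [← zeroExt_map_app]
    exact (congrArg _ hs).trans (app_zero_sec _ _)
  obtain ⟨W, hW, h, e⟩ := zeroExtι_mem V s
  rcases mem_of_le_sup h hx with hx' | hx'
  · obtain ⟨W', hW', t, hx'', ht⟩ := locally_exact hS _ hs' hx
    obtain ⟨t', ht'⟩ := (zeroExtι_bijective (inf_le_right : W' ⊓ V ≤ V)).2
      (S.X₁.res (inf_le_left : W' ⊓ V ≤ W') t)
    refine ⟨W' ⊓ V, inf_le_left.trans hW', t', ⟨hx'', hx'⟩, zeroExtι_injective V _ _ ?_⟩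
    change ((zeroExtι V).app S.X₂).app _ (((zeroExt V).map S.f).app _ t') =
      ((zeroExtι V).app S.X₂).app _ (((zeroExt V).obj S.X₂).res _ s)
    rw [zeroExt_map_app, ht', app_res, ht, res_res, app_res]
    rfl
  · exact ⟨W, hW, 0, hx', (app_zero_sec _ _).trans e.symm⟩

instance : PreservesFiniteLimits (zeroExt V) :=
  (((zeroExt V).exact_tfae.out 1 3 rfl rfl).mp (zeroExt_map_exact V)).1

instance : PreservesFiniteColimits (zeroExt V) :=
  (((zeroExt V).exact_tfae.out 1 3 rfl rfl).mp (zeroExt_map_exact V)).2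

/-- The quotient of a module by the extension by zero from `V`. -/
noncomputable def zeroQuot : X.Modules ⥤ X.Modules where
  obj M := cokernel ((zeroExtι V).app M)
  map {M N} f := cokernel.map _ _ ((zeroExt V).map f) f ((zeroExtι V).naturality f).symm
  map_id M := by
    rw [← cancel_epi (cokernel.π ((zeroExtι V).app M))]
    simp only [cokernel.π_desc]
    exact (Category.id_comp _).trans (Category.comp_id _).symm
  map_comp f g := by
    rw [← cancel_epi (cokernel.π _)]
    simp

/-- The projection to the quotient by the extension by zero. -/
noncomputable def zeroQuotπ : 𝟭 X.Modules ⟶ zeroQuot V where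
  app M := cokernel.π ((zeroExtι V).app M)
  naturality M N f := by
    simp [zeroQuot]

instance (M : X.Modules) : Epi ((zeroQuotπ V).app M) :=
  inferInstanceAs (Epi (cokernel.π ((zeroExtι V).app M)))

lemma zeroExtι_comp_zeroQuotπ (M : X.Modules) : (zeroExtι V).app M ≫ (zeroQuotπ V).app M = 0 :=
  cokernel.condition _

/-- The short exact sequence relating extension by zero and its quotient. -/
noncomputable def zeroSeq (M : X.Modules) : ShortComplex X.Modules :=
  ShortComplex.mk _ _ (zeroExtι_comp_zeroQuotπ V M)

lemma zeroSeq_shortExact (M : X.Modules) : (zeroSeq V M).ShortExact where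
  exact := ShortComplex.exact_of_g_is_cokernel _ (cokernelIsCokernel ((zeroExtι V).app M))
  mono_f := inferInstanceAs (Mono ((zeroExtι V).app M))
  epi_g := inferInstanceAs (Epi ((zeroQuotπ V).app M))

instance : (zeroQuot V).Additive where
  map_add {M N f g} := by
    rw [← cancel_epi ((zeroQuotπ V).app M), ← NatTrans.naturality, Preadditive.comp_add,
      ← NatTrans.naturality, ← NatTrans.naturality]
    simp

lemma zeroQuotπ_app_eq_zero {M : X.Modules} {U : X.Opens} (s : Γ(M, U)) :
    ((zeroQuotπ V).app M).app U s = 0 ↔ s ∈ (suppSub V M).sec U := by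
  constructor
  · intro h
    refine (suppSub V M).local_mem s fun x hx => ?_
    obtain ⟨W, hW, t, hx', e⟩ := locally_exact (zeroSeq_shortExact V M).exact s h hx
    refine ⟨W, hW, hx', ?_⟩
    have := (suppSub V M).ι_mem t
    erw [e] at this
    exact this
  · intro h
    obtain ⟨t, rfl⟩ := (suppSub V M).exists_of_mem h
    exact congr(($(zeroExtι_comp_zeroQuotπ V M)).app U t)

lemma zeroQuot_section_eq_zero {M : X.Modules} {U : X.Opens} (h : U ≤ V)
    (s : Γ((zeroQuot V).obj M, U)) : s = 0 := by
  refine eq_of_res_mem fun x hx => ?_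
  obtain ⟨W, hW, t, hx', e⟩ := locally_surjective_of_epi ((zeroQuotπ V).app M) s hx
  refine ⟨W, hW, hx', ?_⟩
  rw [← e, map_zero, zeroQuotπ_app_eq_zero]
  exact ⟨⊥, bot_le, (hW.trans h).trans le_sup_left, section_bot M _ _⟩

lemma zeroQuot_map_app {M N : X.Modules} (f : M ⟶ N) {U : X.Opens} (s : Γ(M, U)) :
    ((zeroQuot V).map f).app U (((zeroQuotπ V).app M).app U s) =
      ((zeroQuotπ V).app N).app U (f.app U s) :=
  congr(($((zeroQuotπ V).naturality f)).app U s).symm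

lemma zeroQuot_map_exact (S : ShortComplex X.Modules) (hS : S.Exact) :
    (S.map (zeroQuot V)).Exact := by
  refine exact_of_locally _ fun U s hs x hx => ?_
  change Γ((zeroQuot V).obj S.X₂, U) at s
  change ((zeroQuot V).map S.g).app U s = 0 at hs
  obtain ⟨W, hW, t, hx', e⟩ := locally_surjective_of_epi ((zeroQuotπ V).app S.X₂) s hx
  have h₁ : ((zeroQuotπ V).app S.X₃).app W (S.g.app W t) = 0 := by
    rw [← zeroQuot_map_app, e, app_res, hs, map_zero]
  obtain ⟨W', hW', h, e'⟩ := (zeroQuotπ_app_eq_zero V _).mp h₁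
  rcases mem_of_le_sup h hx' with hx₂ | hx₂
  · exact ⟨U ⊓ V, inf_le_left, 0, ⟨hx, hx₂⟩, (app_zero_sec _ _).trans
      (zeroQuot_section_eq_zero V inf_le_right _).symm⟩
  · rw [← app_res] at e'
    obtain ⟨W'', hW'', t', hx₃, e''⟩ := locally_exact hS _ e' hx₂
    refine ⟨W'', (hW''.trans hW').trans hW, ((zeroQuotπ V).app S.X₁).app _ t', hx₃, ?_⟩
    change ((zeroQuot V).map S.f).app W'' _ = ((zeroQuot V).obj S.X₂).res _ s
    rw [zeroQuot_map_app, e'', res_res]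
    exact (app_res ((zeroQuotπ V).app S.X₂) _ t).trans (by rw [e, res_res])

instance : PreservesFiniteLimits (zeroQuot V) :=
  (((zeroQuot V).exact_tfae.out 1 3 rfl rfl).mp (zeroQuot_map_exact V)).1

instance : PreservesFiniteColimits (zeroQuot V) :=
  (((zeroQuot V).exact_tfae.out 1 3 rfl rfl).mp (zeroQuot_map_exact V)).2

end ExactFunctors

end AlgebraicGeometry.Scheme.Modules

namespace AlgebraicGeometry.Scheme.Modules

section ZeroExtIso

variable {X} {V : X.Opens}

lemma le_inf_sup {U V W : X.Opens} (h : U ≤ V ⊔ W) : U ≤ (U ⊓ V) ⊔ W :=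
  fun _ hx => (h hx).imp (fun h' => ⟨hx, h'⟩) id

lemma res_zeroExtι {M : X.Modules} {U U' : X.Opens} (h : U ≤ U') (s : Γ((zeroExt V).obj M, U')) :
    M.res h (((zeroExtι V).app M).app U' s) =
      ((zeroExtι V).app M).app U (((zeroExt V).obj M).res h s) :=
  (app_res ((zeroExtι V).app M) h s).symm

/-- `zeroExt V` inverts the morphisms which are bijective on sections over open subsets of `V`. -/
lemma isIso_zeroExt_map {M N : X.Modules} (f : M ⟶ N)
    (h : ∀ U : X.Opens, U ≤ V → Function.Bijective (f.app U)) : IsIso ((zeroExt V).map f) := by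
  refine isIso_of_bijective _ fun U => ⟨?_, fun t => ?_⟩
  · refine (injective_iff_map_eq_zero (((zeroExt V).map f).app U).hom).mpr fun s hs => ?_
    change ((zeroExt V).map f).app U s = 0 at hs
    obtain ⟨W, hW, hU, e⟩ := zeroExtι_mem V s
    refine eq_of_res₂ inf_le_left hW (le_inf_sup hU) ?_ (e.trans (map_zero _).symm)
    apply zeroExtι_injective V M
    apply (h (U ⊓ V) inf_le_right).1
    rw [← zeroExt_map_app, app_res, hs]
    simp
  · obtain ⟨W, hW, hU, e⟩ := zeroExtι_mem V t
    obtain ⟨s₀, hs₀⟩ := (h (U ⊓ V) inf_le_right).2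
      (N.res inf_le_left (((zeroExtι V).app N).app U t))
    obtain ⟨s, hs, hs'⟩ := exists_glue₂ (M := M) (inf_le_left : U ⊓ V ≤ U) hW (le_inf_sup hU) s₀ 0 (by
      apply (h _ (inf_le_left.trans inf_le_right)).1
      rw [app_res, hs₀, res_res, map_zero, app_zero_sec]
      rw [← res_res (inf_le_right : U ⊓ V ⊓ W ≤ W) hW, res_zeroExtι, e]
      exact (congrArg _ (app_zero_sec _ _)).trans (map_zero _))
    obtain ⟨s', rfl⟩ := exists_zeroExtι_eq V s W hW hU hs'
    refine ⟨s', zeroExtι_injective V N U ?_⟩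
    rw [zeroExt_map_app]
    refine eq_of_res₂ (M := N) inf_le_left hW (le_inf_sup hU) ?_ ?_
    · rw [← app_res, hs, hs₀]
    · rw [← app_res, hs', res_zeroExtι, e, app_zero_sec]
      exact (app_zero_sec ((zeroExtι V).app N) W).symm

lemma isIso_zeroExtι_app {M : X.Modules}
    (h : ∀ (U : X.Opens) (s : Γ(M, U)), s ∈ (suppSub V M).sec U) : IsIso ((zeroExtι V).app M) :=
  isIso_of_bijective _ fun U => ⟨zeroExtι_injective V M U, fun s => by
    obtain ⟨W, hW, hU, e⟩ := h U s
    exact exists_zeroExtι_eq V s W hW hU e⟩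

lemma isIso_zeroExtι_app_zeroExt {V' : X.Opens} (h : V' ≤ V) (M : X.Modules) :
    IsIso ((zeroExtι V).app ((zeroExt V').obj M)) :=
  isIso_zeroExtι_app fun U s => by
    obtain ⟨W, hW, hU, e⟩ := zeroExtι_mem V' s
    exact ⟨W, hW, hU.trans (sup_le_sup_right h _), e⟩

lemma isIso_zeroExt_map_zeroExtι {V' : X.Opens} (h : V ≤ V') (M : X.Modules) :
    IsIso ((zeroExt V).map ((zeroExtι V').app M)) :=
  isIso_zeroExt_map _ fun _ hU => zeroExtι_bijective (hU.trans h)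

lemma isIso_zeroExtι_inf (V V' : X.Opens) (M : X.Modules) :
    IsIso ((zeroExtι (V ⊓ V')).app ((zeroExt V).obj ((zeroExt V').obj M))) :=
  isIso_zeroExtι_app fun U s => by
    obtain ⟨W, hW, hU, e⟩ := zeroExtι_mem V s
    obtain ⟨W', hW', hU', e'⟩ := zeroExtι_mem V' (((zeroExtι V).app ((zeroExt V').obj M)).app U s)
    refine ⟨W ⊔ W', sup_le hW hW', fun x hx => ?_, ?_⟩
    · rcases hU hx with h | h
      · rcases hU' hx with h' | h'
        · exact Or.inl ⟨h, h'⟩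
        · exact Or.inr (Or.inr h')
      · exact Or.inr (Or.inl h)
    · refine eq_of_res₂ le_sup_left le_sup_right le_rfl ?_ ?_
      · rw [res_res, e, map_zero]
      · rw [res_res, map_zero]
        apply zeroExtι_injective V
        rw [app_res]
        exact e'.trans (app_zero_sec _ _).symm

lemma isIso_zeroExtι_top (M : X.Modules) : IsIso ((zeroExtι ⊤).app M) :=
  isIso_of_bijective _ fun _ => zeroExtι_bijective le_top

lemma isIso_zeroExtι_zeroQuot_sup (V V' : X.Opens) (M : X.Modules) :
    IsIso ((zeroExtι V').app ((zeroQuot V).obj ((zeroExt (V ⊔ V')).obj M))) :=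
  isIso_zeroExtι_app fun U s => by
    refine (suppSub V' _).local_mem s fun x hx => ?_
    obtain ⟨W, hW, t, hx', e⟩ := locally_surjective_of_epi ((zeroQuotπ V).app _) s hx
    refine ⟨W, hW, hx', ?_⟩
    change Γ((zeroExt (V ⊔ V')).obj M, W) at t
    obtain ⟨W', hW', hU, e'⟩ := zeroExtι_mem (V ⊔ V') t
    refine ⟨W' ⊔ (W ⊓ V), sup_le hW' inf_le_left, fun x hx => ?_, ?_⟩
    · rcases hU hx with (h | h) | h
      · exact Or.inr (Or.inr ⟨hx, h⟩)
      · exact Or.inl h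
      · exact Or.inr (Or.inl h)
    · refine eq_of_res₂ le_sup_left le_sup_right le_rfl ?_ (?_ : _ = _)
      · rw [map_zero, ← e, res_res]
        refine (app_res ((zeroQuotπ V).app ((zeroExt (V ⊔ V')).obj M)) _ t).symm.trans ?_
        exact (congrArg _ e').trans (app_zero_sec _ _)
      · exact (zeroQuot_section_eq_zero V inf_le_right _).trans
          (zeroQuot_section_eq_zero V inf_le_right _).symm

lemma zeroExt_section_eq_zero_of_isZero {M : X.Modules} (h : IsZero M) {U : X.Opens} (s : Γ(M, U)) :
    s = 0 := by
  have : 𝟙 M = 0 := h.eq_of_src _ _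
  exact congr(($this).app U s)

lemma isZero_of_sections {M : X.Modules} (h : ∀ (U : X.Opens) (s : Γ(M, U)), s = 0) : IsZero M := by
  rw [IsZero.iff_id_eq_zero]
  exact hom_ext' fun U s => (h U s).trans (h U _).symm

lemma isZero_zeroExt_bot (M : X.Modules) : IsZero ((zeroExt ⊥).obj M) :=
  isZero_of_sections fun U s => by
    obtain ⟨W, hW, hU, e⟩ := zeroExtι_mem ⊥ s
    rw [bot_sup_eq] at hU
    obtain rfl := le_antisymm hU hW
    simpa using e

end ZeroExtIso

section Extension

variable {X} {V : X.Opens} {M N : X.Modules}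

/-- Extension of a compatible family of maps over the open subsets of `V`: the graph. -/
def ExtGraph (f : ∀ U : X.Opens, U ≤ V → (Γ((zeroExt V).obj M, U) →ₗ[Γ(X, U)] Γ(N, U)))
    {U : X.Opens} (s : Γ((zeroExt V).obj M, U)) (t : Γ(N, U)) : Prop :=
  N.res (inf_le_left : U ⊓ V ≤ U) t = f (U ⊓ V) inf_le_right (((zeroExt V).obj M).res inf_le_left s) ∧
    t ∈ (suppSub V N).sec U

lemma ExtGraph.unique
    {f : ∀ U : X.Opens, U ≤ V → (Γ((zeroExt V).obj M, U) →ₗ[Γ(X, U)] Γ(N, U))}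
    {U : X.Opens} {s : Γ((zeroExt V).obj M, U)} {t t' : Γ(N, U)}
    (h : ExtGraph f s t) (h' : ExtGraph f s t') : t = t' := by
  obtain ⟨W, hW, hU, e⟩ := (suppSub V N).sec U |>.sub_mem h.2 h'.2
  rw [← sub_eq_zero]
  refine eq_of_res₂ inf_le_left hW (le_inf_sup hU) ?_ (e.trans (map_zero _).symm)
  rw [map_sub, h.1, h'.1, sub_self, map_zero]

lemma ExtGraph.exists
    {f : ∀ U : X.Opens, U ≤ V → (Γ((zeroExt V).obj M, U) →ₗ[Γ(X, U)] Γ(N, U))}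
    (hf : ∀ (U U' : X.Opens) (h : U ≤ U') (h' : U' ≤ V) (s : Γ((zeroExt V).obj M, U')),
      f U (h.trans h') (((zeroExt V).obj M).res h s) = N.res h (f U' h' s))
    {U : X.Opens} (s : Γ((zeroExt V).obj M, U)) : ∃ t, ExtGraph f s t := by
  obtain ⟨W, hW, hU, e⟩ := zeroExtι_mem V s
  obtain ⟨t, ht, ht'⟩ := exists_glue₂ (M := N) (inf_le_left : U ⊓ V ≤ U) hW (le_inf_sup hU)
    (f (U ⊓ V) inf_le_right (((zeroExt V).obj M).res inf_le_left s)) 0 (by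
      rw [← hf _ _ inf_le_left inf_le_right, res_res, map_zero,
        ← res_res (inf_le_right : U ⊓ V ⊓ W ≤ W) hW, e, map_zero, map_zero])
  exact ⟨t, ht, W, hW, hU, ht'⟩

/-- Extend a compatible family of maps over the open subsets of `V` to `zeroExt V`. -/
noncomputable def zeroExtDesc
    (f : ∀ U : X.Opens, U ≤ V → (Γ((zeroExt V).obj M, U) →ₗ[Γ(X, U)] Γ(N, U)))
    (hf : ∀ (U U' : X.Opens) (h : U ≤ U') (h' : U' ≤ V) (s : Γ((zeroExt V).obj M, U')),
      f U (h.trans h') (((zeroExt V).obj M).res h s) = N.res h (f U' h' s)) :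
    (zeroExt V).obj M ⟶ N :=
  homMk' (fun U =>
    { toFun s := (ExtGraph.exists hf s).choose
      map_add' s t := ExtGraph.unique (ExtGraph.exists hf (s + t)).choose_spec
        ⟨by simp only [map_add, (ExtGraph.exists hf s).choose_spec.1,
            (ExtGraph.exists hf t).choose_spec.1],
          ((suppSub V N).sec U).add_mem (ExtGraph.exists hf s).choose_spec.2
            (ExtGraph.exists hf t).choose_spec.2⟩
      map_smul' r s := ExtGraph.unique (ExtGraph.exists hf (r • s)).choose_spec
        ⟨by
            simp only [RingHom.id_apply, res_smul, (ExtGraph.exists hf s).choose_spec.1]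
            exact ((f _ _).map_smul _ _).symm,
          ((suppSub V N).sec U).smul_mem r (ExtGraph.exists hf s).choose_spec.2⟩ })
    (fun U U' h s => ExtGraph.unique (ExtGraph.exists hf _).choose_spec
      ⟨by
        change N.res _ (N.res h (ExtGraph.exists hf s).choose) = _
        rw [res_res, res_res,
          ← res_res (inf_le_inf_right V h) (inf_le_left : U' ⊓ V ≤ U'),
          (ExtGraph.exists hf s).choose_spec.1, ← hf _ _ _ inf_le_right, res_res],
        (suppSub V N).res_mem h (ExtGraph.exists hf s).choose_spec.2⟩)

lemma zeroExtDesc_app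
    (f : ∀ U : X.Opens, U ≤ V → (Γ((zeroExt V).obj M, U) →ₗ[Γ(X, U)] Γ(N, U)))
    (hf : ∀ (U U' : X.Opens) (h : U ≤ U') (h' : U' ≤ V) (s : Γ((zeroExt V).obj M, U')),
      f U (h.trans h') (((zeroExt V).obj M).res h s) = N.res h (f U' h' s))
    {U : X.Opens} (hU : U ≤ V) (s : Γ((zeroExt V).obj M, U)) :
    (zeroExtDesc f hf).app U s = f U hU s :=
  ExtGraph.unique (ExtGraph.exists hf s).choose_spec
    ⟨(hf _ _ _ _ _).symm, ⊥, bot_le, hU.trans le_sup_left, section_bot N _ _⟩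

/-- Multiplication by a function on `V`, on the extension by zero of a module. -/
noncomputable def zeroExtActApp (r : Γ(X, V)) (M : X.Modules) :
    (zeroExt V).obj M ⟶ (zeroExt V).obj M :=
  zeroExtDesc (fun U hU =>
      { toFun s := X.presheaf.map (homOfLE hU).op r • s
        map_add' := smul_add _
        map_smul' a s := smul_comm _ _ _ })
    (fun U U' h h' s => by
      simp only [LinearMap.coe_mk, AddHom.coe_mk, res_smul]
      congr 1
      rw [← CategoryTheory.comp_apply, ← Functor.map_comp]
      rfl)

lemma zeroExtActApp_app (r : Γ(X, V)) {U : X.Opens} (hU : U ≤ V) (s : Γ((zeroExt V).obj M, U)) :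
    (zeroExtActApp r M).app U s = X.presheaf.map (homOfLE hU).op r • s :=
  zeroExtDesc_app _ _ hU _

/-- Multiplication by a function on `V`, as an endomorphism of the extension by zero. -/
noncomputable def zeroExtAct (r : Γ(X, V)) : zeroExt V ⟶ zeroExt V where
  app M := zeroExtActApp r M
  naturality M N f := zeroExt_hom_ext fun U hU s => by
    change (zeroExtActApp r N).app U (((zeroExt V).map f).app U s) =
      ((zeroExt V).map f).app U ((zeroExtActApp r M).app U s)
    rw [zeroExtActApp_app r hU, zeroExtActApp_app r hU, Hom.app_smul]

lemma zeroExtAct_app (r : Γ(X, V)) {U : X.Opens} (hU : U ≤ V) (s : Γ((zeroExt V).obj M, U)) :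
    ((zeroExtAct r).app M).app U s = X.presheaf.map (homOfLE hU).op r • s :=
  zeroExtActApp_app r hU s

lemma isIso_zeroExt_zeroExtAct (r : Γ(X, V)) (M : X.Modules) :
    IsIso ((zeroExt (X.basicOpen r)).map ((zeroExtAct r).app M)) :=
  isIso_zeroExt_map _ fun U hU => by
    have h := hU.trans (X.basicOpen_le r)
    have hu : IsUnit (X.presheaf.map (homOfLE h).op r) := by
      have := (RingedSpace.isUnit_res_basicOpen X.toRingedSpace r).map
        (X.presheaf.map (homOfLE hU).op).hom
      have e := congr($(X.presheaf.map_comp (homOfLE (X.basicOpen_le r)).op (homOfLE hU).op) r)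
      exact e ▸ this
    rw [show (((zeroExtAct r).app M).app U : Γ((zeroExt V).obj M, U) → _) =
      fun s => X.presheaf.map (homOfLE h).op r • s from funext (zeroExtAct_app r h)]
    obtain ⟨a, ha⟩ := hu
    rw [← ha]
    exact MulAction.bijective a

end Extension

end AlgebraicGeometry.Scheme.Modules

namespace AlgebraicGeometry.Scheme.Modules

section StructureSheaf

variable {X}

variable (X) in
/-- The structure sheaf as a module. -/
noncomputable def structureModule : X.Modules := SheafOfModules.unit X.ringCatSheaf

/-- A section of the structure sheaf, as an element of the structure sheaf ring. -/
def unitVal {U : X.Opens} : Γ(structureModule X, U) ≃ₗ[Γ(X, U)] Γ(X, U) where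
  toFun s := s
  invFun s := s
  map_add' _ _ := rfl
  map_smul' _ _ := rfl
  left_inv _ := rfl
  right_inv _ := rfl

lemma unitVal_res {U V : X.Opens} (h : U ≤ V) (s : Γ(structureModule X, V)) :
    unitVal (res _ h s) = X.presheaf.map (homOfLE h).op (unitVal s) := rfl

/-- The extension by zero of the structure sheaf of an open subset. -/
noncomputable abbrev zeroExtO (V : X.Opens) : X.Modules :=
  (zeroExt V).obj (structureModule X)

variable (V : X.Opens)

/-- The unit section of `zeroExtO V` over `V`. -/
noncomputable def zeroExtOne : Γ(zeroExtO V, V) :=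
  ((zeroExtι_bijective (M := structureModule X) (le_refl V)).2
    (unitVal.symm 1)).choose

lemma zeroExtι_zeroExtOne : ((zeroExtι V).app (structureModule X)).app V (zeroExtOne V) = unitVal.symm (1 : Γ(X, V)) :=
  ((zeroExtι_bijective (M := structureModule X) (le_refl V)).2
    (unitVal.symm 1)).choose_spec

variable {V}

/-- The value of a section of `zeroExtO V`. -/
noncomputable def zeroExtVal {U : X.Opens} (s : Γ(zeroExtO V, U)) : Γ(X, U) :=
  unitVal (((zeroExtι V).app (structureModule X)).app U s)

lemma zeroExtVal_injective {U : X.Opens} :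
    Function.Injective (zeroExtVal : Γ(zeroExtO V, U) → Γ(X, U)) :=
  unitVal.injective.comp (zeroExtι_injective V _ U)

lemma zeroExtVal_smul {U : X.Opens} (r : Γ(X, U)) (s : Γ(zeroExtO V, U)) :
    zeroExtVal (r • s) = r * zeroExtVal s := by
  unfold zeroExtVal
  rw [Hom.app_smul]
  exact unitVal.map_smul _ _

lemma zeroExtVal_add {U : X.Opens} (r s : Γ(zeroExtO V, U)) :
    zeroExtVal (r + s) = zeroExtVal r + zeroExtVal s := by
  unfold zeroExtVal
  rw [app_add_sec]
  exact unitVal.map_add _ _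

lemma zeroExtVal_res {U U' : X.Opens} (h : U ≤ U') (s : Γ(zeroExtO V, U')) :
    zeroExtVal (res _ h s) = X.presheaf.map (homOfLE h).op (zeroExtVal s) := by
  unfold zeroExtVal
  rw [← unitVal_res, res_zeroExtι]

lemma zeroExtVal_one : zeroExtVal (zeroExtOne V) = 1 := by
  unfold zeroExtVal
  rw [zeroExtι_zeroExtOne, LinearEquiv.apply_symm_apply]

lemma eq_smul_zeroExtOne {U : X.Opens} (h : U ≤ V) (s : Γ(zeroExtO V, U)) :
    s = zeroExtVal s • res _ h (zeroExtOne V) := by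
  apply zeroExtVal_injective
  rw [zeroExtVal_smul, zeroExtVal_res, zeroExtVal_one, map_one, mul_one]

/-- The morphism from `zeroExtO V` determined by a section over `V`. -/
noncomputable def ofSection {N : X.Modules} (n : Γ(N, V)) : zeroExtO V ⟶ N :=
  zeroExtDesc (fun U hU =>
    { toFun s := zeroExtVal s • N.res hU n
      map_add' s t := by rw [zeroExtVal_add, add_smul]
      map_smul' r s := by rw [zeroExtVal_smul, mul_smul, RingHom.id_apply] })
    (fun U U' h h' s => by simp [zeroExtVal_res])

lemma ofSection_app {N : X.Modules} (n : Γ(N, V)) {U : X.Opens} (hU : U ≤ V) (s : Γ(zeroExtO V, U)) :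
    (ofSection n).app U s = zeroExtVal s • N.res hU n :=
  zeroExtDesc_app _ _ hU _

lemma ofSection_one {N : X.Modules} (n : Γ(N, V)) : (ofSection n).app V (zeroExtOne V) = n := by
  rw [ofSection_app n le_rfl, zeroExtVal_one, one_smul, res_rfl]

lemma zeroExtO_hom_ext {N : X.Modules} {f g : zeroExtO V ⟶ N}
    (h : f.app V (zeroExtOne V) = g.app V (zeroExtOne V)) : f = g :=
  zeroExt_hom_ext fun U hU s => by
    rw [eq_smul_zeroExtOne hU s, Hom.app_smul, Hom.app_smul, app_res, app_res, h]

lemma ofSection_comp {N N' : X.Modules} (n : Γ(N, V)) (f : N ⟶ N') :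
    ofSection n ≫ f = ofSection (f.app V n) := by
  refine zeroExtO_hom_ext ?_
  rw [ofSection_one]
  exact congrArg (f.app V) (ofSection_one n)

/-- Morphisms from `zeroExtO V` correspond to sections over `V`. -/
noncomputable def zeroExtOHomEquiv (N : X.Modules) : (zeroExtO V ⟶ N) ≃+ Γ(N, V) where
  toFun f := f.app V (zeroExtOne V)
  invFun n := ofSection n
  left_inv _ := zeroExtO_hom_ext (ofSection_one _)
  right_inv n := ofSection_one n
  map_add' _ _ := rfl

end StructureSheaf

end AlgebraicGeometry.Scheme.Modules

namespace AlgebraicGeometry.Scheme.Modules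

section Grothendieck

lemma presheafOfModules_hasExactColimitsOfShape {C : Type u} [SmallCategory C] (R : Cᵒᵖ ⥤ RingCat.{u})
    (J : Type u) [SmallCategory J] [IsFiltered J] :
    HasExactColimitsOfShape J (_root_.PresheafOfModules.{u} R) :=
  HasExactColimitsOfShape.domain_of_functor J (_root_.PresheafOfModules.toPresheaf R)

instance : HasColimitsOfSize.{u, u} X.Modules :=
  inferInstanceAs (HasColimitsOfSize.{u, u} (SheafOfModules.{u} X.ringCatSheaf))

instance (J : Type u) [SmallCategory J] [IsFiltered J] :
    HasExactColimitsOfShape J X.Modules :=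
  have := presheafOfModules_hasExactColimitsOfShape X.ringCatSheaf.obj J
  (_root_.PresheafOfModules.sheafificationAdjunction (𝟙 X.ringCatSheaf.obj)).hasExactColimitsOfShape J

lemma isSeparator_sigma_zeroExtO : IsSeparator (∐ fun V : X.Opens => zeroExtO V) := by
  rw [isSeparator_sigma]
  intro M N f g h
  refine hom_ext' fun U s => ?_
  have := h (zeroExtO U) (ObjectProperty.ofObj_apply _ U) (ofSection s)
  rw [ofSection_comp, ofSection_comp] at this
  rw [← ofSection_one (f.app U s), this, ofSection_one]

instance : IsGrothendieckAbelian.{u} X.Modules where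
  hasSeparator := ⟨_, isSeparator_sigma_zeroExtO X⟩
  ab5OfSize := ⟨fun _ _ _ => inferInstance⟩

end Grothendieck


end AlgebraicGeometry.Scheme.Modules

section FiniteSupport

variable {C : Type*} [Category* C] [Preadditive C] {J : Type*} (N : J → C) [HasCoproduct N]

/-- The projection of a coproduct to a finite subsum. -/
noncomputable def sigmaTrunc [DecidableEq J] (F : Finset J) : ∐ N ⟶ ∐ N :=
  ∑ j ∈ F, Sigma.π N j ≫ Sigma.ι N j

lemma ι_sigmaTrunc [DecidableEq J] (F : Finset J) (j : J) :
    Sigma.ι N j ≫ sigmaTrunc N F = if j ∈ F then Sigma.ι N j else 0 := by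
  rw [sigmaTrunc, Preadditive.comp_sum]
  have : ∀ i ∈ F, Sigma.ι N j ≫ Sigma.π N i ≫ Sigma.ι N i = if j = i then Sigma.ι N j else 0 := by
    intro i _
    split_ifs with h
    · subst h; rw [Sigma.ι_π_eq_id_assoc]
    · rw [Sigma.ι_π_of_ne_assoc _ h, zero_comp]
  rw [Finset.sum_congr rfl this]
  simp

lemma sigmaTrunc_comp [DecidableEq J] {F G : Finset J} (h : F ⊆ G) :
    sigmaTrunc N F ≫ sigmaTrunc N G = sigmaTrunc N F := by
  conv_lhs => arg 1; rw [sigmaTrunc]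
  rw [Preadditive.sum_comp]
  refine Finset.sum_congr rfl fun j hj => ?_
  rw [Category.assoc, ι_sigmaTrunc, if_pos (h hj)]

end FiniteSupport

section CoproductComparison

variable {T : Type (u + 1)} [Category.{w} T] [Preadditive T] (E : T) {J : Type u} [DecidableEq J]
  (Y : J → T) [HasCoproduct Y]

lemma coproductComparison_of (j : J) (f : E ⟶ Y j) :
    coproductComparison E Y (DirectSum.of (fun j => E ⟶ Y j) j f) = f ≫ Sigma.ι Y j := by
  simp [coproductComparison]

lemma coproductComparison_π (a : DirectSum J (fun j => E ⟶ Y j)) (j : J) :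
    coproductComparison E Y a ≫ Sigma.π Y j = a j := by
  induction a using DirectSum.induction_on with
  | zero => simp
  | of i f =>
    rw [coproductComparison_of, Category.assoc]
    by_cases h : i = j
    · subst h; simp
    · rw [Sigma.ι_π_of_ne _ h, comp_zero, DirectSum.of_eq_of_ne _ _ _ (Ne.symm h)]
  | add a b ha hb => rw [map_add, Preadditive.add_comp, ha, hb, DirectSum.add_apply]

lemma coproductComparison_injective : Function.Injective (coproductComparison E Y) := by
  intro a b h
  refine DFinsupp.ext fun j => ?_
  rw [← coproductComparison_π E Y a j, h]
  exact coproductComparison_π E Y b j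

variable {E Y}

lemma coproductComparison_mem_range {f : E ⟶ ∐ Y} (F : Finset J) (h : f ≫ sigmaTrunc Y F = f) :
    f ∈ Set.range (coproductComparison E Y) := by
  refine ⟨∑ j ∈ F, DirectSum.of (fun j => E ⟶ Y j) j (f ≫ Sigma.π Y j), ?_⟩
  rw [map_sum]
  conv_rhs => rw [← h, sigmaTrunc, Preadditive.comp_sum]
  exact Finset.sum_congr rfl fun j _ => by rw [coproductComparison_of, Category.assoc]

lemma exists_comp_sigmaTrunc {f : E ⟶ ∐ Y} (hf : f ∈ Set.range (coproductComparison E Y)) :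
    ∃ F : Finset J, f ≫ sigmaTrunc Y F = f := by
  obtain ⟨a, rfl⟩ := hf
  induction a using DirectSum.induction_on with
  | zero => exact ⟨∅, by simp⟩
  | of i f => exact ⟨{i}, by rw [coproductComparison_of, Category.assoc, ι_sigmaTrunc]; simp⟩
  | add a b ha hb =>
    obtain ⟨F, hF⟩ := ha
    obtain ⟨G, hG⟩ := hb
    refine ⟨F ∪ G, ?_⟩
    rw [map_add, Preadditive.add_comp, ← hF, ← hG, Category.assoc, Category.assoc,
      sigmaTrunc_comp _ Finset.subset_union_left, sigmaTrunc_comp _ Finset.subset_union_right]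

end CoproductComparison

namespace AlgebraicGeometry.Scheme.Modules

section CoproductSections

variable {X} {J : Type u} [DecidableEq J] (N : J → X.Modules)

/-- The sections of a coproduct which have locally finite support. -/
noncomputable def finSuppSub : (∐ N).LocalSubmodule where
  sec U :=
    { carrier := {s | ∀ x ∈ U, ∃ (W : X.Opens) (hW : W ≤ U) (F : Finset J), x ∈ W ∧
        (sigmaTrunc N F).app W ((∐ N).res hW s) = (∐ N).res hW s}
      zero_mem' x hx := ⟨U, le_rfl, ∅, hx, by simp⟩
      add_mem' {s t} hs ht x hx := by
        obtain ⟨W, hW, F, hx₁, e⟩ := hs x hx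
        obtain ⟨W', hW', F', hx₂, e'⟩ := ht x hx
        refine ⟨W ⊓ W', inf_le_left.trans hW, F ∪ F', ⟨hx₁, hx₂⟩, ?_⟩
        rw [map_add, app_add_sec]
        congr 1
        · rw [← res_res inf_le_left hW, ← e, app_res]
          congr 1
          exact congr(($(sigmaTrunc_comp N (Finset.subset_union_left : F ⊆ F ∪ F'))).app W _)
        · rw [← res_res inf_le_right hW', ← e', app_res]
          congr 1
          exact congr(($(sigmaTrunc_comp N (Finset.subset_union_right : F' ⊆ F ∪ F'))).app W' _)
      smul_mem' r s hs x hx := by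
        obtain ⟨W, hW, F, hx₁, e⟩ := hs x hx
        refine ⟨W, hW, F, hx₁, ?_⟩
        rw [res_smul, Hom.app_smul, e] }
  res_mem {U V} h s hs x hx := by
    obtain ⟨W, hW, F, hx₁, e⟩ := hs x (h hx)
    refine ⟨W ⊓ U, inf_le_right, F, ⟨hx₁, hx⟩, ?_⟩
    rw [res_res, ← res_res inf_le_left hW, app_res, e]
  local_mem {V} s hs x hx := by
    obtain ⟨W, hW, hx₁, h⟩ := hs x hx
    obtain ⟨W', hW', F, hx₂, e⟩ := h x hx₁
    exact ⟨W', hW'.trans hW, F, hx₂, by simpa using e⟩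

lemma mem_finSuppSub {U : X.Opens} (s : Γ(∐ N, U)) : s ∈ (finSuppSub N).sec U := by
  have hι : ∀ (j : J) (U : X.Opens) (t : Γ(N j, U)), (Sigma.ι N j).app U t ∈ (finSuppSub N).sec U :=
    fun j U t x hx => ⟨U, le_rfl, {j}, hx, by
      rw [res_rfl]
      have := ι_sigmaTrunc N {j} j
      rw [if_pos (by simp)] at this
      exact congr(($this).app U t)⟩
  have h : (Sigma.desc fun j => (finSuppSub N).lift (Sigma.ι N j) (hι j)) ≫ (finSuppSub N).ι = 𝟙 _ := by
    ext1 j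
    rw [Category.comp_id, ← Category.assoc, Sigma.ι_desc, LocalSubmodule.lift_ι]
  have := congr(($h).app U s)
  change (finSuppSub N).ι.app U _ = s at this
  rw [← this]
  exact (finSuppSub N).ι_mem _

lemma exists_sigmaTrunc_app {V : X.Opens} (hV : IsCompact (V : Set X)) (s : Γ(∐ N, V)) :
    ∃ F : Finset J, (sigmaTrunc N F).app V s = s := by
  choose W hW F hx e using fun x : V => mem_finSuppSub N s x.1 x.2
  obtain ⟨t, ht⟩ := hV.elim_finite_subcover (fun x : V => (W x : Set X)) (fun x => (W x).2)
    (fun x hx' => Set.mem_iUnion.mpr ⟨⟨x, hx'⟩, hx _⟩)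
  refine ⟨t.biUnion F, eq_of_res_mem fun x hx' => ?_⟩
  obtain ⟨y, hy, hxy⟩ := Set.mem_iUnion₂.mp (ht hx')
  refine ⟨W y, hW y, hxy, ?_⟩
  rw [← app_res, ← e y]
  exact congr(($(sigmaTrunc_comp N (Finset.subset_biUnion_of_mem F hy))).app (W y) _)

lemma coproductComparison_zeroExtO_bijective {V : X.Opens} (hV : IsCompact (V : Set X)) :
    Function.Bijective (coproductComparison (zeroExtO V) N) := by
  refine ⟨coproductComparison_injective _ _, fun f => ?_⟩
  obtain ⟨F, hF⟩ := exists_sigmaTrunc_app N hV (f.app V (zeroExtOne V))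
  exact coproductComparison_mem_range F (zeroExtO_hom_ext hF)

end CoproductSections

end AlgebraicGeometry.Scheme.Modules

section TriangulatedClosure

open Pretriangulated

variable {T : Type*} [Category* T] [HasZeroObject T] [HasShift T ℤ] [Preadditive T]
  [∀ n : ℤ, (shiftFunctor T n).Additive] [Pretriangulated T]

/-- A class of objects of a pretriangulated category is a strictly full triangulated subcategory,
except that it may be empty. -/
structure TriClosed (P : T → Prop) : Prop where
  iso {X Y : T} (e : X ≅ Y) : P X → P Y
  shift {X : T} (n : ℤ) : P X → P (X⟦n⟧)
  ext {t : Triangle T} : t ∈ distTriang T → P t.obj₁ → P t.obj₃ → P t.obj₂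

namespace TriClosed

variable {P : T → Prop}

lemma obj₃ (hP : TriClosed P) {t : Triangle T} (ht : t ∈ distTriang T) (h₁ : P t.obj₁) (h₂ : P t.obj₂) : P t.obj₃ :=
  hP.ext (rot_of_distTriang _ ht) h₂ (hP.shift 1 h₁)

lemma obj₁ (hP : TriClosed P) {t : Triangle T} (ht : t ∈ distTriang T) (h₂ : P t.obj₂) (h₃ : P t.obj₃) : P t.obj₁ :=
  hP.ext (inv_rot_of_distTriang _ ht) (hP.shift (-1) h₃) h₂

lemma of_isZero (hP : TriClosed P) {X Z : T} (hX : P X) (hZ : IsZero Z) : P Z :=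
  hP.iso ((isZero_zero T).iso hZ) (hP.obj₃ (contractible_distinguished X) hX hX)

lemma biprod (hP : TriClosed P) {X Y : T} (hX : P X) (hY : P Y) : P (X ⊞ Y) :=
  hP.ext (binaryBiproductTriangle_distinguished X Y) hX hY

lemma map (hP : TriClosed P) {T' : Type*} [Category* T'] [HasZeroObject T'] [HasShift T' ℤ] [Preadditive T']
    [∀ n : ℤ, (shiftFunctor T' n).Additive] [Pretriangulated T'] (F : T' ⥤ T) [F.CommShift ℤ]
    [F.IsTriangulated] : TriClosed fun X => P (F.obj X) where
  iso e := hP.iso (F.mapIso e)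
  shift n h := hP.iso ((F.commShiftIso n).symm.app _) (hP.shift n h)
  ext ht := hP.ext (F.map_distinguished _ ht)

end TriClosed

lemma triClosed_isZero : TriClosed fun X : T => IsZero X where
  iso e h := h.of_iso e.symm
  shift n h := (shiftFunctor T n).map_isZero h
  ext ht h₁ h₃ := Triangle.isZero₂_of_isZero₁₃ _ ht h₁ h₃

/-- The objects obtained from an object by shifts and extensions. -/
inductive TriSpan (O : T) : T → Prop
  | base : TriSpan O O
  | iso {X Y : T} (e : X ≅ Y) : TriSpan O X → TriSpan O Y
  | shift {X : T} (n : ℤ) : TriSpan O X → TriSpan O (X⟦n⟧)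
  | ext {t : Triangle T} : t ∈ distTriang T → TriSpan O t.obj₁ → TriSpan O t.obj₃ →
      TriSpan O t.obj₂

lemma triSpan_triClosed (O : T) : TriClosed (TriSpan O) := ⟨.iso, .shift, .ext⟩

lemma TriSpan.le {O : T} {P : T → Prop} (hP : TriClosed P) (hO : P O) {X : T} (hX : TriSpan O X) :
    P X := by
  induction hX with
  | base => exact hO
  | iso e _ h => exact hP.iso e h
  | shift n _ h => exact hP.shift n h
  | ext ht _ _ h₁ h₃ => exact hP.ext ht h₁ h₃

/-- The vanishing of all morphisms from the shifts of a variable object to a fixed object. -/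
lemma triClosed_hom_eq_zero (M : T) : TriClosed fun X : T => ∀ (n : ℤ) (f : X⟦n⟧ ⟶ M), f = 0 where
  iso e h n f := by
    rw [← cancel_epi (((shiftFunctor T n).mapIso e).hom), h n (_ ≫ f), comp_zero]
  shift m h n f := by
    rw [← cancel_epi ((shiftFunctorAdd T m n).hom.app _), h _ (_ ≫ f), comp_zero]
  ext {t} ht h₁ h₃ n f := by
    obtain ⟨g, rfl⟩ := Triangle.yoneda_exact₂ _ (Triangle.shift_distinguished _ ht n) f (h₁ n _)
    exact (congrArg (fun g => _ ≫ g) (h₃ n g)).trans comp_zero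

lemma exists_distTriang_of_iso {t : Triangle T} (ht : t ∈ distTriang T) {X Y Z : T}
    (e₁ : t.obj₁ ≅ X) (e₂ : t.obj₂ ≅ Y) (e₃ : t.obj₃ ≅ Z) :
    ∃ (f : X ⟶ Y) (g : Y ⟶ Z) (h : Z ⟶ X⟦(1 : ℤ)⟧), Triangle.mk f g h ∈ distTriang T :=
  ⟨e₁.inv ≫ t.mor₁ ≫ e₂.hom, e₂.inv ≫ t.mor₂ ≫ e₃.hom, e₃.inv ≫ t.mor₃ ≫ e₁.hom⟦1⟧',
    isomorphic_distinguished _ ht _ (Triangle.isoMk _ _ e₁.symm e₂.symm e₃.symm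
      (show (e₁.inv ≫ t.mor₁ ≫ e₂.hom) ≫ e₂.inv = e₁.inv ≫ t.mor₁ by simp)
      (show (e₂.inv ≫ t.mor₂ ≫ e₃.hom) ≫ e₃.inv = e₂.inv ≫ t.mor₂ by simp)
      (show (e₃.inv ≫ t.mor₃ ≫ e₁.hom⟦1⟧') ≫ e₁.inv⟦1⟧' = e₃.inv ≫ t.mor₃ by
        simp [← Functor.map_comp]))⟩

/-- The direct sum of two objects, as a product over the walking pair. -/
noncomputable def piPairIso (f : WalkingPair → T) : ∏ᶜ f ≅ f .left ⊞ f .right :=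
  (HasLimit.isoOfNatIso (diagramIsoPair _) : ∏ᶜ f ≅ f .left ⨯ f .right) ≪≫
    (biprod.isoProd (f .left) (f .right)).symm

lemma exists_biprod_triangle {t s : Triangle T} (ht : t ∈ distTriang T) (hs : s ∈ distTriang T) :
    ∃ (f : t.obj₁ ⊞ s.obj₁ ⟶ t.obj₂ ⊞ s.obj₂) (g : t.obj₂ ⊞ s.obj₂ ⟶ t.obj₃ ⊞ s.obj₃)
      (h : t.obj₃ ⊞ s.obj₃ ⟶ (t.obj₁ ⊞ s.obj₁)⟦(1 : ℤ)⟧), Triangle.mk f g h ∈ distTriang T :=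
  exists_distTriang_of_iso (productTriangle_distinguished
    (fun j : WalkingPair => match j with
      | .left => t
      | .right => s) (by rintro (_ | _) <;> assumption))
    (piPairIso _) (piPairIso _) (piPairIso _)

/-- The direct sum of an object and its shift, which is the cone of its zero endomorphism. -/
noncomputable def addShift (X : T) : T := X ⊞ X⟦(1 : ℤ)⟧

lemma exists_iso_addShift {X Y : T} {g : X ⟶ Y} {h : Y ⟶ X⟦(1 : ℤ)⟧}
    (ht : Triangle.mk (0 : X ⟶ X) g h ∈ distTriang T) : Nonempty (Y ≅ addShift X) :=
  ⟨(exists_iso_binaryBiproduct_of_distTriang _ (rot_of_distTriang _ ht)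
    (show -((0 : X ⟶ X)⟦(1 : ℤ)⟧') = 0 by simp)).choose⟩

lemma exists_addShift_triangle {t : Triangle T} (ht : t ∈ distTriang T) :
    ∃ (f : addShift t.obj₁ ⟶ addShift t.obj₂) (g : addShift t.obj₂ ⟶ addShift t.obj₃)
      (h : addShift t.obj₃ ⟶ (addShift t.obj₁)⟦(1 : ℤ)⟧), Triangle.mk f g h ∈ distTriang T :=
  exists_biprod_triangle ht (Triangle.shift_distinguished _ ht 1)

/-- The iterates of `addShift`. -/
noncomputable def addShifts (X : T) : ℕ → T
  | 0 => X
  | n + 1 => addShift (addShifts X n)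

lemma exists_addShifts_triangle {t : Triangle T} (ht : t ∈ distTriang T) (n : ℕ) :
    ∃ (f : addShifts t.obj₁ n ⟶ addShifts t.obj₂ n) (g : addShifts t.obj₂ n ⟶ addShifts t.obj₃ n)
      (h : addShifts t.obj₃ n ⟶ (addShifts t.obj₁ n)⟦(1 : ℤ)⟧),
      Triangle.mk f g h ∈ distTriang T := by
  induction n with
  | zero => exact ⟨_, _, _, ht⟩
  | succ n ih =>
    obtain ⟨f, g, h, ht'⟩ := ih
    exact exists_addShift_triangle ht'

lemma TriClosed.addShifts {P : T → Prop} (hP : TriClosed P) {X : T} (hX : P X) (n : ℕ) :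
    P (addShifts X n) := by
  induction n with
  | zero => exact hX
  | succ n ih => exact hP.biprod ih (hP.shift 1 ih)

/-- `addShift` commutes with triangulated functors. -/
noncomputable def addShiftMapIso {T' : Type*} [Category* T'] [HasZeroObject T'] [HasShift T' ℤ]
    [Preadditive T'] [∀ n : ℤ, (shiftFunctor T' n).Additive] [Pretriangulated T'] (F : T ⥤ T')
    [F.CommShift ℤ] [F.IsTriangulated] (X : T) : F.obj (addShift X) ≅ addShift (F.obj X) :=
  have := preservesBinaryBiproducts_of_preservesBiproducts F
  F.mapBiprod _ _ ≪≫ biprod.mapIso (Iso.refl _) ((F.commShiftIso (1 : ℤ)).app X)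

/-- The iterates of `addShift` commute with triangulated functors. -/
noncomputable def addShiftsMapIso {T' : Type*} [Category* T'] [HasZeroObject T'] [HasShift T' ℤ]
    [Preadditive T'] [∀ n : ℤ, (shiftFunctor T' n).Additive] [Pretriangulated T'] (F : T ⥤ T')
    [F.CommShift ℤ] [F.IsTriangulated] (X : T) :
    ∀ n : ℕ, F.obj (addShifts X n) ≅ addShifts (F.obj X) n
  | 0 => Iso.refl _
  | n + 1 => addShiftMapIso F _ ≪≫ biprod.mapIso (addShiftsMapIso F X n)
      ((shiftFunctor T' (1 : ℤ)).mapIso (addShiftsMapIso F X n))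

end TriangulatedClosure

section ZeroExtSystem

open Pretriangulated

variable {T : Type*} [Category* T] [HasZeroObject T] [HasShift T ℤ] [Preadditive T]
  [∀ n : ℤ, (shiftFunctor T n).Additive] [Pretriangulated T]
  {ι : Type*} [DistribLattice ι] [BoundedOrder ι]

variable (T ι) in
/-- The formal properties of the functors `j_! j^*`, and of their cones, for the open subsets of a
space. -/
structure ZeroExtSystem where
  /-- The extension by zero of the restriction. -/
  L : ι → T ⥤ T
  /-- The cone of the inclusion of the extension by zero. -/
  C : ι → T ⥤ T
  commShiftL (a : ι) : (L a).CommShift ℤ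
  commShiftC (a : ι) : (C a).CommShift ℤ
  triangL (a : ι) : (L a).IsTriangulated
  triangC (a : ι) : (C a).IsTriangulated
  /-- The inclusion of the extension by zero. -/
  ε (a : ι) : L a ⟶ 𝟭 T
  /-- The projection to the cone. -/
  π (a : ι) : 𝟭 T ⟶ C a
  exists_triangle (a : ι) (P : T) : ∃ δ : (C a).obj P ⟶ ((L a).obj P)⟦(1 : ℤ)⟧,
    Triangle.mk ((ε a).app P) ((π a).app P) δ ∈ distTriang T
  isIso_map_ε {a b : ι} (h : a ≤ b) (P : T) : IsIso ((L a).map ((ε b).app P))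
  isIso_ε_L {a b : ι} (h : a ≤ b) (P : T) : IsIso ((ε b).app ((L a).obj P))
  isIso_ε_inf (a b : ι) (P : T) : IsIso ((ε (a ⊓ b)).app ((L a).obj ((L b).obj P)))
  isIso_ε_top (P : T) : IsIso ((ε ⊤).app P)
  isZero_bot (P : T) : IsZero ((L ⊥).obj P)
  isZero_sup {a b : ι} {P : T} : IsZero ((L a).obj P) → IsZero ((L b).obj P) →
    IsZero ((L (a ⊔ b)).obj P)

namespace ZeroExtSystem

attribute [instance] commShiftL commShiftC triangL triangC

variable (S : ZeroExtSystem T ι)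

/-- The objects supported on an open subset. -/
def Supp (a : ι) (P : T) : Prop := IsIso ((S.ε a).app P)

lemma supp_iff {a : ι} {P : T} : S.Supp a P ↔ IsZero ((S.C a).obj P) := by
  obtain ⟨δ, h⟩ := S.exists_triangle a P
  exact (Triangle.isZero₃_iff_isIso₁ _ h).symm

lemma triClosed_supp (a : ι) : TriClosed (S.Supp a) := by
  have := triClosed_isZero.map (S.C a)
  simpa only [← supp_iff] using this

lemma triClosed_isZero (a : ι) : TriClosed fun P => IsZero ((S.L a).obj P) :=
  _root_.triClosed_isZero.map (S.L a)

variable {S}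

lemma supp_L {a b : ι} (h : a ≤ b) (P : T) : S.Supp b ((S.L a).obj P) := S.isIso_ε_L h P

lemma supp_top (P : T) : S.Supp ⊤ P := S.isIso_ε_top P

/-- Objects are isomorphic to the extension by zero of their restriction to the support. -/
noncomputable def Supp.isoL {a : ι} {P : T} (h : S.Supp a P) : (S.L a).obj P ≅ P :=
  have : IsIso ((S.ε a).app P) := h
  asIso ((S.ε a).app P)

lemma Supp.mono {a b : ι} (hab : a ≤ b) {P : T} (h : S.Supp a P) : S.Supp b P :=
  (S.triClosed_supp b).iso h.isoL (supp_L hab P)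

lemma Supp.L {a : ι} {P : T} (h : S.Supp a P) (b : ι) : S.Supp (b ⊓ a) ((S.L b).obj P) :=
  (S.triClosed_supp _).iso ((S.L b).mapIso h.isoL) (S.isIso_ε_inf b a P)

variable (S) in
/-- Iterated restrictions. -/
noncomputable def mapIso {a b : ι} (h : a ≤ b) (P : T) :
    (S.L a).obj ((S.L b).obj P) ≅ (S.L a).obj P :=
  have := S.isIso_map_ε h P
  asIso ((S.L a).map ((S.ε b).app P))

variable (S) in
/-- Iterated restrictions and intersections. -/
noncomputable def infIso (a b : ι) (P : T) :
    (S.L a).obj ((S.L b).obj P) ≅ (S.L (a ⊓ b)).obj P :=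
  (show S.Supp _ _ from S.isIso_ε_inf a b P).isoL.symm ≪≫ S.mapIso inf_le_left _ ≪≫
    S.mapIso inf_le_right _

lemma isZero_mono {a b : ι} (h : a ≤ b) {P : T} (hP : IsZero ((S.L b).obj P)) :
    IsZero ((S.L a).obj P) :=
  ((S.L a).map_isZero hP).of_iso (S.mapIso h P).symm

lemma isZero_L {a : ι} {P : T} (hP : IsZero ((S.L a).obj P)) (b : ι) :
    IsZero ((S.L a).obj ((S.L b).obj P)) :=
  (isZero_mono inf_le_left hP).of_iso (S.infIso a b P)

lemma isZero_L_C (a : ι) (P : T) : IsZero ((S.L a).obj ((S.C a).obj P)) := by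
  obtain ⟨δ, h⟩ := S.exists_triangle a P
  exact Triangle.isZero₃_of_isIso₁ _ ((S.L a).map_distinguished _ h) (S.isIso_map_ε le_rfl P)

lemma Supp.C {a : ι} {P : T} (h : S.Supp a P) (b : ι) : S.Supp a ((S.C b).obj P) := by
  obtain ⟨δ, hδ⟩ := S.exists_triangle b P
  exact (S.triClosed_supp a).obj₃ hδ ((h.L b).mono inf_le_right) h

lemma Supp.hom_eq_zero {a : ι} {P Z : T} (h : S.Supp a P) (hZ : IsZero ((S.L a).obj Z))
    (f : P ⟶ Z) : f = 0 := by
  have : IsIso ((S.ε a).app P) := h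
  rw [← cancel_epi ((S.ε a).app P)]
  have := (S.ε a).naturality f
  simp only [Functor.id_obj, Functor.id_map] at this
  rw [← this, hZ.eq_of_tgt ((S.L a).map f) 0, zero_comp, comp_zero]

lemma Supp.isZero {a : ι} {P : T} (h : S.Supp a P) (hP : IsZero ((S.L a).obj P)) : IsZero P :=
  hP.of_iso h.isoL.symm

lemma Supp.lift_unique {a : ι} {P M : T} (h : S.Supp a P) {f : P ⟶ (S.L a).obj M}
    (hf : f ≫ (S.ε a).app M = 0) : f = 0 := by
  obtain ⟨δ, hδ⟩ := S.exists_triangle a M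
  obtain ⟨g, rfl⟩ := Triangle.coyoneda_exact₂ _ (inv_rot_of_distTriang _ hδ) f hf
  rw [show g = 0 from h.hom_eq_zero
    ((S.triClosed_isZero a).shift (-1) (isZero_L_C a M)) g]
  exact zero_comp

/-- The cone of the inclusion of the extension by zero is functorial in a unique way. -/
lemma π_cancel {a : ι} {P Z : T} (hZ : IsZero ((S.L a).obj Z)) {f g : (S.C a).obj P ⟶ Z}
    (h : (S.π a).app P ≫ f = (S.π a).app P ≫ g) : f = g := by
  obtain ⟨δ, hδ⟩ := S.exists_triangle a P
  rw [← sub_eq_zero]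
  obtain ⟨k, hk⟩ := Triangle.yoneda_exact₃ _ hδ (f - g)
    (show (S.π a).app P ≫ (f - g) = 0 by rw [Preadditive.comp_sub, sub_eq_zero]; exact h)
  rw [hk, show k = 0 from ((S.triClosed_supp a).shift 1 (supp_L le_rfl P)).hom_eq_zero hZ k]
  exact comp_zero

lemma isIso_of_supp {a : ι} {P Q : T} (hP : S.Supp a P) (hQ : S.Supp a Q) (f : P ⟶ Q)
    (h : IsIso ((S.L a).map f)) : IsIso f := by
  obtain ⟨Z, g, k, ht⟩ := distinguished_cocone_triangle f
  refine (Triangle.isZero₃_iff_isIso₁ _ ht).mp (((S.triClosed_supp a).obj₃ ht hP hQ).isZero ?_)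
  exact Triangle.isZero₃_of_isIso₁ _ ((S.L a).map_distinguished _ ht) h

/-- The union of a finite list of open subsets. -/
def lsup (l : List ι) : ι := l.foldr (· ⊔ ·) ⊥

@[simp] lemma lsup_nil : lsup ([] : List ι) = ⊥ := rfl

@[simp] lemma lsup_cons (a : ι) (l : List ι) : lsup (a :: l) = a ⊔ lsup l := rfl

lemma le_lsup {l : List ι} {a : ι} (h : a ∈ l) : a ≤ lsup l := by
  induction l with
  | nil => simp at h
  | cons b l ih =>
    rcases List.mem_cons.mp h with rfl | h
    · exact le_sup_left
    · exact (ih h).trans le_sup_right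

lemma lsup_le {l : List ι} {b : ι} (h : ∀ a ∈ l, a ≤ b) : lsup l ≤ b := by
  induction l with
  | nil => exact bot_le
  | cons a l ih => exact sup_le (h a (by simp)) (ih fun c hc => h c (by simp [hc]))

lemma lsup_map_inf (l : List ι) (a : ι) : lsup (l.map (a ⊓ ·)) = a ⊓ lsup l := by
  induction l with
  | nil => simp
  | cons b l ih => simp [ih, inf_sup_left]

lemma isZero_lsup {l : List ι} {P : T} (h : ∀ a ∈ l, IsZero ((S.L a).obj P)) :
    IsZero ((S.L (lsup l)).obj P) := by
  induction l with
  | nil => exact S.isZero_bot P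
  | cons a l ih => exact S.isZero_sup (h a (by simp)) (ih fun b hb => h b (by simp [hb]))

lemma Supp.of_isZero {a b : ι} {P : T} (h : S.Supp (a ⊔ b) P) (ha : IsZero ((S.L a).obj P)) :
    S.Supp b P := by
  obtain ⟨δ, hδ⟩ := S.exists_triangle b P
  rw [supp_iff]
  exact (h.C b).isZero (S.isZero_sup ((S.triClosed_isZero a).obj₃ hδ (isZero_L ha b) ha)
    (isZero_L_C b P))

/-- The Mayer-Vietoris principle. -/
lemma mayerVietoris {𝒟 : T → Prop} (h𝒟 : TriClosed 𝒟) {B : Set ι}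
    (hB : ∀ a ∈ B, ∀ b ∈ B, a ⊓ b ∈ B) {P : T} (hP : ∀ b ∈ B, 𝒟 ((S.L b).obj P))
    (h₀ : ∃ X, 𝒟 X) {l : List ι} (hl : ∀ a ∈ l, a ∈ B) : 𝒟 ((S.L (lsup l)).obj P) := by
  obtain ⟨n, hn⟩ : ∃ n, l.length = n := ⟨_, rfl⟩
  induction n generalizing l with
  | zero =>
    obtain rfl := List.eq_nil_of_length_eq_zero hn
    exact h𝒟.of_isZero h₀.choose_spec (S.isZero_bot P)
  | succ n ih =>
    obtain ⟨a, l, rfl⟩ := List.exists_cons_of_length_eq_add_one hn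
    simp only [List.length_cons, Nat.add_right_cancel_iff] at hn
    have hl' : ∀ b ∈ l, b ∈ B := fun b hb => hl b (by simp [hb])
    have ha : a ∈ B := hl a (by simp)
    set Q := (S.L (lsup (a :: l))).obj P
    have e (b : ι) (hb : b ≤ a ⊔ lsup l) : (S.L b).obj Q ≅ (S.L b).obj P := S.mapIso hb P
    obtain ⟨δ, hδ⟩ := S.exists_triangle a Q
    have hC : S.Supp (lsup l) ((S.C a).obj Q) :=
      Supp.of_isZero (Supp.C (supp_L le_rfl P) a) (isZero_L_C a Q)
    have hla : 𝒟 ((S.L (lsup l)).obj ((S.L a).obj Q)) := by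
      refine h𝒟.iso ((S.L _).mapIso (e a le_sup_left) ≪≫ S.infIso _ _ _).symm ?_
      rw [inf_comm, ← lsup_map_inf]
      refine ih (fun b hb => ?_) (by simpa using hn)
      obtain ⟨c, hc, rfl⟩ := List.mem_map.mp hb
      exact hB a ha c (hl' c hc)
    exact h𝒟.ext hδ (h𝒟.iso (e a le_sup_left).symm (hP a ha)) (h𝒟.iso hC.isoL
      (h𝒟.obj₃ ((S.L (lsup l)).map_distinguished _ hδ) hla
        (h𝒟.iso (e _ le_sup_right).symm (ih hl' hn))))

end ZeroExtSystem

end ZeroExtSystem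

section Chart

open Pretriangulated

variable {T : Type*} [Category* T] [HasZeroObject T] [HasShift T ℤ] [Preadditive T]
  [∀ n : ℤ, (shiftFunctor T n).Additive] [Pretriangulated T]
  {ι : Type*} [DistribLattice ι] [BoundedOrder ι]

lemma exists_extension {t : Triangle T} (ht : t ∈ distTriang T) {S : T} (e : t.obj₁ ⟶ S)
    (h : t.mor₃ ≫ e⟦(1 : ℤ)⟧' = 0) : ∃ e' : t.obj₂ ⟶ S, t.mor₁ ≫ e' = e := by
  obtain ⟨g, hg⟩ := Triangle.yoneda_exact₃ _ (rot_of_distTriang _ ht) (e⟦(1 : ℤ)⟧') h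
  obtain ⟨g, rfl⟩ := (shiftFunctor T (1 : ℤ)).map_surjective g
  have key (g : t.obj₂ ⟶ S) : (shiftFunctor T (1 : ℤ)).map (t.mor₁ ≫ (-g)) =
      (-(shiftFunctor T (1 : ℤ)).map t.mor₁) ≫ (shiftFunctor T (1 : ℤ)).map g := by
    rw [Preadditive.comp_neg, Functor.map_neg, Functor.map_comp, Preadditive.neg_comp]
  exact ⟨-g, (shiftFunctor T (1 : ℤ)).map_injective ((key g).trans hg.symm)⟩

namespace ZeroExtSystem

/-- The principal open subsets of an affine open subset `v`, and the action of its functions. -/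
structure Chart (S : ZeroExtSystem T ι) (v : ι) where
  /-- The functions on `v`. -/
  G : Type*
  /-- The principal open subsets. -/
  D : G → ι
  D_le (g : G) : D g ≤ v
  exists_top : ∃ g, D g = v
  exists_inf (g h : G) : ∃ k, D k = D g ⊓ D h
  exists_list {a : ι} (h : a ≤ v) : ∃ l : List G, lsup (l.map D) = a
  /-- The action of the functions on objects supported on `v`. -/
  m (g : G) : S.L v ⟶ S.L v
  isIso_m (g : G) (P : T) : IsIso ((S.L (D g)).map ((m g).app P))

variable {S : ZeroExtSystem T ι}

lemma Supp.eq_of_comp_ε {a : ι} {P M : T} (h : S.Supp a P) {f g : P ⟶ (S.L a).obj M}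
    (hf : f ≫ (S.ε a).app M = g ≫ (S.ε a).app M) : f = g := by
  rw [← sub_eq_zero]
  apply h.lift_unique
  rw [Preadditive.sub_comp, hf, sub_self]

lemma Supp.isoL_inv_naturality {a : ι} {P Q : T} (hP : S.Supp a P) (hQ : S.Supp a Q) (f : P ⟶ Q) :
    hP.isoL.inv ≫ (S.L a).map f = f ≫ hQ.isoL.inv := by
  rw [Iso.inv_comp_eq, ← Category.assoc, Iso.eq_comp_inv]
  exact (S.ε a).naturality f

lemma Supp.isoL_hom {a : ι} {P : T} (h : S.Supp a P) : h.isoL.hom = (S.ε a).app P := rfl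

namespace Chart

variable {v : ι} (c : S.Chart v)

/-- The powers of the action of a function. -/
def pow (g : c.G) (k : ℕ) : S.L v ⟶ S.L v := (show End (S.L v) from c.m g) ^ k

lemma pow_zero (g : c.G) (P : T) : (c.pow g 0).app P = 𝟙 _ := rfl

lemma pow_add (g : c.G) (k l : ℕ) (P : T) :
    (c.pow g (k + l)).app P = (c.pow g k).app P ≫ (c.pow g l).app P := by
  rw [pow, add_comm k l, _root_.pow_add, End.mul_def]
  rfl

lemma pow_one (g : c.G) : c.pow g 1 = c.m g := _root_.pow_one (show End (S.L v) from c.m g)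

lemma isIso_map_pow (g : c.G) (k : ℕ) (P : T) :
    IsIso ((S.L (c.D g)).map ((c.pow g k).app P)) := by
  induction k with
  | zero => rw [pow_zero]; infer_instance
  | succ k ih =>
    have := c.isIso_m g P
    rw [pow_add, pow_one, Functor.map_comp]
    infer_instance

/-- All morphisms from shifts of `Y` to shifts of `M` are annihilated by a power of the
function `g`. -/
def Kill (g : c.G) (M Y : T) : Prop :=
  ∀ (n p : ℤ) (f : (S.L v).obj (Y⟦n⟧) ⟶ M⟦p⟧), ∃ k, (c.pow g k).app (Y⟦n⟧) ≫ f = 0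

lemma triClosed_kill_left (g : c.G) (M : T) : TriClosed (c.Kill g M) where
  iso {X Y} e h n p f := by
    obtain ⟨k, hk⟩ := h n p ((S.L v).map (e.hom⟦n⟧') ≫ f)
    refine ⟨k, ?_⟩
    rw [← cancel_epi ((S.L v).map (e.hom⟦n⟧')), comp_zero, ← hk, NatTrans.naturality_assoc]
  shift {X} m h n p f := by
    obtain ⟨k, hk⟩ := h _ p ((S.L v).map ((shiftFunctorAdd T m n).hom.app X) ≫ f)
    refine ⟨k, ?_⟩
    rw [← cancel_epi ((S.L v).map ((shiftFunctorAdd T m n).hom.app X)), comp_zero, ← hk]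
    exact (c.pow g k).naturality_assoc _ f
  ext {t} ht h₁ h₃ n p f := by
    have ht' := (S.L v).map_distinguished _ (Triangle.shift_distinguished _ ht n)
    obtain ⟨k, hk⟩ := h₁ n p ((S.L v).map (((Triangle.shiftFunctor T n).obj t).mor₁) ≫ f)
    obtain ⟨f', hf'⟩ := Triangle.yoneda_exact₂ _ ht' ((c.pow g k).app _ ≫ f)
      (((c.pow g k).naturality_assoc ((Triangle.shiftFunctor T n).obj t).mor₁ f).trans hk)
    obtain ⟨l, hl⟩ := h₃ n p f'
    refine ⟨l + k, ?_⟩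
    rw [pow_add, Category.assoc]
    refine (congrArg (fun x => _ ≫ x) hf').trans ?_
    refine (((c.pow g l).naturality_assoc
      ((Triangle.shiftFunctor T n).obj t).mor₂ f').symm.trans ?_)
    exact (congrArg (fun x => _ ≫ x) hl).trans comp_zero

lemma triClosed_kill_right (g : c.G) (Y : T) : TriClosed fun M => c.Kill g M Y where
  iso {M N} e h n p f := by
    obtain ⟨k, hk⟩ := h n p (f ≫ e.inv⟦p⟧')
    refine ⟨k, ?_⟩
    rw [← cancel_mono (e.inv⟦p⟧'), zero_comp, ← hk, Category.assoc]
  shift {M} m h n p f := by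
    obtain ⟨k, hk⟩ := h n _ (f ≫ (shiftFunctorAdd T m p).inv.app M)
    refine ⟨k, ?_⟩
    rw [← cancel_mono ((shiftFunctorAdd T m p).inv.app M), zero_comp, ← hk, Category.assoc]
  ext {t} ht h₁ h₃ n p f := by
    have ht' := Triangle.shift_distinguished _ ht p
    obtain ⟨k, hk⟩ := h₃ n p (f ≫ ((Triangle.shiftFunctor T p).obj t).mor₂)
    obtain ⟨f', hf'⟩ := Triangle.coyoneda_exact₂ _ ht' ((c.pow g k).app _ ≫ f)
      ((Category.assoc _ _ _).trans hk)
    obtain ⟨l, hl⟩ := h₁ n p f'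
    refine ⟨l + k, ?_⟩
    rw [pow_add, Category.assoc]
    refine (congrArg (fun x => _ ≫ x) hf').trans ((Category.assoc _ _ _).symm.trans ?_)
    exact (congrArg (fun x => x ≫ _) hl).trans zero_comp

lemma kill_of_supp {g : c.G} {a : ι} {M Y : T} (hY : S.Supp a Y) (hM : IsZero ((S.L a).obj M)) :
    c.Kill g M Y := fun n p f => ⟨0, by
  rw [(((S.triClosed_supp a).shift n hY).L v |>.mono inf_le_right).hom_eq_zero
    ((S.triClosed_isZero a).shift p hM) f, comp_zero]⟩

/-- Objects `P` such that morphisms from `L (D g) P` to `M` extend to `P` after multiplication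
by a power of `g`. -/
def Tors (g : c.G) (M P : T) : Prop := c.Kill g M ((S.C (c.D g)).obj P)

lemma triClosed_tors_left (g : c.G) (M : T) : TriClosed (c.Tors g M) :=
  (c.triClosed_kill_left g M).map (S.C (c.D g))

lemma triClosed_tors_right (g : c.G) (P : T) : TriClosed fun M => c.Tors g M P :=
  c.triClosed_kill_right g _

lemma tors_L_iff {g : c.G} {a : ι} {M P : T} (hP : S.Supp a P) :
    c.Tors g ((S.L a).obj M) P ↔ c.Tors g M P := by
  obtain ⟨δ, hδ⟩ := S.exists_triangle a M
  have := c.kill_of_supp (g := g) (hP.C (c.D g)) (isZero_L_C a M)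
  exact ⟨fun h => (c.triClosed_tors_right g P).ext hδ h this,
    fun h => (c.triClosed_tors_right g P).obj₁ hδ h this⟩

lemma kill_of_tors {g : c.G} {M P : T} (h : c.Tors g M P) (hP : IsZero ((S.L (c.D g)).obj P)) :
    c.Kill g M P := by
  obtain ⟨δ, hδ⟩ := S.exists_triangle (c.D g) P
  have : IsIso ((S.π (c.D g)).app P) := (Triangle.isZero₁_iff_isIso₂ _ hδ).mp hP
  exact (c.triClosed_kill_left g M).iso (asIso ((S.π (c.D g)).app P)).symm h

/-- The action of a power of a function on an object supported on `v`. -/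
noncomputable def act (g : c.G) (k : ℕ) {P : T} (hP : S.Supp v P) : P ⟶ P :=
  hP.isoL.inv ≫ (c.pow g k).app P ≫ (S.ε v).app P

lemma act_naturality (g : c.G) (k : ℕ) {P Q : T} (hP : S.Supp v P) (hQ : S.Supp v Q) (f : P ⟶ Q) :
    c.act g k hP ≫ f = f ≫ c.act g k hQ := by
  rw [act, act, Category.assoc, Category.assoc, ← reassoc_of% Supp.isoL_inv_naturality hP hQ f,
    (c.pow g k).naturality_assoc, (S.ε v).naturality f]
  rfl

lemma act_naturality_assoc (g : c.G) (k : ℕ) {P Q R : T} (hP : S.Supp v P) (hQ : S.Supp v Q)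
    (f : P ⟶ Q) (h : Q ⟶ R) : c.act g k hP ≫ f ≫ h = f ≫ c.act g k hQ ≫ h := by
  rw [← Category.assoc, act_naturality c g k hP hQ, Category.assoc]

lemma act_zero (g : c.G) {P : T} (hP : S.Supp v P) : c.act g 0 hP = 𝟙 P := by
  rw [act, pow_zero, Category.id_comp]
  exact hP.isoL.inv_hom_id

lemma act_succ (g : c.G) (k : ℕ) {P : T} (hP : S.Supp v P) :
    c.act g (k + 1) hP = c.act g 1 hP ≫ c.act g k hP := by
  simp only [act, Category.assoc]
  rw [add_comm, pow_add, ← hP.isoL_hom, hP.isoL.hom_inv_id_assoc, Category.assoc]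

lemma isIso_map_act (g : c.G) (k : ℕ) {P : T} (hP : S.Supp v P) :
    IsIso ((S.L (c.D g)).map (c.act g k hP)) := by
  have := c.isIso_map_pow g k P
  have : IsIso ((S.ε v).app P) := hP
  rw [act, Functor.map_comp, Functor.map_comp]
  infer_instance

lemma Kill.exists_act_comp_eq_zero {c : S.Chart v} {g : c.G} {M P : T} (h : c.Kill g M P)
    (hP : S.Supp v P) (p : ℤ) (f : P ⟶ M⟦p⟧) : ∃ k, c.act g k hP ≫ f = 0 := by
  let e := (shiftFunctorZero T ℤ).app P
  have hP' : S.Supp v (P⟦(0 : ℤ)⟧) := (S.triClosed_supp v).shift 0 hP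
  obtain ⟨k, hk⟩ := h 0 p ((S.ε v).app _ ≫ e.hom ≫ f)
  refine ⟨k, ?_⟩
  rw [← cancel_epi e.hom, ← act_naturality_assoc c g k hP' hP, act, Category.assoc, Category.assoc]
  exact (congrArg (fun x => _ ≫ x) hk).trans (comp_zero.trans comp_zero.symm)

/-- Morphisms on a principal open extend after multiplication by a power of the function. -/
lemma exists_act_comp_eq {g : c.G} {M P : T} (h : c.Tors g M P) (hP : S.Supp v P)
    (hP' : S.Supp v ((S.L (c.D g)).obj P)) (f : (S.L (c.D g)).obj P ⟶ M) :
    ∃ (k : ℕ) (f' : P ⟶ M), c.act g k hP' ≫ f = (S.ε (c.D g)).app P ≫ f' := by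
  obtain ⟨δ, hδ⟩ := S.exists_triangle (c.D g) P
  have hδ' := inv_rot_of_distTriang _ hδ
  have hZ : S.Supp v (((S.C (c.D g)).obj P)⟦(-1 : ℤ)⟧) :=
    (S.triClosed_supp v).shift (-1) (hP.C _)
  let j : ((S.C (c.D g)).obj P)⟦(-1 : ℤ)⟧ ⟶ (S.L (c.D g)).obj P :=
    (Triangle.mk ((S.ε (c.D g)).app P) ((S.π (c.D g)).app P) δ).invRotate.mor₁
  obtain ⟨k, hk⟩ := Kill.exists_act_comp_eq_zero ((c.triClosed_kill_left g M).shift (-1) h) hZ 0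
    (j ≫ f ≫ (shiftFunctorZero T ℤ).inv.app M)
  refine ⟨k, Triangle.yoneda_exact₂ _ hδ' (c.act g k hP' ≫ f)
    (show j ≫ c.act g k hP' ≫ f = 0 from ?_)⟩
  rw [← act_naturality_assoc c g k hZ hP' j, ← cancel_mono ((shiftFunctorZero T ℤ).inv.app M),
    zero_comp, ← hk]
  simp only [Category.assoc]

end Chart

end ZeroExtSystem

end Chart

section Extension

open Pretriangulated

variable {T : Type*} [Category* T] [HasZeroObject T] [HasShift T ℤ] [Preadditive T]
  [∀ n : ℤ, (shiftFunctor T n).Additive] [Pretriangulated T]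
  {ι : Type*} [DistribLattice ι] [BoundedOrder ι]

lemma nonempty_iso₂ {t s : Triangle T} (ht : t ∈ distTriang T) (hs : s ∈ distTriang T)
    (e₁ : t.obj₁ ≅ s.obj₁) (e₃ : t.obj₃ ≅ s.obj₃)
    (h : t.mor₃ ≫ e₁.hom⟦(1 : ℤ)⟧' = e₃.hom ≫ s.mor₃) : Nonempty (t.obj₂ ≅ s.obj₂) := by
  obtain ⟨b, hb, hb'⟩ := complete_distinguished_triangle_morphism₂ _ _ ht hs e₁.hom e₃.hom h
  have : IsIso b := isIso₂_of_isIso₁₃ (Triangle.homMk t s e₁.hom b e₃.hom hb hb' h) ht hs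
    (inferInstanceAs (IsIso e₁.hom)) (inferInstanceAs (IsIso e₃.hom))
  exact ⟨asIso b⟩

lemma nonempty_iso₃ {t s : Triangle T} (ht : t ∈ distTriang T) (hs : s ∈ distTriang T)
    (e₁ : t.obj₁ ≅ s.obj₁) (e₂ : t.obj₂ ≅ s.obj₂)
    (h : t.mor₁ ≫ e₂.hom = e₁.hom ≫ s.mor₁) : Nonempty (t.obj₃ ≅ s.obj₃) := by
  obtain ⟨c, hc, hc'⟩ := complete_distinguished_triangle_morphism _ _ ht hs e₁.hom e₂.hom h
  have : IsIso c := isIso₃_of_isIso₁₂ (Triangle.homMk t s e₁.hom e₂.hom c h hc hc') ht hs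
    (inferInstanceAs (IsIso e₁.hom)) (inferInstanceAs (IsIso e₂.hom))
  exact ⟨asIso c⟩

namespace ZeroExtSystem

variable (S : ZeroExtSystem T ι)

/-- The objects built from the extension by zero of the object `O`. -/
def Fin (O : T) (a : ι) : T → Prop := TriSpan ((S.L a).obj O)

variable {S} {O : T}

lemma fin_triClosed (a : ι) : TriClosed (S.Fin O a) := triSpan_triClosed _

lemma Fin.L {a b : ι} {P : T} (hP : S.Fin O a P) (h : b ≤ a) : S.Fin O b ((S.L b).obj P) :=
  TriSpan.le ((fin_triClosed b).map (S.L b)) ((fin_triClosed b).iso (S.mapIso h O).symm .base) hP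

lemma Fin.supp {a : ι} {P : T} (hP : S.Fin O a P) : S.Supp a P :=
  TriSpan.le (S.triClosed_supp a) (supp_L le_rfl O) hP

lemma L_naturality {a : ι} {P Q : T} (f : P ⟶ Q) :
    (S.L a).map f ≫ (S.ε a).app Q = (S.ε a).app P ≫ f := (S.ε a).naturality f

lemma π_naturality {a : ι} {P Q : T} (f : P ⟶ Q) :
    (S.π a).app P ≫ (S.C a).map f = f ≫ (S.π a).app Q := ((S.π a).naturality f).symm

namespace Chart

variable {v : ι} (c : S.Chart v)

lemma kill_of_isZero {g : c.G} {M Y : T} (hY : IsZero Y) : c.Kill g M Y := fun n _ _ =>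
  ⟨0, (((S.L v).map_isZero ((shiftFunctor T n).map_isZero hY)).eq_of_src _ _)⟩

lemma map_L_act (g : c.G) (k : ℕ) {P : T} (hP : S.Supp v P) {w : ι}
    (hP' : S.Supp v ((S.L w).obj P)) : (S.L w).map (c.act g k hP) = c.act g k hP' := by
  refine (supp_L le_rfl P).eq_of_comp_ε ?_
  rw [L_naturality]
  exact (c.act_naturality g k hP' hP ((S.ε w).app P)).symm

lemma map_C_act (g : c.G) (k : ℕ) {P : T} (hP : S.Supp v P) {w : ι}
    (hP' : S.Supp v ((S.C w).obj P)) : (S.C w).map (c.act g k hP) = c.act g k hP' := by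
  refine π_cancel (isZero_L_C w P) ?_
  rw [π_naturality]
  exact c.act_naturality g k hP hP' ((S.π w).app P)

/-- The finite type extension property of morphisms from opens contained in `w`. -/
def Good (O : T) (w : ι) (M : T) : Prop :=
  ∀ g h, c.D h ≤ w → c.Tors g M ((S.L (c.D h)).obj O)

variable {c}

lemma Good.tors_L {w : ι} {M : T} (hM : c.Good O w M) (g : c.G) {P : T} {l : List c.G}
    (hl : ∀ h ∈ l, c.D h ≤ w ∧ S.Fin O (c.D h) ((S.L (c.D h)).obj P)) :
    c.Tors g M ((S.L (lsup (l.map c.D))).obj P) := by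
  refine mayerVietoris (B := {a | ∃ h, c.D h = a ∧ ∃ i ∈ l, c.D h ≤ c.D i})
    (c.triClosed_tors_left g M) ?_ ?_
    ⟨_, c.kill_of_isZero ((S.C _).map_isZero (isZero_zero T))⟩ ?_
  · rintro _ ⟨h, rfl, i, hi, hhi⟩ _ ⟨h', rfl, -⟩
    obtain ⟨k, hk⟩ := c.exists_inf h h'
    exact ⟨k, hk, i, hi, hk ▸ inf_le_left.trans hhi⟩
  · rintro _ ⟨h, rfl, i, hi, hhi⟩
    have := Fin.L (hl i hi).2 hhi
    exact TriSpan.le (c.triClosed_tors_left g M) (hM g h (hhi.trans (hl i hi).1))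
      ((fin_triClosed _).iso (S.mapIso hhi P) this)
  · intro a ha
    obtain ⟨h, hh, rfl⟩ := List.mem_map.mp ha
    exact ⟨h, rfl, h, hh, le_rfl⟩

lemma good_of_locally (hO : c.Good O v O) {F : T} {l : List c.G}
    (hl : ∀ h ∈ l, S.Fin O (c.D h) ((S.L (c.D h)).obj F)) :
    c.Good O (lsup (l.map c.D)) F := by
  intro g h hh
  have key : c.Tors g F ((S.L (lsup ((l.map c.D).map (c.D h ⊓ ·)))).obj O) := by
    refine mayerVietoris (B := {a | ∃ h, c.D h = a ∧ ∃ i ∈ l, c.D h ≤ c.D i})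
      (c.triClosed_tors_left g F) ?_ ?_
      ⟨_, c.kill_of_isZero ((S.C _).map_isZero (isZero_zero T))⟩ ?_
    · rintro _ ⟨h, rfl, i, hi, hhi⟩ _ ⟨h', rfl, -⟩
      obtain ⟨k, hk⟩ := c.exists_inf h h'
      exact ⟨k, hk, i, hi, hk ▸ inf_le_left.trans hhi⟩
    · rintro _ ⟨h, rfl, i, hi, hhi⟩
      rw [← c.tors_L_iff (supp_L hhi O)]
      refine TriSpan.le (c.triClosed_tors_right g _) ?_ (hl i hi)
      rw [c.tors_L_iff (supp_L hhi O)]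
      exact hO g h (c.D_le h)
    · intro a ha
      rw [List.map_map] at ha
      obtain ⟨i, hi, rfl⟩ := List.mem_map.mp ha
      obtain ⟨k, hk⟩ := c.exists_inf h i
      exact ⟨k, hk, i, hi, hk ▸ inf_le_right⟩
  rwa [lsup_map_inf, inf_eq_left.mpr hh] at key

lemma Good.tors {M : T} (hM : c.Good O v M) (g : c.G) {R : T} (hR : S.Fin O v R) :
    c.Tors g M R := by
  obtain ⟨h, hh⟩ := c.exists_top
  exact TriSpan.le (c.triClosed_tors_left g M) (by simpa only [hh] using hM g h (c.D_le h)) hR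

lemma Good.kill_C {M : T} (hM : c.Good O v M) {g : c.G} {w : ι} (hg : c.D g ≤ w) (hw : w ≤ v)
    {R : T} (hR : S.Fin O v R) : c.Kill g M ((S.C w).obj R) := by
  obtain ⟨δ, hδ⟩ := S.exists_triangle w R
  obtain ⟨l, rfl⟩ := c.exists_list hw
  refine c.kill_of_tors ((c.triClosed_tors_left g M).obj₃ hδ ?_ (hM.tors g hR))
    (isZero_mono hg (isZero_L_C _ R))
  exact hM.tors_L g fun h _ => ⟨c.D_le h, hR.L (c.D_le h)⟩

lemma Good.shift {w : ι} {M : T} (hM : c.Good O w M) (n : ℤ) : c.Good O w (M⟦n⟧) :=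
  fun g h hh => (c.triClosed_tors_right g _).shift n (hM g h hh)

lemma Good.of_fin (hO : c.Good O v O) {M : T} (hM : S.Fin O v M) : c.Good O v M := by
  obtain ⟨h, hh⟩ := c.exists_top
  have := good_of_locally (l := [h]) hO (F := M) (by simpa using hM.L (c.D_le h))
  simpa [hh] using this

lemma exists_cone_act (g : c.G) (k : ℕ) {R : T} (hR : S.Fin O v R) :
    ∃ (R₁ : T) (q : R ⟶ R₁) (δ : R₁ ⟶ R⟦(1 : ℤ)⟧),
      Triangle.mk (c.act g k hR.supp) q δ ∈ distTriang T ∧ S.Fin O v R₁ ∧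
      IsZero ((S.L (c.D g)).obj R₁) ∧
      ∀ a, IsZero ((S.L a).obj R) → IsZero ((S.L a).obj R₁) := by
  obtain ⟨R₁, q, δ, ht⟩ := distinguished_cocone_triangle (c.act g k hR.supp)
  exact ⟨R₁, q, δ, ht, (fin_triClosed v).obj₃ ht hR hR,
    Triangle.isZero₃_of_isIso₁ _ ((S.L _).map_distinguished _ ht) (c.isIso_map_act g k _),
    fun a ha => (S.triClosed_isZero a).obj₃ ht ha ha⟩

lemma Good.exists_factor {M : T} (hM : c.Good O v M) {w : ι} (hw : w ≤ v) (l : List c.G)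
    (hl : ∀ g ∈ l, c.D g ≤ w) {R : T} (hR : S.Fin O v R) (f : (S.C w).obj R ⟶ M) :
    ∃ (R₁ : T) (q : R ⟶ R₁), S.Fin O v R₁ ∧ (∀ g ∈ l, IsZero ((S.L (c.D g)).obj R₁)) ∧
      (∀ a, IsZero ((S.L a).obj R) → IsZero ((S.L a).obj R₁)) ∧
      ∃ f₁, f = (S.C w).map q ≫ f₁ := by
  induction l generalizing R with
  | nil => exact ⟨R, 𝟙 R, hR, by simp, fun _ => id, f, by simp⟩
  | cons g l ih =>
    obtain ⟨k, hk⟩ := Kill.exists_act_comp_eq_zero (hM.kill_C (hl g (by simp)) hw hR)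
      (hR.supp.C w) 0 (f ≫ (shiftFunctorZero T ℤ).inv.app M)
    rw [← Category.assoc, ← c.map_C_act g k hR.supp, ← zero_comp (f := (shiftFunctorZero T ℤ).inv.app M), cancel_mono] at hk
    obtain ⟨R₁, q, δ, ht, hR₁, h₀, hz⟩ := exists_cone_act g k hR
    obtain ⟨f₁, hf₁⟩ := Triangle.yoneda_exact₂ _ ((S.C w).map_distinguished _ ht) f hk
    obtain ⟨R₂, q', hR₂, h₀', hz', f₂, rfl⟩ := ih (fun g hg => hl g (by simp [hg])) hR₁ f₁
    refine ⟨R₂, q ≫ q', hR₂, ?_, fun a ha => hz' a (hz a ha), f₂, ?_⟩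
    · intro h hh
      rcases List.mem_cons.mp hh with rfl | hh
      · exact hz' _ h₀
      · exact h₀' h hh
    · rw [Functor.map_comp, Category.assoc]
      exact hf₁

lemma Good.exists_extension {M : T} (hM : c.Good O v M) {w : ι} (hw : w ≤ v) {R : T}
    (hR : S.Fin O v R) (e : (S.L w).obj R ⟶ M) :
    ∃ (R' : T) (s : R' ⟶ R) (e' : R' ⟶ M), S.Fin O v R' ∧ IsIso ((S.L w).map s) ∧
      (S.ε w).app R' ≫ e' = (S.L w).map s ≫ e := by
  obtain ⟨l, hl⟩ := c.exists_list hw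
  obtain ⟨δ, hδ⟩ := S.exists_triangle w R
  obtain ⟨R₁, q, hR₁, h₀, -, f₁, hf₁⟩ := (hM.shift 1).exists_factor hw l
    (fun g hg => (le_lsup (List.mem_map_of_mem hg)).trans hl.le) hR (δ ≫ e⟦(1 : ℤ)⟧')
  obtain ⟨R', s, γ, ht⟩ := distinguished_cocone_triangle₁ q
  have hz : IsZero ((S.L w).obj R₁) := hl ▸ isZero_lsup fun a ha => by
    obtain ⟨g, hg, rfl⟩ := List.mem_map.mp ha
    exact h₀ g hg
  obtain ⟨δ', hδ'⟩ := S.exists_triangle w R'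
  obtain ⟨ψ, hψ, hψ'⟩ := complete_distinguished_triangle_morphism _ _ hδ' hδ
    ((S.L w).map s) s (L_naturality s).symm
  obtain rfl : ψ = (S.C w).map s := π_cancel (isZero_L_C w R) (hψ.trans (π_naturality s).symm)
  have h₂ : δ' ≫ ((S.L w).map s ≫ e)⟦(1 : ℤ)⟧' = 0 := by
    rw [Functor.map_comp, ← Category.assoc,
      show δ' ≫ ((S.L w).map s)⟦(1 : ℤ)⟧' = (S.C w).map s ≫ δ from hψ', Category.assoc, hf₁, ← Category.assoc, ← Functor.map_comp,
      show s ≫ q = 0 from comp_distTriang_mor_zero₁₂ _ ht, Functor.map_zero, zero_comp]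
  obtain ⟨e', he'⟩ := _root_.exists_extension hδ' ((S.L w).map s ≫ e) h₂
  exact ⟨R', s, e', (fin_triClosed v).obj₁ ht hR hR₁,
    (Triangle.isZero₃_iff_isIso₁ _ ((S.L w).map_distinguished _ ht)).mp hz, he'⟩

/-- The restrictions to `w` of finite type objects are closed under extensions. -/
lemma exists_L_iso_of_triangle (hO : c.Good O v O) {w : ι} (hw : w ≤ v) {t : Triangle T}
    (ht : t ∈ distTriang T)
    {Q₁ Q₃ : T} (h₁ : S.Fin O v Q₁) (h₃ : S.Fin O v Q₃) (e₁ : (S.L w).obj Q₁ ≅ t.obj₁)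
    (e₃ : (S.L w).obj Q₃ ≅ t.obj₃) :
    ∃ Q₂, S.Fin O v Q₂ ∧ Nonempty ((S.L w).obj Q₂ ≅ t.obj₂) := by
  let γ : (S.L w).obj Q₃ ⟶ (S.L w).obj (Q₁⟦(1 : ℤ)⟧) :=
    e₃.hom ≫ t.mor₃ ≫ e₁.inv⟦(1 : ℤ)⟧' ≫ ((S.L w).commShiftIso (1 : ℤ)).inv.app Q₁
  obtain ⟨R, s, e', hR, hs, he'⟩ := ((Good.of_fin hO h₁).shift 1).exists_extension hw h₃
    (γ ≫ (S.ε w).app _)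
  have key : (S.L w).map e' = (S.L w).map s ≫ γ := (supp_L le_rfl R).eq_of_comp_ε (by
    rw [L_naturality, he']
    exact (Category.assoc _ _ _).symm)
  let es : (S.L w).obj R ≅ (S.L w).obj Q₃ := asIso ((S.L w).map s)
  obtain ⟨Q₂, f, g, hQ⟩ := distinguished_cocone_triangle₂ e'
  refine ⟨Q₂, (fin_triClosed v).ext hQ h₁ hR,
    nonempty_iso₂ ((S.L w).map_distinguished _ hQ) ht e₁ (es ≪≫ e₃) ?_⟩
  exact (show ((S.L w).map e' ≫ ((S.L w).commShiftIso (1 : ℤ)).hom.app Q₁) ≫ e₁.hom⟦(1 : ℤ)⟧' =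
    ((S.L w).map s ≫ e₃.hom) ≫ t.mor₃ by simp [key, γ, ← Functor.map_comp])

lemma exists_L_iso_of_fin (hO : c.Good O v O) {w : ι} (hw : w ≤ v) {F : T} (hF : S.Fin O w F) :
    ∃ Q, S.Fin O v Q ∧ Nonempty ((S.L w).obj Q ≅ F) := by
  induction hF with
  | base => exact ⟨_, .base, ⟨S.mapIso hw O⟩⟩
  | iso e _ h =>
    obtain ⟨Q, hQ, ⟨e'⟩⟩ := h
    exact ⟨Q, hQ, ⟨e' ≪≫ e⟩⟩
  | shift n _ h =>
    obtain ⟨Q, hQ, ⟨e'⟩⟩ := h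
    exact ⟨_, hQ.shift n, ⟨((S.L w).commShiftIso n).app Q ≪≫ (shiftFunctor T n).mapIso e'⟩⟩
  | ext ht _ _ h₁ h₃ =>
    obtain ⟨Q₁, hQ₁, ⟨e₁⟩⟩ := h₁
    obtain ⟨Q₃, hQ₃, ⟨e₃⟩⟩ := h₃
    exact exists_L_iso_of_triangle hO hw ht hQ₁ hQ₃ e₁ e₃

/-- The obstruction to the extension of a finite type object to an affine open vanishes after the
addition of sufficiently many shifts. -/
theorem exists_addShifts_iso (hO : c.Good O v O) (l : List c.G) {F : T}
    (hF : S.Supp (lsup (l.map c.D)) F)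
    (hl : ∀ g ∈ l, S.Fin O (c.D g) ((S.L (c.D g)).obj F)) :
    ∃ (N : ℕ) (Q : T), S.Fin O v Q ∧
      Nonempty ((S.L (lsup (l.map c.D))).obj Q ≅ addShifts F N) := by
  induction l generalizing F with
  | nil =>
    exact ⟨0, _, .base, ⟨(S.isZero_bot _).iso ((S.isZero_bot F).of_iso hF.isoL.symm)⟩⟩
  | cons g l ih =>
    have hw : lsup ((g :: l).map c.D) ≤ v := lsup_le fun a ha => by
      obtain ⟨h, -, rfl⟩ := List.mem_map.mp ha
      exact c.D_le h
    have hD (h) (hh : h ∈ g :: l) : c.D h ≤ lsup ((g :: l).map c.D) :=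
      le_lsup (List.mem_map_of_mem hh)
    have hl' : ∀ h ∈ l, h ∈ g :: l := fun h hh => by simp [hh]
    have hwl : lsup ((g :: l).map c.D) = c.D g ⊔ lsup (l.map c.D) := rfl
    have hG : c.Good O _ F := good_of_locally hO hl
    generalize hw_def : lsup ((g :: l).map c.D) = w at *
    obtain ⟨R, hR, ⟨e⟩⟩ := exists_L_iso_of_fin hO (c.D_le g) (hl g (by simp))
    have hRw : c.Tors g F ((S.L w).obj R) := by
      have := hG.tors_L g (P := R) (l := g :: l)
        fun h hh => ⟨hD h hh, hR.L (c.D_le h)⟩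
      rwa [hw_def] at this
    have hRv : S.Supp v ((S.L w).obj R) := supp_L hw R
    have hRg : S.Supp v ((S.L (c.D g)).obj ((S.L w).obj R)) := supp_L (c.D_le g) _
    let eg : (S.L (c.D g)).obj ((S.L w).obj R) ≅ (S.L (c.D g)).obj F :=
      S.mapIso (hD g (by simp)) R ≪≫ e
    obtain ⟨k, a, ha⟩ := c.exists_act_comp_eq hRw hRv hRg (eg.hom ≫ (S.ε (c.D g)).app F)
    have ha' : IsIso ((S.L (c.D g)).map a) := by
      have h₁ : IsIso (c.act g k hRg) :=
        isIso_of_supp (supp_L le_rfl _) (supp_L le_rfl _) _ (c.isIso_map_act g k hRg)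
      have : (S.L (c.D g)).map a = c.act g k hRg ≫ eg.hom := (supp_L le_rfl _).eq_of_comp_ε (by
        rw [L_naturality, ← ha, Category.assoc])
      rw [this]
      infer_instance
    obtain ⟨Z, b, δ, ht⟩ := distinguished_cocone_triangle a
    have hZg : IsZero ((S.L (c.D g)).obj Z) :=
      Triangle.isZero₃_of_isIso₁ _ ((S.L (c.D g)).map_distinguished _ ht) ha'
    have hZ : S.Supp (lsup (l.map c.D)) Z :=
      ((S.triClosed_supp _).obj₃ ht (supp_L hwl.le R) (hwl ▸ hF)).of_isZero hZg
    have hZl : ∀ h ∈ l, S.Fin O (c.D h) ((S.L (c.D h)).obj Z) := fun h hh =>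
      ((fin_triClosed (c.D h)).map (S.L (c.D h))).obj₃ ht
        ((fin_triClosed (c.D h)).iso (S.mapIso (hD h (hl' h hh)) R).symm (hR.L (c.D_le h)))
        (hl h (hl' h hh))
    obtain ⟨N, Q₁, hQ₁, ⟨e₁⟩⟩ := ih hZ hZl
    have hw₁ : lsup (l.map c.D) ≤ w := hwl.symm ▸ le_sup_right
    have hGZ : c.Good O _ Z := good_of_locally hO hZl
    generalize hw₁_def : lsup (l.map c.D) = w₁ at *
    have hZZ : c.Tors g Z Z := by
      have := hGZ.tors_L g (P := Z) (l := l) fun h hh =>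
        ⟨hw₁_def ▸ le_lsup (List.mem_map_of_mem hh), hZl h hh⟩
      rw [hw₁_def] at this
      exact (c.triClosed_tors_left g Z).iso hZ.isoL this
    have hA : c.Kill g (addShifts Z N) (addShifts Z N) :=
      (c.triClosed_kill_left g _).addShifts
        ((c.triClosed_kill_right g _).addShifts (c.kill_of_tors hZZ hZg) N) N
    have hAv : S.Supp v (addShifts Z N) :=
      (S.triClosed_supp v).addShifts (hZ.mono (hw₁.trans hw)) N
    obtain ⟨k, hk⟩ := Kill.exists_act_comp_eq_zero hA hAv 0 ((shiftFunctorZero T ℤ).inv.app _)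
    rw [← zero_comp (f := (shiftFunctorZero T ℤ).inv.app (addShifts Z N))] at hk
    replace hk := (cancel_mono _).mp hk
    obtain ⟨Q₂, q, δ', hQ, hQ₂, hQ₂g, -⟩ := exists_cone_act g k hQ₁
    obtain ⟨A', f', g', hA'⟩ := distinguished_cocone_triangle (0 : addShifts Z N ⟶ addShifts Z N)
    obtain ⟨eA⟩ := exists_iso_addShift hA'
    obtain ⟨eQ⟩ := nonempty_iso₃ ((S.L w₁).map_distinguished _ hQ) hA' e₁ e₁ (by
      refine Eq.trans ?_ comp_zero.symm
      have hs : S.Supp v ((S.L w₁).obj Q₁) := supp_L (hw₁.trans hw) Q₁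
      exact (show (S.L w₁).map (c.act g k hQ₁.supp) ≫ e₁.hom = 0 by
        rw [c.map_L_act g k hQ₁.supp hs, c.act_naturality g k hs hAv, hk, comp_zero]))
    have hQ₂w : S.Supp w₁ ((S.L w).obj Q₂) :=
      Supp.of_isZero (supp_L hwl.le Q₂) (isZero_L hQ₂g w)
    obtain ⟨f₁, f₂, f₃, hs⟩ := exists_addShifts_triangle ht (N + 1)
    obtain ⟨Q, hQ, ⟨eF⟩⟩ := exists_L_iso_of_triangle hO hw hs
      ((fin_triClosed v).addShifts hR (N + 1)) hQ₂ (addShiftsMapIso (S.L w) R (N + 1))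
      (hQ₂w.isoL.symm ≪≫ S.mapIso hw₁ Q₂ ≪≫ eQ ≪≫ eA)
    exact ⟨N + 1, Q, hQ, ⟨eF⟩⟩

end Chart

end ZeroExtSystem

end Extension

section Generator

open Pretriangulated

variable {T : Type*} [Category* T] [HasShift T ℤ] [Preadditive T]
  [∀ n : ℤ, (shiftFunctor T n).Additive]

/-- The vanishing of all morphisms to the shifts of `M`. -/
def LeftOrth (M X : T) : Prop := ∀ (p : ℤ) (f : X ⟶ M⟦p⟧), f = 0

lemma leftOrth_iff (M X : T) : LeftOrth M X ↔ ∀ (n : ℤ) (f : X⟦n⟧ ⟶ M), f = 0 := by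
  refine ⟨fun h n f => ?_, fun h n f => ?_⟩
  · apply (shiftFunctor T (-n)).map_injective
    rw [← cancel_epi ((shiftFunctorCompIsoId T n (-n) (by simp)).inv.app X), Functor.map_zero,
      comp_zero]
    exact h _ _
  · apply (shiftFunctor T (-n)).map_injective
    rw [← cancel_mono ((shiftFunctorCompIsoId T n (-n) (by simp)).hom.app M), Functor.map_zero,
      zero_comp]
    exact h _ _

variable [HasZeroObject T] [Pretriangulated T] {ι : Type*} [DistribLattice ι] [BoundedOrder ι]

lemma triClosed_leftOrth (M : T) : TriClosed (LeftOrth M) := by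
  have := triClosed_hom_eq_zero M
  simpa only [← leftOrth_iff] using this

lemma LeftOrth.of_biprod {M X Y : T} (h : LeftOrth M (X ⊞ Y)) : LeftOrth M X ∧ LeftOrth M Y :=
  ⟨fun p f => by rw [← biprod.inl_desc f (0 : Y ⟶ _), h p (biprod.desc f 0), comp_zero],
    fun p f => by rw [← biprod.inr_desc (0 : X ⟶ _) f, h p (biprod.desc 0 f), comp_zero]⟩

lemma LeftOrth.of_addShifts {M X : T} {n : ℕ} (h : LeftOrth M (addShifts X n)) :
    LeftOrth M X := by
  induction n with
  | zero => exact h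
  | succ n ih => exact ih (LeftOrth.of_biprod h).1

namespace ZeroExtSystem

variable {S : ZeroExtSystem T ι} {O : T}

namespace Chart

variable {v : ι} {c : S.Chart v}

/-- Koszul objects generate the complement of the union of finitely many principal opens. -/
lemma exists_koszul {w : ι} (hw : w ≤ v) (l : List c.G) (hl : ∀ g ∈ l, c.D g ≤ w)
    {R : T} (hR : S.Fin O v R) :
    ∃ K, S.Fin O v K ∧ (∀ g ∈ l, IsZero ((S.L (c.D g)).obj K)) ∧
      (∀ a, IsZero ((S.L a).obj R) → IsZero ((S.L a).obj K)) ∧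
      ∀ M, c.Good O v M → LeftOrth M ((S.C w).obj K) → LeftOrth M ((S.C w).obj R) := by
  induction l generalizing R with
  | nil => exact ⟨R, hR, by simp, fun _ => id, fun _ _ => id⟩
  | cons g l ih =>
    obtain ⟨R₁, q, δ, ht, hR₁, h₀, hz⟩ := exists_cone_act g 1 hR
    obtain ⟨K, hK, h₀', hz', h⟩ := ih (fun g hg => hl g (by simp [hg])) hR₁
    refine ⟨K, hK, ?_, fun a ha => hz' a (hz a ha), fun M hM hMK p f => ?_⟩
    · intro h hh
      rcases List.mem_cons.mp hh with rfl | hh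
      · exact hz' _ h₀
      · exact h₀' h hh
    obtain ⟨k, hk⟩ := Kill.exists_act_comp_eq_zero (hM.kill_C (hl g (by simp)) hw hR)
      (hR.supp.C w) p f
    induction k with
    | zero => rwa [act_zero, Category.id_comp] at hk
    | succ k ih =>
      refine ih ?_
      rw [act_succ, Category.assoc, ← c.map_C_act g 1 hR.supp] at hk
      obtain ⟨f', hf'⟩ := Triangle.yoneda_exact₂ _ ((S.C w).map_distinguished _ ht) _ hk
      rw [h M hM hMK p f'] at hf'
      exact hf'.trans comp_zero

end Chart

/-- The objects which are locally of finite type on `a`. -/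
def LocFin (S : ZeroExtSystem T ι) (O : T) (a : ι) (P : T) : Prop :=
  ∃ l : List ι, lsup l = a ∧ ∀ b ∈ l, S.Fin O b ((S.L b).obj P)

lemma lsup_append (l l' : List ι) : lsup (l ++ l') = lsup l ⊔ lsup l' := by
  induction l with
  | nil => simp
  | cons a l ih => simp [ih, sup_assoc]

lemma LocFin.exists_list {a v : ι} {P : T} (hP : S.LocFin O a P) (c : S.Chart v) :
    ∃ l : List c.G, lsup (l.map c.D) = a ⊓ v ∧ ∀ g ∈ l, S.Fin O (c.D g) ((S.L (c.D g)).obj P) := by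
  obtain ⟨l, rfl, hl⟩ := hP
  induction l with
  | nil => exact ⟨[], by simp, by simp⟩
  | cons b l ih =>
    obtain ⟨l₂, h₂, h₂'⟩ := ih fun b hb => hl b (by simp [hb])
    obtain ⟨l₁, h₁⟩ := c.exists_list (inf_le_right : b ⊓ v ≤ v)
    refine ⟨l₁ ++ l₂, ?_, fun g hg => ?_⟩
    · rw [List.map_append, lsup_append, h₁, h₂, lsup_cons, inf_sup_right]
    · rcases List.mem_append.mp hg with hg | hg
      · have hgb : c.D g ≤ b :=
          (le_lsup (List.mem_map_of_mem hg)).trans (h₁.le.trans inf_le_left)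
        exact (fin_triClosed _).iso (S.mapIso hgb P) ((hl b (by simp)).L hgb)
      · exact h₂' g hg

/-- Locally finite type objects belong to any triangulated subcategory containing all extensions
by zero of the structure object. -/
lemma LocFin.mem {P : T} (hP : S.LocFin O ⊤ P) {𝒦 : T → Prop} (h𝒦 : TriClosed 𝒦)
    (hO : ∀ a, 𝒦 ((S.L a).obj O)) : 𝒦 P := by
  obtain ⟨l, hl, hl'⟩ := hP
  have := mayerVietoris (S := S) (P := P) (l := l) h𝒦 (B := {b | ∃ a ∈ l, b ≤ a})
    (fun a ⟨c, hc, hac⟩ _ _ => ⟨c, hc, inf_le_left.trans hac⟩)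
    (fun b ⟨a, ha, hba⟩ => h𝒦.iso (S.mapIso hba P) (TriSpan.le h𝒦 (hO b) ((hl' a ha).L hba)))
    ⟨_, hO ⊤⟩ (fun a ha => ⟨a, ha, le_rfl⟩)
  rw [hl] at this
  exact h𝒦.iso (supp_top P).isoL this

/-- Gluing along the union of an open subset with an affine open subset. -/
lemma exists_glue {U v : ι} (c : S.Chart v) (hO : c.Good O v O) {P : T} (hP : S.Supp U P)
    (hP' : S.LocFin O U P) :
    ∃ P' : T, S.Supp (v ⊔ U) P' ∧ S.LocFin O (v ⊔ U) P' ∧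
      ∀ M, c.Good O v M → (LeftOrth M ((S.L v).obj O) → IsZero ((S.L v).obj M)) →
        (LeftOrth M P → IsZero ((S.L U).obj M)) → LeftOrth M P' →
          IsZero ((S.L (v ⊔ U)).obj M) := by
  obtain ⟨l, hlw, hl⟩ := hP'.exists_list c
  have hD (g) (hg : g ∈ l) : c.D g ≤ U ⊓ v := hlw ▸ le_lsup (List.mem_map_of_mem hg)
  obtain ⟨N, Q, hQ, ⟨e⟩⟩ := Chart.exists_addShifts_iso hO l (F := (S.L (U ⊓ v)).obj P)
    (hlw ▸ supp_L le_rfl P)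
    fun g hg => (fin_triClosed _).iso (S.mapIso (hD g hg) P).symm (hl g hg)
  rw [hlw] at e
  obtain ⟨K, hK, hK₀, -, hKM⟩ := Chart.exists_koszul (c := c) (w := U ⊓ v) inf_le_right l hD
    (R := (S.L v).obj O) .base
  set W := U ⊓ v
  have hKW : IsZero ((S.L W).obj K) := hlw ▸ isZero_lsup fun a ha => by
    obtain ⟨g, hg, rfl⟩ := List.mem_map.mp ha
    exact hK₀ g hg
  set P₁ := addShifts P N
  have hP₁ : S.Supp U P₁ := (S.triClosed_supp U).addShifts hP N
  let u : (S.L W).obj Q ⟶ P₁ := (e ≪≫ (addShiftsMapIso (S.L W) P N).symm).hom ≫ (S.ε W).app P₁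
  obtain ⟨δ, hδ⟩ := S.exists_triangle W Q
  obtain ⟨E, i, p, hE⟩ := distinguished_cocone_triangle₂ (δ ≫ u⟦(1 : ℤ)⟧')
  have hCQ : S.Supp v ((S.C W).obj Q) := hQ.supp.C W
  have hCQU : IsZero ((S.L U).obj ((S.C W).obj Q)) :=
    Supp.isZero (hCQ.L U) (isZero_L (isZero_L_C W Q) U)
  have hKU : IsZero ((S.L U).obj K) := Supp.isZero (hK.supp.L U) (isZero_L hKW U)
  have hKC (M : T) (h : LeftOrth M K) : LeftOrth M ((S.C W).obj K) := by
    obtain ⟨δ, hδ⟩ := S.exists_triangle W K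
    have : IsIso ((S.π W).app K) := (Triangle.isZero₁_iff_isIso₂ _ hδ).mp hKW
    exact (triClosed_leftOrth M).iso (asIso ((S.π W).app K)) h
  have hu : IsIso ((S.L v).map u) := by
    obtain ⟨δ, hδ⟩ := S.exists_triangle W P₁
    have : IsIso ((S.L v).map ((S.ε W).app P₁)) :=
      (Triangle.isZero₃_iff_isIso₁ _ ((S.L v).map_distinguished _ hδ)).mp
        (Supp.isZero ((hP₁.C W).L v) (isZero_L (inf_comm U v ▸ isZero_L_C W P₁) v))
    rw [Functor.map_comp]
    infer_instance
  let eu : (S.L v).obj ((S.L W).obj Q) ≅ (S.L v).obj P₁ := @asIso _ _ _ _ ((S.L v).map u) hu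
  obtain ⟨eV⟩ := nonempty_iso₂ ((S.L v).map_distinguished _ hδ) ((S.L v).map_distinguished _ hE)
    eu (Iso.refl _)
    (show ((S.L v).map δ ≫ ((S.L v).commShiftIso (1 : ℤ)).hom.app _) ≫
        ((S.L v).map u)⟦(1 : ℤ)⟧' = 𝟙 _ ≫ (S.L v).map (δ ≫ u⟦(1 : ℤ)⟧') ≫
        ((S.L v).commShiftIso (1 : ℤ)).hom.app _ by simp)
  have hi : IsIso ((S.L U).map i) :=
    (Triangle.isZero₃_iff_isIso₁ _ ((S.L U).map_distinguished _ hE)).mp hCQU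
  let eU : (S.L U).obj P₁ ≅ (S.L U).obj E := asIso ((S.L U).map i)
  refine ⟨E ⊞ K, ?_, ?_, fun M hM hv hU h => ?_⟩
  · have hs := S.triClosed_supp (v ⊔ U)
    exact hs.biprod (hs.ext hE (hP₁.mono le_sup_right) (hCQ.mono le_sup_left))
      (hK.supp.mono le_sup_left)
  · obtain ⟨l', hl', hPl'⟩ := hP'
    have hT (a : ι) : TriClosed fun Y => S.Fin O a ((S.L a).obj Y) := (fin_triClosed a).map (S.L a)
    refine ⟨v :: l', by rw [lsup_cons, hl'], fun a ha => ?_⟩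
    rcases List.mem_cons.mp ha with rfl | ha
    · refine (hT a).biprod ((fin_triClosed _).iso eV ?_) (hK.L le_rfl)
      exact hQ.L le_rfl
    · have haU : a ≤ U := hl' ▸ le_lsup ha
      refine (hT a).biprod ((fin_triClosed a).iso
        ((S.mapIso haU P₁).symm ≪≫ (S.L a).mapIso eU ≪≫ S.mapIso haU E) ?_)
        ((fin_triClosed a).of_isZero .base (isZero_mono haU hKU))
      exact (hT a).addShifts (hPl' a ha) N
  · obtain ⟨hME, hMK⟩ := h.of_biprod
    have hO' : LeftOrth M ((S.C W).obj ((S.L v).obj O)) := hKM M hM (hKC M hMK)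
    have hQ' : LeftOrth M ((S.C W).obj Q) :=
      TriSpan.le ((triClosed_leftOrth M).map (S.C W)) hO' hQ
    have hMU : IsZero ((S.L U).obj M) :=
      hU ((triClosed_leftOrth M).obj₁ hE hME hQ').of_addShifts
    refine S.isZero_sup (hv ?_) hMU
    obtain ⟨δ, hδ⟩ := S.exists_triangle W ((S.L v).obj O)
    refine (triClosed_leftOrth M).ext hδ (fun p f => ?_) hO'
    exact (supp_L le_rfl _ : S.Supp W _).hom_eq_zero
      ((S.triClosed_isZero W).shift p (isZero_mono inf_le_left hMU)) f

/-- The existence of a locally finite type generator. -/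
theorem exists_locFin_generator (𝓜 : T → Prop) (l : List ι)
    (hl : ∀ v ∈ l, ∃ c : S.Chart v, c.Good O v O ∧ ∀ M, 𝓜 M → c.Good O v M ∧
      (LeftOrth M ((S.L v).obj O) → IsZero ((S.L v).obj M))) :
    ∃ P : T, S.Supp (lsup l) P ∧ S.LocFin O (lsup l) P ∧
      ∀ M, 𝓜 M → LeftOrth M P → IsZero ((S.L (lsup l)).obj M) := by
  induction l with
  | nil =>
    exact ⟨(S.L ⊥).obj O, supp_L le_rfl O, ⟨[], rfl, by simp⟩, fun M _ _ => S.isZero_bot M⟩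
  | cons v l ih =>
    obtain ⟨P, hP, hP', hPM⟩ := ih fun v hv => hl v (by simp [hv])
    obtain ⟨c, hO, hc⟩ := hl v (by simp)
    obtain ⟨P', hS, hF, h⟩ := exists_glue c hO hP hP'
    exact ⟨P', hS, hF, fun M hM => h M (hc M hM).1 (hc M hM).2 (hPM M hM)⟩

end ZeroExtSystem

end Generator

section ExactEndofunctor

open Pretriangulated DerivedCategory

variable {C : Type*} [Category* C] [Abelian C]
  {F G : C ⥤ C} [F.Additive] [PreservesFiniteLimits F] [PreservesFiniteColimits F]
  [G.Additive] [PreservesFiniteLimits G] [PreservesFiniteColimits G]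

/-- The endofunctor of cochain complexes induced by an additive endofunctor. -/
noncomputable abbrev CategoryTheory.Functor.cx (F : C ⥤ C) [F.Additive] :
    CochainComplex C ℤ ⥤ CochainComplex C ℤ :=
  F.mapHomologicalComplex (ComplexShape.up ℤ)

/-- The transformation of complexes induced by a transformation to the identity. -/
@[simps]
noncomputable def counitCx (ε : F ⟶ 𝟭 C) : F.cx ⟶ 𝟭 _ where
  app K :=
    { f := fun n => ε.app (K.X n)
      comm' := fun i j _ => (ε.naturality (K.d i j)).symm }
  naturality K L f := by
    ext n
    exact ε.naturality (f.f n)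

/-- The transformation of complexes induced by a transformation from the identity. -/
@[simps]
noncomputable def unitCx (π : 𝟭 C ⟶ F) : 𝟭 _ ⟶ F.cx where
  app K :=
    { f := fun n => π.app (K.X n)
      comm' := fun i j _ => (π.naturality (K.d i j)).symm }
  naturality K L f := by
    ext n
    exact π.naturality (f.f n)

variable [HasDerivedCategory C]

lemma isIso_Q_map {K L : CochainComplex C ℤ} (f : K ⟶ L) (h : ∀ n, IsIso (f.f n)) :
    IsIso (Q.map f) := by
  have := HomologicalComplex.Hom.isIso_of_components f
  infer_instance

lemma isZero_Q_obj {K : CochainComplex C ℤ} (h : ∀ n, IsZero (K.X n)) : IsZero (Q.obj K) := by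
  rw [IsZero.iff_id_eq_zero, ← Q.map_id, show 𝟙 K = 0 by
    ext n; exact (h n).eq_of_src _ _, Functor.map_zero]

/-- The counit induced on the derived category. -/
noncomputable def counitD (ε : F ⟶ 𝟭 C) : F.mapDerivedCategory ⟶ 𝟭 (DerivedCategory C) :=
  letI : Localization.Lifting Q (HomologicalComplex.quasiIso C (ComplexShape.up ℤ)) Q
    (𝟭 (DerivedCategory C)) := ⟨Functor.rightUnitor _⟩
  Localization.liftNatTrans Q (HomologicalComplex.quasiIso C (ComplexShape.up ℤ))
    (F.cx ⋙ Q) Q _ _ (Functor.whiskerRight (counitCx ε) Q)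

lemma counitD_app (ε : F ⟶ 𝟭 C) (K : CochainComplex C ℤ) :
    (counitD ε).app (Q.obj K) =
      F.mapDerivedCategoryFactors.hom.app K ≫ Q.map ((counitCx ε).app K) := by
  let : Localization.Lifting Q (HomologicalComplex.quasiIso C (ComplexShape.up ℤ)) Q
    (𝟭 (DerivedCategory C)) := ⟨Functor.rightUnitor _⟩
  refine (Localization.liftNatTrans_app Q (HomologicalComplex.quasiIso C (ComplexShape.up ℤ))
    (F.cx ⋙ Q) Q _ _ (Functor.whiskerRight (counitCx ε) Q) K).trans ?_
  exact congrArg (F.mapDerivedCategoryFactors.hom.app K ≫ ·) (Category.comp_id _)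

/-- The unit induced on the derived category. -/
noncomputable def unitD (π : 𝟭 C ⟶ F) : 𝟭 (DerivedCategory C) ⟶ F.mapDerivedCategory :=
  letI : Localization.Lifting Q (HomologicalComplex.quasiIso C (ComplexShape.up ℤ)) Q
    (𝟭 (DerivedCategory C)) := ⟨Functor.rightUnitor _⟩
  Localization.liftNatTrans Q (HomologicalComplex.quasiIso C (ComplexShape.up ℤ))
    Q (F.cx ⋙ Q) _ _ (Functor.whiskerRight (unitCx π) Q)

lemma unitD_app (π : 𝟭 C ⟶ F) (K : CochainComplex C ℤ) :
    (unitD π).app (Q.obj K) =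
      Q.map ((unitCx π).app K) ≫ F.mapDerivedCategoryFactors.inv.app K := by
  let : Localization.Lifting Q (HomologicalComplex.quasiIso C (ComplexShape.up ℤ)) Q
    (𝟭 (DerivedCategory C)) := ⟨Functor.rightUnitor _⟩
  refine (Localization.liftNatTrans_app Q (HomologicalComplex.quasiIso C (ComplexShape.up ℤ))
    Q (F.cx ⋙ Q) _ _ (Functor.whiskerRight (unitCx π) Q) K).trans ?_
  exact Category.id_comp _

/-- The transformation induced on the derived category. -/
noncomputable def mapNatD (α : F ⟶ G) : F.mapDerivedCategory ⟶ G.mapDerivedCategory :=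
  Localization.liftNatTrans Q (HomologicalComplex.quasiIso C (ComplexShape.up ℤ))
    (F.cx ⋙ Q) (G.cx ⋙ Q) _ _ (Functor.whiskerRight (α.mapHomologicalComplex _) Q)

lemma mapNatD_app (α : F ⟶ G) (K : CochainComplex C ℤ) :
    (mapNatD α).app (Q.obj K) = F.mapDerivedCategoryFactors.hom.app K ≫
      Q.map ((α.mapHomologicalComplex _).app K) ≫ G.mapDerivedCategoryFactors.inv.app K :=
  Localization.liftNatTrans_app Q (HomologicalComplex.quasiIso C (ComplexShape.up ℤ))
    (F.cx ⋙ Q) (G.cx ⋙ Q) _ _ (Functor.whiskerRight (α.mapHomologicalComplex _) Q) K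

lemma exists_Q_obj_iso (P : DerivedCategory C) : ∃ K, Nonempty (Q.obj K ≅ P) :=
  ⟨_, ⟨Q.objObjPreimageIso P⟩⟩

lemma isIso_app_of_Q {D : Type*} [Category* D] {A B : DerivedCategory C ⥤ D} (α : A ⟶ B)
    (h : ∀ K, IsIso (α.app (Q.obj K))) (P : DerivedCategory C) : IsIso (α.app P) := by
  obtain ⟨K, ⟨e⟩⟩ := exists_Q_obj_iso P
  exact (NatTrans.isIso_app_iff_of_iso α e).mp (h K)

lemma isIso_map_Q {K L : CochainComplex C ℤ} (f : K ⟶ L) (h : ∀ n, IsIso (F.map (f.f n))) :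
    IsIso (F.mapDerivedCategory.map (Q.map f)) := by
  have := isIso_Q_map (F.cx.map f) h
  exact (NatIso.isIso_map_iff F.mapDerivedCategoryFactors f).mpr this

lemma isIso_map_counitD (ε : G ⟶ 𝟭 C) (h : ∀ M, IsIso (F.map (ε.app M)))
    (P : DerivedCategory C) : IsIso (F.mapDerivedCategory.map ((counitD ε).app P)) := by
  refine isIso_app_of_Q (Functor.whiskerRight (counitD ε) F.mapDerivedCategory) (fun K => ?_) P
  have := isIso_map_Q ((counitCx ε).app K) (F := F) fun n => h (K.X n)
  rw [Functor.whiskerRight_app, counitD_app, Functor.map_comp]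
  infer_instance

lemma isIso_counitD_Q (ε : F ⟶ 𝟭 C) {K : CochainComplex C ℤ} (h : ∀ n, IsIso (ε.app (K.X n))) :
    IsIso ((counitD ε).app (Q.obj K)) := by
  have := isIso_Q_map ((counitCx ε).app K) h
  rw [counitD_app]
  infer_instance

lemma isIso_counitD_map (ε : F ⟶ 𝟭 C) (h : ∀ M, IsIso (ε.app (G.obj M)))
    (P : DerivedCategory C) : IsIso ((counitD ε).app (G.mapDerivedCategory.obj P)) := by
  refine isIso_app_of_Q (Functor.whiskerLeft G.mapDerivedCategory (counitD ε)) (fun K => ?_) P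
  exact (NatTrans.isIso_app_iff_of_iso _ (G.mapDerivedCategoryFactors.app K)).mpr
    (isIso_counitD_Q ε fun n => h (K.X n))

lemma isIso_counitD_map_map {H : C ⥤ C} [H.Additive] [PreservesFiniteLimits H]
    [PreservesFiniteColimits H] (ε : F ⟶ 𝟭 C) (h : ∀ M, IsIso (ε.app (G.obj (H.obj M))))
    (P : DerivedCategory C) :
    IsIso ((counitD ε).app (G.mapDerivedCategory.obj (H.mapDerivedCategory.obj P))) := by
  refine isIso_app_of_Q (Functor.whiskerLeft (H.mapDerivedCategory ⋙ G.mapDerivedCategory)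
    (counitD ε)) (fun K => ?_) P
  exact (NatTrans.isIso_app_iff_of_iso _
    (G.mapDerivedCategory.mapIso (H.mapDerivedCategoryFactors.app K) ≪≫
      G.mapDerivedCategoryFactors.app (H.cx.obj K))).mpr
    (isIso_counitD_Q ε fun n => h (K.X n))

lemma isIso_map_mapNatD {H : C ⥤ C} [H.Additive] [PreservesFiniteLimits H]
    [PreservesFiniteColimits H] (α : F ⟶ G) (h : ∀ M, IsIso (H.map (α.app M)))
    (P : DerivedCategory C) : IsIso (H.mapDerivedCategory.map ((mapNatD α).app P)) := by
  refine isIso_app_of_Q (Functor.whiskerRight (mapNatD α) H.mapDerivedCategory) (fun K => ?_) P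
  have := isIso_map_Q ((α.mapHomologicalComplex _).app K) (F := H) fun n => h (K.X n)
  rw [Functor.whiskerRight_app, mapNatD_app, Functor.map_comp, Functor.map_comp]
  infer_instance

lemma isZero_mapDerivedCategory (h : ∀ M, IsZero (F.obj M)) (P : DerivedCategory C) :
    IsZero (F.mapDerivedCategory.obj P) := by
  obtain ⟨K, ⟨e⟩⟩ := exists_Q_obj_iso P
  exact (isZero_Q_obj fun n => h (K.X n)).of_iso
    ((F.mapDerivedCategory.mapIso e).symm ≪≫ F.mapDerivedCategoryFactors.app K)

/-- The short exact sequence of complexes associated to a natural short exact sequence. -/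
noncomputable def cxSeq (ε : F ⟶ 𝟭 C) (π : 𝟭 C ⟶ G) (h₀ : ∀ M, ε.app M ≫ π.app M = 0)
    (K : CochainComplex C ℤ) : ShortComplex (CochainComplex C ℤ) :=
  ShortComplex.mk ((counitCx ε).app K) ((unitCx π).app K)
    (by ext n; exact h₀ (K.X n))

lemma exists_triangle_counitD (ε : F ⟶ 𝟭 C) (π : 𝟭 C ⟶ G) (h₀ : ∀ M, ε.app M ≫ π.app M = 0)
    (h : ∀ M, (ShortComplex.mk (ε.app M) (π.app M) (h₀ M)).ShortExact) (P : DerivedCategory C) :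
    ∃ δ : G.mapDerivedCategory.obj P ⟶ (F.mapDerivedCategory.obj P)⟦(1 : ℤ)⟧,
      Triangle.mk ((counitD ε).app P) ((unitD π).app P) δ ∈ distTriang _ := by
  obtain ⟨K, ⟨e⟩⟩ := exists_Q_obj_iso P
  have hS : (cxSeq ε π h₀ K).ShortExact :=
    HomologicalComplex.shortExact_of_degreewise_shortExact _ fun n => h (K.X n)
  let e₁ : F.mapDerivedCategory.obj P ≅ Q.obj (F.cx.obj K) :=
    (F.mapDerivedCategory.mapIso e).symm ≪≫ F.mapDerivedCategoryFactors.app K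
  let e₃ : G.mapDerivedCategory.obj P ≅ Q.obj (G.cx.obj K) :=
    (G.mapDerivedCategory.mapIso e).symm ≪≫ G.mapDerivedCategoryFactors.app K
  have h₁ : (counitD ε).app P ≫ e.inv = e₁.hom ≫ Q.map ((counitCx ε).app K) := by
    have := (counitD ε).naturality e.inv
    rw [counitD_app] at this
    exact this.symm.trans (Category.assoc _ _ _).symm
  have h₂ : (unitD π).app P ≫ e₃.hom = e.inv ≫ Q.map ((unitCx π).app K) := by
    have := (unitD π).naturality e.inv
    rw [unitD_app] at this
    have := congrArg (· ≫ G.mapDerivedCategoryFactors.hom.app K) this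
    simp only [Category.assoc, Iso.inv_hom_id_app] at this
    refine (Eq.trans ?_ this.symm).trans (congrArg _ (Category.comp_id _))
    rfl
  let δ : Q.obj (G.cx.obj K) ⟶ (Q.obj (F.cx.obj K))⟦(1 : ℤ)⟧ := triangleOfSESδ hS
  have h₃ : (e₃.hom ≫ δ ≫ (shiftFunctor _ (1 : ℤ)).map e₁.inv) ≫
      (shiftFunctor _ (1 : ℤ)).map e₁.hom = e₃.hom ≫ δ := by
    rw [Category.assoc, Category.assoc, ← Functor.map_comp, e₁.inv_hom_id, CategoryTheory.Functor.map_id,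
      Category.comp_id]
  exact ⟨e₃.hom ≫ δ ≫ (shiftFunctor _ (1 : ℤ)).map e₁.inv,
    isomorphic_distinguished _ (triangleOfSES_distinguished hS) _
      (Triangle.isoMk (Triangle.mk _ _ _) (Triangle.mk _ _ _) e₁ e.symm e₃ h₁ h₂ h₃)⟩

end ExactEndofunctor

namespace AlgebraicGeometry.Scheme.Modules

open ZeroExtSystem in
lemma exists_list_basicOpen {X : Scheme.{u}} [IsNoetherian X] {V U : X.Opens} (hV : IsAffineOpen V) (hU : U ≤ V) :
    ∃ l : List Γ(X, V), lsup (l.map X.basicOpen) = U := by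
  have hU' : IsCompact (U : Set X) := NoetherianSpace.isCompact _
  have key (x : U) : ∃ g : Γ(X, V), X.basicOpen g ≤ U ∧ x.1 ∈ X.basicOpen g :=
    hV.exists_basicOpen_le x (hU x.2)
  choose g hg hx using key
  obtain ⟨t, ht⟩ := hU'.elim_finite_subcover (fun x : U => (X.basicOpen (g x) : Set X))
    (fun x => (X.basicOpen (g x)).2) fun x hxU => Set.mem_iUnion.mpr ⟨⟨x, hxU⟩, hx ⟨x, hxU⟩⟩
  refine ⟨t.toList.map g, le_antisymm (lsup_le fun a ha => ?_) fun x hxU => ?_⟩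
  · simp only [List.mem_map] at ha
    obtain ⟨_, ⟨y, -, rfl⟩, rfl⟩ := ha
    exact hg y
  · obtain ⟨y, hy, hxy⟩ := Set.mem_iUnion₂.mp (ht hxU)
    have h : X.basicOpen (g y) ∈ (t.toList.map g).map X.basicOpen :=
      List.mem_map_of_mem (List.mem_map_of_mem (Finset.mem_toList.mpr hy))
    exact le_lsup h hxy

section DerivedZeroExt

open Pretriangulated DerivedCategory ZeroExtSystem

variable [HasDerivedCategory.{w} X.Modules]

lemma isZero_mapDerivedCategory_sup {V V' : X.Opens} {P : DerivedCategory X.Modules}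
    (h : IsZero ((zeroExt V).mapDerivedCategory.obj P))
    (h' : IsZero ((zeroExt V').mapDerivedCategory.obj P)) :
    IsZero ((zeroExt (V ⊔ V')).mapDerivedCategory.obj P) := by
  set R := (zeroExt (V ⊔ V')).mapDerivedCategory.obj P
  have hR {W : X.Opens} (hW : W ≤ V ⊔ V') (hP : IsZero ((zeroExt W).mapDerivedCategory.obj P)) :
      IsZero ((zeroExt W).mapDerivedCategory.obj R) :=
    have := isIso_map_counitD (F := zeroExt W) (zeroExtι (V ⊔ V'))
      (fun M => isIso_zeroExt_map_zeroExtι hW M) P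
    hP.of_iso (asIso ((zeroExt W).mapDerivedCategory.map ((counitD (zeroExtι (V ⊔ V'))).app P)))
  obtain ⟨δ, hδ⟩ := exists_triangle_counitD (zeroExtι V) (zeroQuotπ V)
    (fun M => zeroExtι_comp_zeroQuotπ V M) (fun M => zeroSeq_shortExact V M) R
  have hV := hR le_sup_left h
  refine Triangle.isZero₂_of_isZero₁₃ _ hδ hV ?_
  have := isIso_counitD_map_map (zeroExtι V') (G := zeroQuot V) (H := zeroExt (V ⊔ V'))
    (fun M => isIso_zeroExtι_zeroQuot_sup V V' M) P
  refine IsZero.of_iso ?_ (asIso ((counitD (zeroExtι V')).app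
    ((zeroQuot V).mapDerivedCategory.obj R))).symm
  have h₂ := (zeroExt V').mapDerivedCategory.map_distinguished _ hδ
  have e := (Triangle.isZero₁_iff_isIso₂ _ h₂).mp (((zeroExt V').mapDerivedCategory).map_isZero hV)
  exact (hR le_sup_right h').of_iso (@asIso _ _ _ _ _ e).symm

/-- The extensions by zero on the derived category of sheaves of modules. -/
noncomputable def zeroExtSystem : ZeroExtSystem (DerivedCategory X.Modules) X.Opens where
  L V := (zeroExt V).mapDerivedCategory
  C V := (zeroQuot V).mapDerivedCategory
  commShiftL _ := inferInstance
  commShiftC _ := inferInstance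
  triangL _ := inferInstance
  triangC _ := inferInstance
  ε V := counitD (zeroExtι V)
  π V := unitD (zeroQuotπ V)
  exists_triangle V P := exists_triangle_counitD (zeroExtι V) (zeroQuotπ V)
    (fun M => zeroExtι_comp_zeroQuotπ V M) (fun M => zeroSeq_shortExact V M) P
  isIso_map_ε h P := isIso_map_counitD _ (fun M => isIso_zeroExt_map_zeroExtι h M) P
  isIso_ε_L h P := isIso_counitD_map _ (fun M => isIso_zeroExtι_app_zeroExt h M) P
  isIso_ε_inf V V' P := isIso_counitD_map_map _ (fun M => isIso_zeroExtι_inf V V' M) P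
  isIso_ε_top P := isIso_app_of_Q _ (fun _ => isIso_counitD_Q _ fun _ => isIso_zeroExtι_top _) P
  isZero_bot P := isZero_mapDerivedCategory isZero_zeroExt_bot P
  isZero_sup h h' := isZero_mapDerivedCategory_sup X h h'

variable {X}

/-- The principal open subsets of an affine open subset. -/
noncomputable def chart [IsNoetherian X] {V : X.Opens} (hV : IsAffineOpen V) :
    (zeroExtSystem X).Chart V where
  G := Γ(X, V)
  D := X.basicOpen
  D_le := X.basicOpen_le
  exists_top := ⟨1, X.basicOpen_of_isUnit isUnit_one⟩
  exists_inf g h := ⟨g * h, X.basicOpen_mul g h⟩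
  exists_list := exists_list_basicOpen hV
  m g := mapNatD (zeroExtAct g)
  isIso_m g P := isIso_map_mapNatD _ (fun M => isIso_zeroExt_zeroExtAct g M) P

end DerivedZeroExt

end AlgebraicGeometry.Scheme.Modules

namespace AlgebraicGeometry.Scheme.Modules

section Localizing

variable {X}

/-- A sheaf of modules is localizing if, over each affine open subset, its sections over a
principal open subset are obtained by localization. -/
def Localizing (F : X.Modules) : Prop :=
  ∀ (V : X.Opens) (_ : IsAffineOpen V) (g : Γ(X, V)),
    (∀ t : Γ(F, X.basicOpen g), ∃ (m : ℕ) (s : Γ(F, V)),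
      F.res (X.basicOpen_le g) s = X.presheaf.map (homOfLE (X.basicOpen_le g)).op (g ^ m) • t) ∧
    ∀ s : Γ(F, V), F.res (X.basicOpen_le g) s = 0 → ∃ k : ℕ, g ^ k • s = 0

lemma fromSpec_appIso_inv {V : X.Opens} (hV : IsAffineOpen V) (W : (Spec Γ(X, V)).Opens)
    (hW : hV.fromSpec ''ᵁ W ≤ V) (r : Γ(X, V)) :
    (hV.fromSpec.appIso W).inv
      ((Spec Γ(X, V)).presheaf.map W.leTop.op ((Scheme.ΓSpecIso Γ(X, V)).inv r)) =
      X.presheaf.map (homOfLE hW).op r := by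
  have h : W ≤ hV.fromSpec ⁻¹ᵁ V := by
    rw [hV.fromSpec_preimage_self]; exact le_top
  have e : (Scheme.ΓSpecIso Γ(X, V)).inv ≫ (Spec Γ(X, V)).presheaf.map W.leTop.op =
      hV.fromSpec.appLE V W h := by
    rw [Scheme.Hom.appLE, hV.fromSpec_app_self, Category.assoc, ← Functor.map_comp]
    rfl
  have := congr($(hV.fromSpec.appLE_appIso_inv h) r)
  rw [← e] at this
  exact this

lemma restrict_smul_Spec (F : X.Modules) {V : X.Opens} (hV : IsAffineOpen V)
    (W : (Spec Γ(X, V)).Opens) (hW : hV.fromSpec ''ᵁ W ≤ V) (r : Γ(X, V))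
    (x : Γ(F, hV.fromSpec ''ᵁ W)) :
    (show Γ(F, hV.fromSpec ''ᵁ W) from r • (show Γ(F.restrict hV.fromSpec, W) from x)) =
      X.presheaf.map (homOfLE hW).op r • x := by
  rw [← fromSpec_appIso_inv hV W hW r]
  rfl

lemma localizing_of_isQuasicoherent (F : X.Modules) [F.IsQuasicoherent] : Localizing F := by
  intro V hV g
  have hF := (isIso_fromTildeΓ_iff_isLocalizing
    ((restrictFunctor hV.fromSpec).obj F)).mp inferInstance g
  have hD : hV.fromSpec ''ᵁ PrimeSpectrum.basicOpen g = X.basicOpen g :=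
    hV.fromSpec_image_basicOpen g
  have hT : hV.fromSpec ''ᵁ (⊤ : (Spec Γ(X, V)).Opens) = V := by
    rw [Scheme.Hom.image_top_eq_opensRange, hV.opensRange_fromSpec]
  have hDT : hV.fromSpec ''ᵁ PrimeSpectrum.basicOpen g ≤ hV.fromSpec ''ᵁ ⊤ := by
    rw [hD, hT]; exact X.basicOpen_le g
  refine ⟨fun t => ?_, fun s hs => ?_⟩
  · obtain ⟨⟨s, ⟨_, m, rfl⟩⟩, h⟩ := hF.surj (F.res hD.le t)
    let s' : Γ(F, hV.fromSpec ''ᵁ ⊤) := s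
    refine ⟨m, F.res hT.ge s', ?_⟩
    have h' : X.presheaf.map (homOfLE (hD.le.trans (X.basicOpen_le g))).op (g ^ m) •
        F.res hD.le t = F.res hDT s' :=
      (restrict_smul_Spec F hV _ (hD.le.trans (X.basicOpen_le g)) (g ^ m) _).symm.trans h
    have := congr(F.res hD.ge $h')
    rw [res_smul, res_res, res_rfl, res_res] at this
    rw [res_res, ← this, ← CommRingCat.comp_apply, ← Functor.map_comp]
    rfl
  · have h0 : F.res hDT (F.res hT.le s) = 0 := by
      have := congr(F.res hD.le $hs)
      simpa using this
    obtain ⟨⟨_, k, rfl⟩, h⟩ := (IsLocalizedModule.eq_zero_iff (.powers g)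
      ((modulesSpecToSheaf.obj ((restrictFunctor hV.fromSpec).obj F)).obj.map
        (PrimeSpectrum.basicOpen g).leTop.op).hom).mp h0
    refine ⟨k, ?_⟩
    have h' : X.presheaf.map (homOfLE hT.le).op (g ^ k) • F.res hT.le s = 0 :=
      (restrict_smul_Spec F hV _ hT.le (g ^ k) _).symm.trans h
    have := congr(F.res hT.ge $h')
    rw [res_smul, res_res, res_rfl, map_zero, ← CommRingCat.comp_apply, ← Functor.map_comp] at this
    rw [← this]
    congr 1
    exact congr($(X.presheaf.map_id _) (g ^ k)).symm

end Localizing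

end AlgebraicGeometry.Scheme.Modules

namespace AlgebraicGeometry.Scheme.Modules

section Serre

variable {X : Scheme.{u}}

/-- The vanishing of the first Čech cohomology groups for the coverings of affine open subsets by
two principal open subsets. -/
def CechAcyclic (F : X.Modules) : Prop :=
  ∀ (V : X.Opens) (_ : IsAffineOpen V) (a b : Γ(X, V)), Ideal.span {a, b} = ⊤ →
    ∀ t : Γ(F, X.basicOpen a ⊓ X.basicOpen b),
      ∃ (s₁ : Γ(F, X.basicOpen a)) (s₂ : Γ(F, X.basicOpen b)),
        F.res inf_le_left s₁ + F.res inf_le_right s₂ = t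

lemma Localizing.exists_res_eq {F : X.Modules} (hF : Localizing F) {V U : X.Opens}
    (hV : IsAffineOpen V) (g : Γ(X, V)) (hU : X.basicOpen g = U) (hUV : U ≤ V) (t : Γ(F, U)) :
    ∃ (m : ℕ) (s : Γ(F, V)), F.res hUV s = X.presheaf.map (homOfLE hUV).op (g ^ m) • t := by
  subst hU
  exact (hF V hV g).1 t

lemma map_map_apply {U V W : X.Opens} (h : U ≤ V) (h' : V ≤ W) (r : Γ(X, W)) :
    X.presheaf.map (homOfLE h).op (X.presheaf.map (homOfLE h').op r) =
      X.presheaf.map (homOfLE (h.trans h')).op r := by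
  rw [← CommRingCat.comp_apply, ← Functor.map_comp]
  rfl

lemma Localizing.cechAcyclic {F : X.Modules} (hF : Localizing F) : CechAcyclic F := by
  intro V hV a b hab t
  obtain ⟨m, s, hs⟩ := hF.exists_res_eq (hV.basicOpen a)
    (X.presheaf.map (homOfLE (X.basicOpen_le a)).op b) (X.basicOpen_res _ _) inf_le_left t
  obtain ⟨n, s', hs'⟩ := hF.exists_res_eq (hV.basicOpen b)
    (X.presheaf.map (homOfLE (X.basicOpen_le b)).op a)
    ((X.basicOpen_res _ _).trans (inf_comm _ _)) inf_le_right t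
  have hab' : IsCoprime (b ^ m) (a ^ n) := by
    refine IsCoprime.pow (IsCoprime.symm ?_)
    rwa [← Ideal.isCoprime_span_singleton_iff, Ideal.isCoprime_iff_sup_eq, ← Ideal.span_union]
  obtain ⟨u, v, e⟩ := hab'
  refine ⟨X.presheaf.map (homOfLE (X.basicOpen_le a)).op u • s,
    X.presheaf.map (homOfLE (X.basicOpen_le b)).op v • s', ?_⟩
  rw [res_smul, res_smul, hs, hs', ← map_pow, ← map_pow, map_map_apply, map_map_apply,
    map_map_apply, map_map_apply, smul_smul, smul_smul, ← add_smul, ← map_mul, ← map_mul,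
    ← map_add, e, map_one, one_smul]

lemma exists_app_eq {S : ShortComplex X.Modules} (hS : S.ShortExact) {U : X.Opens}
    (s : Γ(S.X₂, U)) (hs : S.g.app U s = 0) : ∃ t : Γ(S.X₁, U), S.f.app U t = s := by
  have := hS.mono_f
  have h0 : ofSection s ≫ S.g = 0 := by
    rw [ofSection_comp, hs]
    exact (zeroExtOHomEquiv _).symm.map_zero
  refine ⟨(hS.exact.lift _ h0).app U (zeroExtOne U), ?_⟩
  have := congr(($(hS.exact.lift_f _ h0)).app U (zeroExtOne U))
  rw [ofSection_one] at this
  exact this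

lemma exists_app_eq_of_cechAcyclic {S : ShortComplex X.Modules} (hS : S.ShortExact)
    (h : CechAcyclic S.X₁) {V : X.Opens} (hV : IsAffineOpen V) (s : Γ(S.X₃, V)) :
    ∃ t : Γ(S.X₂, V), S.g.app V t = s := by
  let J : Ideal Γ(X, V) :=
    { carrier := {r | ∃ t : Γ(S.X₂, X.basicOpen r),
        S.g.app _ t = S.X₃.res (X.basicOpen_le r) s}
      add_mem' := ?_
      zero_mem' := ?_
      smul_mem' := ?_ }
  · have hJ : J = ⊤ := by
      have : Ideal.span (J : Set Γ(X, V)) = ⊤ := by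
        rw [← hV.self_le_iSup_basicOpen_iff]
        intro x hx
        have := hS.epi_g
        obtain ⟨W, hW, t, hxW, ht⟩ := locally_surjective_of_epi S.g s hx
        obtain ⟨f, hf, hxf⟩ := hV.exists_basicOpen_le ⟨x, hxW⟩ hx
        refine Opens.mem_iSup.mpr ⟨⟨f, S.X₂.res hf t, ?_⟩, hxf⟩
        rw [app_res, ht, res_res]
      rwa [Ideal.span_eq] at this
    obtain ⟨t, ht⟩ : (1 : Γ(X, V)) ∈ J := hJ ▸ Submodule.mem_top
    have e : V ≤ X.basicOpen (1 : Γ(X, V)) := (X.basicOpen_of_isUnit isUnit_one).ge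
    exact ⟨S.X₂.res e t, by rw [app_res, ht, res_res, res_rfl]⟩
  · rintro a b ⟨t₁, h₁⟩ ⟨t₂, h₂⟩
    set W := X.basicOpen (a + b)
    have hW : W ≤ V := X.basicOpen_le _
    set a' := X.presheaf.map (homOfLE hW).op a
    set b' := X.presheaf.map (homOfLE hW).op b
    have ha : X.basicOpen a' ≤ X.basicOpen a := (X.basicOpen_res _ _).trans_le inf_le_right
    have hb : X.basicOpen b' ≤ X.basicOpen b := (X.basicOpen_res _ _).trans_le inf_le_right
    have hab : Ideal.span {a', b'} = ⊤ := by
      refine Ideal.eq_top_of_isUnit_mem _ (Ideal.add_mem _ (Ideal.subset_span (Set.mem_insert a' _))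
        (Ideal.subset_span (Set.mem_insert_of_mem _ (Set.mem_singleton b')))) ?_
      rw [← map_add]
      exact RingedSpace.isUnit_res_basicOpen X.toLocallyRingedSpace.toRingedSpace (a + b)
    have hc : W ≤ X.basicOpen a' ⊔ X.basicOpen b' := by
      have := ((hV.basicOpen (a + b)).self_le_iSup_basicOpen_iff (s := {a', b'})).mpr hab
      refine this.trans (iSup_le ?_)
      rintro ⟨_, rfl | rfl⟩
      · exact le_sup_left
      · exact le_sup_right
    obtain ⟨c, hc'⟩ := exists_app_eq hS
      (S.X₂.res (inf_le_left.trans ha) t₁ - S.X₂.res (inf_le_right.trans hb) t₂ :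
        Γ(S.X₂, X.basicOpen a' ⊓ X.basicOpen b'))
      (by
        refine (map_sub _ _ _).trans ?_
        rw [sub_eq_zero]
        refine (app_res _ _ _).trans (.trans ?_ (app_res _ _ _).symm)
        rw [h₁, h₂, res_res, res_res])
    obtain ⟨s₁, s₂, hs⟩ := h _ (hV.basicOpen (a + b)) a' b' hab c
    obtain ⟨t, e₁, e₂⟩ := S.X₂.exists_glue₂ (X.basicOpen_le a') (X.basicOpen_le b') hc
      (S.X₂.res ha t₁ - S.f.app _ s₁) (S.X₂.res hb t₂ + S.f.app _ s₂) (by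
        rw [map_sub, map_add, res_res, res_res, ← app_res, ← app_res, sub_eq_iff_eq_add, add_assoc,
          ← app_add_sec, add_comm (S.X₁.res _ s₂), hs, hc']
        abel)
    have z₁ (U : X.Opens) (s : Γ(S.X₁, U)) : S.g.app U (S.f.app U s) = 0 :=
      congr(($(S.zero)).app U s)
    refine ⟨t, eq_of_res₂ (X.basicOpen_le a') (X.basicOpen_le b') hc ?_ ?_⟩
    · rw [← app_res, e₁]
      refine (map_sub _ _ _).trans ?_
      erw [z₁]
      rw [sub_zero]
      erw [app_res]
      rw [h₁, res_res, res_res]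
    · rw [← app_res, e₂, app_add_sec, z₁, add_zero, app_res, h₂, res_res, res_res]
  · have : X.basicOpen (0 : Γ(X, V)) = ⊥ := X.basicOpen_zero V
    refine ⟨0, eq_of_res (U := fun i : PEmpty.{1} => i.elim) (fun i => i.elim) ?_ fun i => i.elim⟩
    rw [this]; exact bot_le
  · rintro r a ⟨t, ht⟩
    have hr : X.basicOpen (r • a) ≤ X.basicOpen a :=
      (X.basicOpen_mul r a).trans_le inf_le_right
    exact ⟨S.X₂.res hr t, by rw [app_res, ht, res_res]⟩

lemma exists_res_eq_of_injective (I : X.Modules) [Injective I] {U V : X.Opens} (h : U ≤ V)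
    (t : Γ(I, U)) : ∃ s : Γ(I, V), I.res h s = t := by
  let j : zeroExtO U ⟶ zeroExtO V := ofSection ((zeroExtO V).res h (zeroExtOne V))
  have hj : Mono j := by
    have e : j ≫ (zeroExtι V).app (structureModule X) =
        (zeroExtι U).app (structureModule X) := by
      refine zeroExtO_hom_ext ?_
      have h₁ : j.app U (zeroExtOne U) = (zeroExtO V).res h (zeroExtOne V) := ofSection_one _
      change ((zeroExtι V).app (structureModule X)).app U (j.app U (zeroExtOne U)) = _
      rw [h₁]
      erw [app_res]
      erw [zeroExtι_zeroExtOne, zeroExtι_zeroExtOne]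
      apply unitVal.injective
      erw [unitVal_res]
      simp
    exact mono_of_mono_fac e
  refine ⟨(Injective.factorThru (ofSection t) j).app V (zeroExtOne V), ?_⟩
  rw [← app_res]
  have h₁ : j.app U (zeroExtOne U) = (zeroExtO V).res h (zeroExtOne V) := ofSection_one _
  have h₂ := congr(($(Injective.comp_factorThru (ofSection t) j)).app U (zeroExtOne U))
  rw [ofSection_one] at h₂
  rw [← h₁]
  exact h₂

lemma CechAcyclic.of_shortExact {S : ShortComplex X.Modules} (hS : S.ShortExact)
    (h : CechAcyclic S.X₁) [Injective S.X₂] : CechAcyclic S.X₃ := by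
  intro V hV a b _ t
  have hab : IsAffineOpen (X.basicOpen a ⊓ X.basicOpen b) := by
    rw [← X.basicOpen_mul]; exact hV.basicOpen _
  obtain ⟨s, rfl⟩ := exists_app_eq_of_cechAcyclic hS h hab t
  obtain ⟨s', rfl⟩ := exists_res_eq_of_injective S.X₂
    (inf_le_left : X.basicOpen a ⊓ X.basicOpen b ≤ X.basicOpen a) s
  exact ⟨S.g.app _ s', 0, by rw [map_zero, add_zero, app_res]⟩

open Abelian in
/-- Serre vanishing. -/
lemma CechAcyclic.ext_eq_zero [HasExt.{w} X.Modules] {V : X.Opens} (hV : IsAffineOpen V) (n : ℕ)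
    {F : X.Modules} (h : CechAcyclic F) (e : Ext (zeroExtO V) F (n + 1)) : e = 0 := by
  induction n generalizing F with
  | zero =>
    let S : ShortComplex X.Modules := ShortComplex.mk (Injective.ι F) (cokernel.π (Injective.ι F))
      (cokernel.condition _)
    have hS : S.ShortExact :=
      { exact := ShortComplex.exact_of_g_is_cokernel _ (cokernelIsCokernel (Injective.ι F))
        mono_f := inferInstanceAs (Mono (Injective.ι F))
        epi_g := inferInstanceAs (Epi (cokernel.π (Injective.ι F))) }
    have : Injective S.X₂ := inferInstanceAs (Injective (Injective.under F))
    obtain ⟨x, rfl⟩ := Ext.covariant_sequence_exact₁ (zeroExtO V) hS e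
      (Ext.eq_zero_of_injective _) rfl
    obtain ⟨x, rfl⟩ := (Ext.mk₀_bijective _ _).2 x
    obtain ⟨t, ht⟩ := exists_app_eq_of_cechAcyclic hS h hV (x.app V (zeroExtOne V))
    have : x = ofSection t ≫ S.g := by
      refine zeroExtO_hom_ext ?_
      rw [← ht, ofSection_comp, ofSection_one]
    rw [this, ← Ext.mk₀_comp_mk₀, Ext.comp_assoc_of_second_deg_zero,
      ShortComplex.ShortExact.comp_extClass, Ext.comp_zero]
  | succ n ih =>
    let S : ShortComplex X.Modules := ShortComplex.mk (Injective.ι F) (cokernel.π (Injective.ι F))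
      (cokernel.condition _)
    have hS : S.ShortExact :=
      { exact := ShortComplex.exact_of_g_is_cokernel _ (cokernelIsCokernel (Injective.ι F))
        mono_f := inferInstanceAs (Mono (Injective.ι F))
        epi_g := inferInstanceAs (Epi (cokernel.π (Injective.ι F))) }
    have : Injective S.X₂ := inferInstanceAs (Injective (Injective.under F))
    obtain ⟨x, rfl⟩ := Ext.covariant_sequence_exact₁ (zeroExtO V) hS e
      (Ext.eq_zero_of_injective _) rfl
    rw [ih (CechAcyclic.of_shortExact hS h) x, Ext.zero_comp]

end Serre

end AlgebraicGeometry.Scheme.Modules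

section Milnor

open Pretriangulated

theorem exists_compatible_seq {G : ℕ → Type*} (s : ∀ m, G (m + 1) → G m) (n : ℕ)
    (hs : ∀ m, n ≤ m → Function.Surjective (s m)) (x : G n) :
    ∃ a : ∀ m, G m, (∀ m, s m (a (m + 1)) = a m) ∧ a n = x := by
  induction n generalizing G with
  | zero =>
    choose r hr using fun m => hs m (Nat.zero_le m)
    exact ⟨fun m => Nat.rec x (fun m y => r m y) m, fun m => hr m _, rfl⟩
  | succ n ih =>
    obtain ⟨a, ha, hx⟩ := ih (G := fun m => G (m + 1)) (fun m => s (m + 1)) (fun m hm => hs (m + 1) (by omega)) x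
    refine ⟨fun m => match m with
      | 0 => s 0 (a 0)
      | m + 1 => a m, ?_, hx⟩
    rintro (_ | m)
    · rfl
    · exact ha m

/-- Homotopy limits of towers, with the degenerate case of the Milnor sequence. -/
theorem exists_holim {T : Type*} [Category T] [HasZeroObject T] [HasShift T ℤ] [Preadditive T]
    [∀ n : ℤ, (shiftFunctor T n).Additive] [Pretriangulated T] (N : ℕ → T) [HasProduct N]
    (t : ∀ n, N (n + 1) ⟶ N n) :
    ∃ (I : T) (i : ∀ n, I ⟶ N n),
      (∀ (A : T) (φ : ∀ n, A ⟶ N n), (∀ n, φ (n + 1) ≫ t n = φ n) →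
        ∃ f : A ⟶ I, ∀ n, f ≫ i n = φ n) ∧
      ∀ (A : T) (n : ℕ),
        (∀ m, n ≤ m → Function.Bijective (fun f : A ⟶ N (m + 1) => f ≫ t m)) →
        (∀ m, n ≤ m → Function.Surjective (fun f : A⟦(1 : ℤ)⟧ ⟶ N (m + 1) => f ≫ t m)) →
        Function.Bijective (fun f : A ⟶ I => f ≫ i n) := by
  let d : ∏ᶜ N ⟶ ∏ᶜ N := Pi.lift fun n => Pi.π N n - Pi.π N (n + 1) ≫ t n
  have hd : ∀ n, d ≫ Pi.π N n = Pi.π N n - Pi.π N (n + 1) ≫ t n := fun n => by simp [d]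
  obtain ⟨I, j, δ, hT⟩ := distinguished_cocone_triangle₁ d
  have hj : ∀ n, (j ≫ Pi.π N (n + 1)) ≫ t n = j ≫ Pi.π N n := fun n => by
    have : j ≫ d ≫ Pi.π N n = 0 := by
      rw [← Category.assoc, show j ≫ d = 0 from comp_distTriang_mor_zero₁₂ _ hT, zero_comp]
    rw [hd, Preadditive.comp_sub, sub_eq_zero] at this
    rw [this, Category.assoc]
  have lift : ∀ (A : T) (φ : ∀ n, A ⟶ N n), (∀ n, φ (n + 1) ≫ t n = φ n) →
      ∃ f : A ⟶ I, ∀ n, f ≫ j ≫ Pi.π N n = φ n := fun A φ hφ => by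
    obtain ⟨f, hf⟩ := Triangle.coyoneda_exact₂ _ hT (Pi.lift φ) (by
      refine Limits.Pi.hom_ext _ _ fun n => ?_
      have : (Pi.lift φ ≫ d) ≫ Pi.π N n = 0 := by
        rw [Category.assoc, hd, Preadditive.comp_sub, ← Category.assoc, Pi.lift_π, Pi.lift_π, hφ,
          sub_self]
      exact this.trans zero_comp.symm)
    refine ⟨f, fun n => ?_⟩
    have := Pi.lift_π φ n
    rw [hf] at this
    exact (Category.assoc _ _ _).symm.trans this
  refine ⟨I, fun n => j ≫ Pi.π N n, lift, fun A n h₁ h₂ => ⟨?_, fun x => ?_⟩⟩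
  · suffices ∀ x : A ⟶ I, x ≫ j ≫ Pi.π N n = 0 → x = 0 from fun x y hxy =>
      sub_eq_zero.mp (this _ (by rw [Preadditive.sub_comp, sub_eq_zero]; exact hxy))
    intro x hx
    have hup : ∀ k, x ≫ j ≫ Pi.π N (n + k) = 0 := fun k => by
      induction k with
      | zero => exact hx
      | succ k ih =>
        refine (h₁ (n + k) (by omega)).1 ?_
        change (x ≫ j ≫ Pi.π N (n + k + 1)) ≫ t (n + k) = 0 ≫ t (n + k)
        rw [Category.assoc, hj, ih, zero_comp]
    have hdown : ∀ k m, m + k = n → x ≫ j ≫ Pi.π N m = 0 := fun k => by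
      induction k with
      | zero => rintro m rfl; exact hx
      | succ k ih =>
        intro m hm
        rw [← hj, ← Category.assoc, ih (m + 1) (by omega), zero_comp]
    have hxj : x ≫ j = 0 := Limits.Pi.hom_ext _ _ fun m => by
      rw [zero_comp, Category.assoc]
      rcases le_total m n with h | h
      · exact hdown (n - m) m (by omega)
      · obtain ⟨k, rfl⟩ := Nat.exists_eq_add_of_le h
        exact hup k
    obtain ⟨g, hg⟩ : ∃ g : A⟦(1 : ℤ)⟧ ⟶ ∏ᶜ N, x⟦(1 : ℤ)⟧' = g ≫ δ :=
      Triangle.coyoneda_exact₁ _ hT (x⟦(1 : ℤ)⟧') (by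
      change x⟦(1 : ℤ)⟧' ≫ j⟦(1 : ℤ)⟧' = 0
      rw [← CategoryTheory.Functor.map_comp, hxj, Functor.map_zero])
    obtain ⟨a, ha, -⟩ := exists_compatible_seq
      (fun m (f : A⟦(1 : ℤ)⟧ ⟶ N (m + 1)) => g ≫ Pi.π N m + f ≫ t m) n
      (fun m hm y => by
        obtain ⟨f, hf⟩ := h₂ m hm (y - g ≫ Pi.π N m)
        exact ⟨f, (congrArg (g ≫ Pi.π N m + ·) hf).trans (add_sub_cancel _ _)⟩) 0
    have hga : g = Pi.lift a ≫ d := Limits.Pi.hom_ext _ _ fun m => by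
      rw [Category.assoc, hd, Preadditive.comp_sub, Pi.lift_π, ← Category.assoc, Pi.lift_π,
        eq_sub_iff_add_eq]
      exact ha m
    refine (shiftFunctor T (1 : ℤ)).map_injective ?_
    rw [hg, hga, Category.assoc, Functor.map_zero]
    rw [show d ≫ δ = 0 from comp_distTriang_mor_zero₂₃ _ hT, comp_zero]
  · obtain ⟨a, ha, hax⟩ := exists_compatible_seq
      (fun m (f : A ⟶ N (m + 1)) => f ≫ t m) n (fun m hm => (h₁ m hm).2) x
    obtain ⟨f, hf⟩ := lift A a ha
    exact ⟨f, (hf n).trans hax⟩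

end Milnor

section DerivedProducts

open DerivedCategory CochainComplex

variable {C : Type*} [Category C] [Abelian C]

variable {ι : Type*} [HasProductsOfShape ι C] (I : ι → CochainComplex C ℤ)

noncomputable def isLimitEvalPi (p : ℤ) :
    IsLimit (Fan.mk ((∏ᶜ I).X p) fun n => (Pi.π I n).f p) :=
  isLimitOfHasProductOfPreservesLimit (HomologicalComplex.eval C _ p) I

theorem nonempty_homotopy_pi {K : CochainComplex C ℤ} {f g : K ⟶ ∏ᶜ I}
    (h : ∀ n, Nonempty (Homotopy (f ≫ Pi.π I n) (g ≫ Pi.π I n))) : Nonempty (Homotopy f g) := by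
  let h' := fun n => (h n).some
  let H : ∀ p q, K.X p ⟶ (∏ᶜ I).X q := fun p q =>
    Fan.IsLimit.lift (isLimitEvalPi I q) fun n => (h' n).hom p q
  have hH : ∀ p q n, H p q ≫ (Pi.π I n).f q = (h' n).hom p q := fun p q n =>
    Fan.IsLimit.fac (isLimitEvalPi I q) _ n
  refine ⟨{ hom := H, zero := fun p q hpq => ?_, comm := fun p => ?_ }⟩
  · refine Fan.IsLimit.hom_ext (isLimitEvalPi I q) _ _ fun n => ?_
    change H p q ≫ (Pi.π I n).f q = 0 ≫ _
    rw [hH, (h' n).zero p q hpq, zero_comp]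
  · refine Fan.IsLimit.hom_ext (isLimitEvalPi I p) _ _ fun n => ?_
    have := (h' n).comm p
    change f.f p ≫ (Pi.π I n).f p = _ ≫ (Pi.π I n).f p
    rw [← HomologicalComplex.comp_f, this, Preadditive.add_comp, Preadditive.add_comp,
      HomologicalComplex.comp_f]
    congr 2
    · rw [dNext_eq _ (show (ComplexShape.up ℤ).Rel p (p + 1) from rfl),
        dNext_eq _ (show (ComplexShape.up ℤ).Rel p (p + 1) from rfl), Category.assoc, hH]
    · rw [prevD_eq _ (show (ComplexShape.up ℤ).Rel (p - 1) p by simp),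
        prevD_eq _ (show (ComplexShape.up ℤ).Rel (p - 1) p by simp), Category.assoc,
        ← (Pi.π I n).comm, ← Category.assoc, hH]

instance isKInjective_pi [∀ n, (I n).IsKInjective] : (∏ᶜ I).IsKInjective where
  nonempty_homotopy_zero f hK := nonempty_homotopy_pi I fun n => by
    rw [zero_comp]
    exact IsKInjective.nonempty_homotopy_zero _ hK

variable [HasDerivedCategory C]

theorem exists_Q_map_eq {K L : CochainComplex C ℤ} [L.IsKInjective] (f : Q.obj K ⟶ Q.obj L) :
    ∃ g : K ⟶ L, Q.map g = f := by
  obtain ⟨g, hg⟩ := (IsKInjective.Qh_map_bijective _ L).surjective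
    ((quotientCompQhIso C).hom.app K ≫ f ≫ (quotientCompQhIso C).inv.app L)
  obtain ⟨g, rfl⟩ := (HomotopyCategory.quotient _ _).map_surjective g
  refine ⟨g, ?_⟩
  have h₁ := quotientCompQhIso_hom_naturality g
  rw [← cancel_epi ((quotientCompQhIso C).hom.app K)]
  refine h₁.symm.trans ?_
  rw [hg]
  simp

theorem nonempty_homotopy_of_Q_map_eq {K L : CochainComplex C ℤ} [L.IsKInjective] {f g : K ⟶ L}
    (h : Q.map f = Q.map g) : Nonempty (Homotopy f g) := by
  refine ⟨HomotopyCategory.homotopyOfEq _ _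
    ((IsKInjective.Qh_map_bijective _ L).injective ?_)⟩
  have h₁ := quotientCompQhIso_hom_naturality f
  have h₂ := quotientCompQhIso_hom_naturality g
  rw [← cancel_mono ((quotientCompQhIso C).hom.app L)]
  exact h₁.trans ((congrArg _ h).trans h₂.symm)

theorem hasProduct_Q_obj [∀ n, (I n).IsKInjective] : HasProduct fun n => Q.obj (I n) := by
  have lift : ∀ (A : DerivedCategory C) (φ : ∀ n, A ⟶ Q.obj (I n)),
      ∃ f : A ⟶ Q.obj (∏ᶜ I), ∀ n, f ≫ Q.map (Pi.π I n) = φ n := fun A φ => by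
    obtain ⟨K, ⟨e⟩⟩ := exists_Q_obj_iso A
    choose g hg using fun n => exists_Q_map_eq (e.hom ≫ φ n)
    refine ⟨e.inv ≫ Q.map (Pi.lift g), fun n => ?_⟩
    rw [Category.assoc, ← CategoryTheory.Functor.map_comp, Pi.lift_π, hg, e.inv_hom_id_assoc]
  have uniq : ∀ (A : DerivedCategory C) (f g : A ⟶ Q.obj (∏ᶜ I)),
      (∀ n, f ≫ Q.map (Pi.π I n) = g ≫ Q.map (Pi.π I n)) → f = g := fun A f g h => by
    obtain ⟨K, ⟨e⟩⟩ := exists_Q_obj_iso A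
    obtain ⟨f', hf⟩ := exists_Q_map_eq (e.hom ≫ f)
    obtain ⟨g', hg⟩ := exists_Q_map_eq (e.hom ≫ g)
    obtain ⟨H⟩ := nonempty_homotopy_pi I (f := f') (g := g') fun n =>
      nonempty_homotopy_of_Q_map_eq (by simp only [CategoryTheory.Functor.map_comp, hf, hg,
        Category.assoc, h])
    rw [← cancel_epi e.hom, ← hf, ← hg, Q_map_eq_of_homotopy _ H]
  choose l hl using lift
  exact ⟨⟨⟨Fan.mk _ fun n => Q.map (Pi.π I n), Fan.IsLimit.mk _ (fun s => l _ s.proj)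
    (fun s n => hl _ _ n) fun s m hm => uniq _ _ _ fun n => (hm n).trans (hl _ s.proj n).symm⟩⟩⟩

theorem hasProduct_of_isGE [EnoughInjectives C] (N : ι → DerivedCategory C) (a : ι → ℤ)
    [∀ n, (N n).IsGE (a n)] : HasProduct N := by
  have : ∀ n, ∃ (L : CochainComplex C ℤ) (_ : L.IsKInjective), Nonempty (Q.obj L ≅ N n) :=
    fun n => by
      obtain ⟨K, _, ⟨e⟩⟩ := exists_iso_Q_obj_of_isGE (N n) (a n)
      obtain ⟨L, i, _, _, _⟩ := CochainComplex.Plus.modelCategoryQuillen.exists_quasiIso_injective K (a n)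
      exact ⟨L, isKInjective_of_injective L (a n), ⟨(e ≪≫ asIso (Q.map i)).symm⟩⟩
  choose L hL e using this
  have := hasProduct_Q_obj L
  exact hasLimit_of_iso (Discrete.natIso fun n => (e n.as).some :
    Discrete.functor (fun n => Q.obj (L n)) ≅ Discrete.functor N)

end DerivedProducts

section HomologyTriangles

open DerivedCategory Pretriangulated DerivedCategory.TStructure

variable {C : Type*} [Category C] [Abelian C] [HasDerivedCategory C]

theorem isIso_homology_mor₂ {S : Triangle (DerivedCategory C)} (hS : S ∈ distTriang _) (m n : ℤ)
    (h : m + 1 = n) (h₁ : IsZero ((homologyFunctor C m).obj S.obj₁))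
    (h₂ : IsZero ((homologyFunctor C n).obj S.obj₁)) :
    IsIso ((homologyFunctor C m).map S.mor₂) := by
  have := (HomologySequence.mono_homologyMap_mor₂_iff S hS m).mpr (h₁.eq_of_src _ _)
  have := (HomologySequence.epi_homologyMap_mor₂_iff S hS m n h).mpr (h₂.eq_of_tgt _ _)
  exact isIso_of_mono_of_epi _

theorem isIso_homology_mor₁ {S : Triangle (DerivedCategory C)} (hS : S ∈ distTriang _) (m n : ℤ)
    (h : m + 1 = n) (h₁ : IsZero ((homologyFunctor C m).obj S.obj₃))
    (h₂ : IsZero ((homologyFunctor C n).obj S.obj₃)) :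
    IsIso ((homologyFunctor C n).map S.mor₁) := by
  have := (HomologySequence.mono_homologyMap_mor₁_iff S hS m n h).mpr (h₁.eq_of_src _ _)
  have := (HomologySequence.epi_homologyMap_mor₁_iff S hS n).mpr (h₂.eq_of_tgt _ _)
  exact isIso_of_mono_of_epi _

theorem isZero_homology_obj₁ {S : Triangle (DerivedCategory C)} (hS : S ∈ distTriang _) (m n : ℤ)
    (h : m + 1 = n) (h₁ : Epi ((homologyFunctor C m).map S.mor₂))
    (h₂ : Mono ((homologyFunctor C n).map S.mor₂)) :
    IsZero ((homologyFunctor C n).obj S.obj₁) :=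
  (HomologySequence.exact₁ S hS m n h).isZero_of_both_zeros
    ((HomologySequence.epi_homologyMap_mor₂_iff S hS m n h).mp h₁)
    ((HomologySequence.mono_homologyMap_mor₂_iff S hS n).mp h₂)

theorem isIso_homology_truncGEπ (M : DerivedCategory C) (a i : ℤ) (h : a ≤ i) :
    IsIso ((homologyFunctor C i).map ((t.truncGEπ a).app M)) :=
  isIso_homology_mor₂ (t.triangleLTGE_distinguished a M) i (i + 1) rfl
    (isZero_of_isLE _ (a - 1) i (by omega)) (isZero_of_isLE _ (a - 1) (i + 1) (by omega))

theorem isZero_homology_truncGE (M : DerivedCategory C) (a i : ℤ) (h : i < a) :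
    IsZero ((homologyFunctor C i).obj ((t.truncGE a).obj M)) :=
  isZero_of_isGE _ a i h

theorem isIso_homology_natTransTruncGEOfLE (M : DerivedCategory C) (a b i : ℤ) (hab : a ≤ b)
    (h : b ≤ i) :
    IsIso ((homologyFunctor C i).map ((t.natTransTruncGEOfLE a b hab).app M)) := by
  have := isIso_homology_truncGEπ M a i (hab.trans h)
  have := isIso_homology_truncGEπ M b i h
  refine IsIso.of_isIso_fac_left (f := (homologyFunctor C i).map ((t.truncGEπ a).app M))
    (h := (homologyFunctor C i).map ((t.truncGEπ b).app M)) ?_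
  rw [← CategoryTheory.Functor.map_comp, t.π_natTransTruncGEOfLE_app]

theorem exists_iso_singleFunctor (M : DerivedCategory C) (n : ℤ) [M.IsGE n] [M.IsLE n] :
    Nonempty (M ≅ (singleFunctor C n).obj ((homologyFunctor C n).obj M)) := by
  obtain ⟨Y, ⟨e⟩⟩ := exists_iso_singleFunctor_obj_of_isGE_of_isLE M n
  exact ⟨e ≪≫ (singleFunctor C n).mapIso (((homologyFunctor C n).mapIso e) ≪≫
    (singleFunctorCompHomologyFunctorIso C n).app Y).symm⟩

/-- The fibre of `τ≥a ⟶ τ≥a+1` is concentrated in degree `a`. -/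
theorem exists_truncGE_triangle (M : DerivedCategory C) (a b : ℤ) (hab : a + 1 = b) :
    ∃ (F : DerivedCategory C) (i : F ⟶ (t.truncGE a).obj M)
      (δ : (t.truncGE b).obj M ⟶ F⟦(1 : ℤ)⟧),
      Triangle.mk i ((t.natTransTruncGEOfLE a b (by omega)).app M) δ ∈ distTriang _ ∧
      Nonempty (F ≅ (singleFunctor C a).obj ((homologyFunctor C a).obj M)) := by
  obtain ⟨F, i, δ, hT⟩ := distinguished_cocone_triangle₁
    ((t.natTransTruncGEOfLE a b (by omega)).app M)
  refine ⟨F, i, δ, hT, ?_⟩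
  have hi : ∀ m, m ≤ a → IsIso ((homologyFunctor C m).map i) := fun m hm =>
    isIso_homology_mor₁ hT (m - 1) m (by omega) (isZero_homology_truncGE M b _ (by omega))
      (isZero_homology_truncGE M b _ (by omega))
  have hGE : F.IsGE a := (isGE_iff _ _).mpr fun m hm =>
    have := hi m hm.le
    (isZero_homology_truncGE M a m hm).of_iso (asIso ((homologyFunctor C m).map i))
  have hLE : F.IsLE a := (isLE_iff _ _).mpr fun m hm => by
    refine isZero_homology_obj₁ hT (m - 1) m (by omega) ?_ ?_
    · rcases (by omega : b ≤ m - 1 ∨ m - 1 < b) with h | h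
      · have := isIso_homology_natTransTruncGEOfLE M a b (m - 1) (by omega) h
        exact inferInstanceAs (Epi ((homologyFunctor C (m - 1)).map
          ((t.natTransTruncGEOfLE a b (by omega)).app M)))
      · exact ⟨fun _ _ _ => (isZero_homology_truncGE M b _ h).eq_of_src _ _⟩
    · have := isIso_homology_natTransTruncGEOfLE M a b m (by omega) (by omega)
      exact inferInstanceAs (Mono ((homologyFunctor C m).map
          ((t.natTransTruncGEOfLE a b (by omega)).app M)))
  obtain ⟨e⟩ := exists_iso_singleFunctor F a
  have := hi a le_rfl
  have := isIso_homology_truncGEπ M a a le_rfl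
  exact ⟨e ≪≫ (singleFunctor C a).mapIso (asIso ((homologyFunctor C a).map i) ≪≫
    (asIso ((homologyFunctor C a).map ((t.truncGEπ a).app M))).symm)⟩

theorem homology_map_single_bijective (Y Z : C) (n : ℤ) :
    Function.Bijective (fun f : (singleFunctor C n).obj Y ⟶ (singleFunctor C n).obj Z =>
      (homologyFunctor C n).map f) := by
  have h : (singleFunctor C n ⋙ homologyFunctor C n).Full :=
    Functor.Full.of_iso (singleFunctorCompHomologyFunctorIso C n).symm
  have h' : (singleFunctor C n ⋙ homologyFunctor C n).Faithful :=
    Functor.Faithful.of_iso (singleFunctorCompHomologyFunctorIso C n).symm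
  have h₁ : Function.Bijective (fun f : Y ⟶ Z => (singleFunctor C n).map f) :=
    ⟨(singleFunctor C n).map_injective, (singleFunctor C n).map_surjective⟩
  refine (Function.Bijective.of_comp_iff _ h₁).mp ?_
  exact ⟨(singleFunctor C n ⋙ homologyFunctor C n).map_injective,
    (singleFunctor C n ⋙ homologyFunctor C n).map_surjective⟩

theorem homology_map_bijective (Y : C) (M : DerivedCategory C) (n : ℤ) [M.IsGE n] :
    Function.Bijective (fun f : (singleFunctor C n).obj Y ⟶ M => (homologyFunctor C n).map f) := by
  have hT := t.triangleLTGE_distinguished (n + 1) M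
  let K := (t.truncLT (n + 1)).obj M
  let j : K ⟶ M := (t.truncLTι (n + 1)).app M
  have hj : ∀ m, m ≤ n → IsIso ((homologyFunctor C m).map j) := fun m hm =>
    isIso_homology_mor₁ hT (m - 1) m (by omega) (isZero_homology_truncGE M _ _ (by omega))
      (isZero_homology_truncGE M _ _ (by omega))
  have hGE : K.IsGE n := (isGE_iff _ _).mpr fun m hm =>
    have := hj m hm.le
    (isZero_of_isGE M n m hm).of_iso (asIso ((homologyFunctor C m).map j))
  have hLE : K.IsLE n := inferInstanceAs (t.IsLE ((t.truncLT (n + 1)).obj M) n)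
  obtain ⟨e⟩ := exists_iso_singleFunctor K n
  have h₁ : Function.Bijective (fun f : (singleFunctor C n).obj Y ⟶ K => f ≫ j) := by
    constructor
    · refine fun f g hfg => sub_eq_zero.mp ?_
      obtain ⟨x, hx⟩ := Triangle.coyoneda_exact₁ _ hT ((f - g)⟦(1 : ℤ)⟧') (by
        change (f - g)⟦(1 : ℤ)⟧' ≫ j⟦(1 : ℤ)⟧' = 0
        rw [← CategoryTheory.Functor.map_comp, Preadditive.sub_comp, sub_eq_zero.mpr hfg,
          Functor.map_zero])
      have : t.IsLE (((singleFunctor C n).obj Y)⟦(1 : ℤ)⟧) (n - 1) :=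
        t.isLE_shift _ n 1 (n - 1) (by omega)
      refine (shiftFunctor _ (1 : ℤ)).map_injective ?_
      refine hx.trans ((congrArg (· ≫ _) (t.zero_of_isLE_of_isGE x (n - 1) (n + 1) (by omega)
        inferInstance (inferInstanceAs (t.IsGE ((t.truncGE (n + 1)).obj M) (n + 1))))).trans ?_)
      rw [Functor.map_zero]
      exact zero_comp
    · intro f
      obtain ⟨x, hx⟩ := Triangle.coyoneda_exact₂ _ hT f
        (t.zero_of_isLE_of_isGE _ n (n + 1) (by omega) inferInstance
          (inferInstanceAs (t.IsGE ((t.truncGE (n + 1)).obj M) (n + 1))))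
      exact ⟨x, hx.symm⟩
  have h₂ : Function.Bijective (fun f : (singleFunctor C n).obj Y ⟶
      (singleFunctor C n).obj ((homologyFunctor C n).obj K) => f ≫ e.inv) :=
    e.symm.homToEquiv.bijective
  have := hj n le_rfl
  refine (Function.Bijective.of_comp_iff _ (h₁.comp h₂)).mp ?_
  let i : (homologyFunctor C n).obj _ ≅ (homologyFunctor C n).obj M :=
    (homologyFunctor C n).mapIso e.symm ≪≫ asIso ((homologyFunctor C n).map j)
  convert i.homToEquiv.bijective.comp (homology_map_single_bijective Y _ n) using 1
  ext f
  simp [i]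

end HomologyTriangles

theorem singleFunctor_hom_eq_zero {C : Type*} [Category C] [Abelian C]
    [HasDerivedCategory.{w} C] [HasExt.{w} C] {Y Z : C} (k : ℕ)
    (h : ∀ e : Abelian.Ext Y Z (k + 1), e = 0) (p q : ℤ) (hpq : q + (k + 1) = p)
    (f : (DerivedCategory.singleFunctor C p).obj Y ⟶ (DerivedCategory.singleFunctor C q).obj Z) :
    f = 0 := by
  let e₁ : ((DerivedCategory.singleFunctor C p).obj Y)⟦p⟧ ≅
      (DerivedCategory.singleFunctor C 0).obj Y :=
    ((DerivedCategory.singleFunctors C).shiftIso p 0 p (by omega)).app Y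
  let e₂ : ((DerivedCategory.singleFunctor C q).obj Z)⟦p⟧ ≅
      (DerivedCategory.singleFunctor C (q - p)).obj Z :=
    ((DerivedCategory.singleFunctors C).shiftIso p (q - p) q (by omega)).app Z
  let e₃ : ((DerivedCategory.singleFunctor C 0).obj Z)⟦((k + 1 : ℕ) : ℤ)⟧ ≅
      (DerivedCategory.singleFunctor C (q - p)).obj Z :=
    ((DerivedCategory.singleFunctors C).shiftIso ((k + 1 : ℕ) : ℤ) (q - p) 0
      (by push_cast; omega)).app Z
  have hz : ∀ g : (DerivedCategory.singleFunctor C 0).obj Y ⟶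
      ((DerivedCategory.singleFunctor C 0).obj Z)⟦((k + 1 : ℕ) : ℤ)⟧, g = 0 := fun g => by
    obtain ⟨e, rfl⟩ := Abelian.Ext.homEquiv.surjective g
    rw [h e]
    exact Abelian.Ext.zero_hom _ _ _
  refine (shiftFunctor _ p).map_injective ?_
  have := hz (e₁.inv ≫ f⟦p⟧' ≫ e₂.hom ≫ e₃.inv)
  rw [← cancel_epi e₁.inv, ← cancel_mono e₂.hom, ← cancel_mono e₃.inv]
  simpa using this

namespace AlgebraicGeometry.Scheme.Modules

section DLoc

open DerivedCategory Pretriangulated DerivedCategory.TStructure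

variable {X : Scheme.{u}}

lemma Localizing.of_iso {F G : X.Modules} (e : F ≅ G) (h : Localizing F) : Localizing G := by
  have hb : ∀ U, Function.Bijective (e.hom.app U) := bijective_of_isIso e.hom
  intro V hV g
  obtain ⟨h₁, h₂⟩ := h V hV g
  refine ⟨fun t => ?_, fun s hs => ?_⟩
  · obtain ⟨t, rfl⟩ := (hb _).2 t
    obtain ⟨m, s, hs⟩ := h₁ t
    exact ⟨m, e.hom.app _ s, by rw [← app_res, hs, Hom.app_smul]⟩
  · obtain ⟨s, rfl⟩ := (hb _).2 s
    rw [← app_res] at hs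
    obtain ⟨k, hk⟩ := h₂ s ((hb _).1 (hs.trans (map_zero _).symm))
    exact ⟨k, by rw [← Hom.app_smul, hk, map_zero]⟩

/-- The homology sheaves of `M` are localizing. -/
def DLoc [HasDerivedCategory.{w} X.Modules] (M : DerivedCategory X.Modules) : Prop :=
  ∀ n, Localizing ((homologyFunctor X.Modules n).obj M)

variable [HasDerivedCategory.{w} X.Modules]

/-- The structure sheaf of `V` extended by zero, placed in degree `q`. -/
noncomputable abbrev zeroExtD (q : ℤ) (V : X.Opens) : DerivedCategory X.Modules :=
  (singleFunctor X.Modules q).obj (zeroExtO V)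

lemma zeroExtD_hom_single_eq_zero {V : X.Opens} (hV : IsAffineOpen V) {F : X.Modules}
    (hF : Localizing F) (p q : ℤ) (hpq : q ≠ p)
    (f : zeroExtD p V ⟶ (singleFunctor X.Modules q).obj F) : f = 0 := by
  rcases lt_or_gt_of_ne hpq with h | h
  · have : HasExt.{w} X.Modules := hasExt_of_hasDerivedCategory _
    obtain ⟨k, hk⟩ := Int.eq_ofNat_of_zero_le (show 0 ≤ p - q - 1 by omega)
    exact singleFunctor_hom_eq_zero k (hF.cechAcyclic.ext_eq_zero hV k) p q (by omega) f
  · exact t.zero_of_isLE_of_isGE f p q h inferInstance inferInstance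

/-- Homology is locally detected by maps from `zeroExtD q W` with `W` affine. -/
theorem isZero_homology_of_zeroExtD (Z : DerivedCategory X.Modules) (q : ℤ)
    (h : ∀ (W : X.Opens), IsAffineOpen W → ∀ f : zeroExtD q W ⟶ Z, f = 0) :
    IsZero ((homologyFunctor X.Modules q).obj Z) := by
  obtain ⟨K, ⟨e⟩⟩ := exists_Q_obj_iso Z
  have h' : ∀ (W : X.Opens), IsAffineOpen W → ∀ f : zeroExtD q W ⟶ Q.obj K, f = 0 :=
    fun W hW f => (cancel_mono e.hom).mp ((h W hW _).trans zero_comp.symm)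
  suffices hK : IsZero (K.homology q) from
    hK.of_iso ((homologyFunctor _ q).mapIso e.symm ≪≫ (homologyFunctorFactors _ q).app K)
  refine isZero_of_sections fun U s => eq_of_res_mem fun x hx => ?_
  obtain ⟨V, hVU, z, hxV, hz⟩ := locally_surjective_of_epi (K.homologyπ q) s hx
  obtain ⟨W, hW, hxW, hWV⟩ := exists_isAffineOpen_mem_and_subset hxV
  replace hWV : W ≤ V := hWV
  refine ⟨W, hWV.trans hVU, hxW, ?_⟩
  rw [map_zero, ← K.homology q |>.res_res hWV hVU, ← hz, ← app_res]
  let c := ofSection ((K.cycles q).res hWV z)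
  let k := c ≫ K.iCycles q
  let g : (HomologicalComplex.single _ _ q).obj (zeroExtO W) ⟶ K :=
    HomologicalComplex.mkHomFromSingle k fun r _ => by simp [k]
  have hg : Q.map g = 0 := by
    let i := (singleFunctorIsoCompQ X.Modules q).app (zeroExtO W)
    exact (cancel_epi i.hom).mp ((h' W hW (i.hom ≫ Q.map g)).trans comp_zero.symm)
  have hhg : HomologicalComplex.homologyMap g q = 0 := by
    have := (homologyFunctorFactors X.Modules q).hom.naturality g
    refine (cancel_epi ((homologyFunctorFactors X.Modules q).hom.app _)).mp
      ((this.symm.trans ?_).trans comp_zero.symm)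
    change (homologyFunctor X.Modules q).map (Q.map g) ≫ _ = _
    rw [hg, Functor.map_zero, zero_comp]
  have hc : (HomologicalComplex.singleObjCyclesSelfIso (ComplexShape.up ℤ) q (zeroExtO W)).inv ≫
      HomologicalComplex.cyclesMap g q = c := by
    rw [← cancel_mono (K.iCycles q), Category.assoc, HomologicalComplex.cyclesMap_i]
    simp [g, k]
  have hcπ : c ≫ K.homologyπ q = 0 := by
    rw [← hc, Category.assoc, ← HomologicalComplex.homologyπ_naturality, hhg, comp_zero,
      comp_zero]
  rw [ofSection_comp] at hcπ
  rw [← ofSection_one ((K.homologyπ q).app W ((K.cycles q).res hWV z)), hcπ]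
  rfl

end DLoc

end AlgebraicGeometry.Scheme.Modules

namespace AlgebraicGeometry.Scheme.Modules

section HomologySections

open DerivedCategory Pretriangulated DerivedCategory.TStructure

variable {X : Scheme.{u}} [HasDerivedCategory.{w} X.Modules]

/-- Shifting `zeroExtD`. -/
noncomputable def zeroExtDShift (V : X.Opens) (n a a' : ℤ) (h : n + a = a') :
    (zeroExtD a' V)⟦n⟧ ≅ zeroExtD a V :=
  ((singleFunctors X.Modules).shiftIso n a a' h).app (zeroExtO V)

lemma zeroExtD_comp_natTransTruncGEOfLE {V : X.Opens} (hV : IsAffineOpen V)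
    {M : DerivedCategory X.Modules} (hM : DLoc M) (a b p : ℤ) (hab : a + 1 = b) :
    (p ≠ a → Function.Injective (fun f : zeroExtD p V ⟶ (t.truncGE a).obj M =>
      f ≫ (t.natTransTruncGEOfLE a b (by omega)).app M)) ∧
    (p ≠ a - 1 → Function.Surjective (fun f : zeroExtD p V ⟶ (t.truncGE a).obj M =>
      f ≫ (t.natTransTruncGEOfLE a b (by omega)).app M)) := by
  obtain ⟨F, i, δ, hT, ⟨e⟩⟩ := exists_truncGE_triangle M a b hab
  refine ⟨fun hp => ?_, fun hp g => ?_⟩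
  · refine (injective_iff_map_eq_zero
      (Preadditive.rightComp (zeroExtD p V) ((t.natTransTruncGEOfLE a b (by omega)).app M))).mpr
      fun f hf => ?_
    obtain ⟨g, hg⟩ := Triangle.coyoneda_exact₂ _ hT f hf
    have : g ≫ e.hom = 0 := zeroExtD_hom_single_eq_zero hV (hM a) p a hp.symm _
    have hg0 : g = 0 := (cancel_mono e.hom).mp (this.trans zero_comp.symm)
    rw [hg, hg0]
    exact zero_comp
  · let e' : F⟦(1 : ℤ)⟧ ≅ (singleFunctor X.Modules (a - 1)).obj ((homologyFunctor _ a).obj M) :=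
      (shiftFunctor _ (1 : ℤ)).mapIso e ≪≫
        ((singleFunctors X.Modules).shiftIso 1 (a - 1) a (by omega)).app _
    have hg : (g ≫ δ) ≫ e'.hom = 0 :=
      zeroExtD_hom_single_eq_zero hV (hM a) p (a - 1) hp.symm _
    obtain ⟨f, hf⟩ := Triangle.coyoneda_exact₃ _ hT g
      ((cancel_mono e'.hom).mp (hg.trans zero_comp.symm))
    exact ⟨f, hf.symm⟩

/-- Maps out of an affine open into a complex with localizing homology are determined by
truncations. -/
theorem zeroExtD_comp_truncGEπ_bijective {V : X.Opens} (hV : IsAffineOpen V)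
    {M : DerivedCategory X.Modules} (hM : DLoc M) (q : ℤ) :
    Function.Bijective (fun f : zeroExtD q V ⟶ M => f ≫ (t.truncGEπ q).app M) := by
  let N : ℕ → DerivedCategory X.Modules := fun n => (t.truncGE (q - n)).obj M
  let τ : ∀ n, N (n + 1) ⟶ N n := fun n =>
    (t.natTransTruncGEOfLE (q - (n + 1 : ℕ)) (q - n) (by push_cast; omega)).app M
  have hN : ∀ n, (N n).IsGE (q - n) := fun n =>
    inferInstanceAs (t.IsGE ((t.truncGE (q - n)).obj M) (q - n))
  have := hasProduct_of_isGE N (fun n => q - n)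
  obtain ⟨I, i, hI, hI'⟩ := exists_holim N τ
  obtain ⟨φ, hφ⟩ := hI M (fun n => (t.truncGEπ (q - n)).app M)
    fun n => t.π_natTransTruncGEOfLE_app _ _ _ M
  have hbij : ∀ (W : X.Opens), IsAffineOpen W → ∀ (p : ℤ) (n : ℕ), q - n ≤ p →
      Function.Bijective (fun f : zeroExtD p W ⟶ I => f ≫ i n) := fun W hW p n hn => by
    refine hI' _ n (fun m hm => ?_) (fun m hm g => ?_)
    · have := zeroExtD_comp_natTransTruncGEOfLE hW hM (q - (m + 1 : ℕ)) (q - m) p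
        (by push_cast; omega)
      exact ⟨this.1 (by push_cast; omega), this.2 (by push_cast; omega)⟩
    · let e := zeroExtDShift W 1 (p - 1) p (by omega)
      obtain ⟨f, hf⟩ := (zeroExtD_comp_natTransTruncGEOfLE hW hM (q - (m + 1 : ℕ)) (q - m) (p - 1)
        (by push_cast; omega)).2 (by push_cast; omega) (e.inv ≫ g)
      refine ⟨e.hom ≫ f, ?_⟩
      have hf' : f ≫ τ m = e.inv ≫ g := hf
      change (e.hom ≫ f) ≫ τ m = g
      rw [Category.assoc, hf', Iso.hom_inv_id_assoc]
  have hφiso : IsIso φ := by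
    rw [DerivedCategory.isIso_iff]
    intro p
    obtain ⟨n, hn⟩ : ∃ n : ℕ, q - n ≤ p - 1 := ⟨(q - p + 1).toNat, by omega⟩
    obtain ⟨Z, g, δ, hT⟩ := distinguished_cocone_triangle (i n)
    have hZ : ∀ r, p - 1 ≤ r → IsZero ((homologyFunctor X.Modules r).obj Z) := fun r hr => by
      refine isZero_homology_of_zeroExtD Z r fun W hW f => ?_
      have hfδ : f ≫ δ = 0 := by
        let e := zeroExtDShift W 1 r (r + 1) (by omega)
        obtain ⟨k, hk⟩ := (shiftFunctor (DerivedCategory X.Modules) (1 : ℤ)).map_surjective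
          (e.hom ≫ f ≫ δ)
        have hk0 : k = 0 := (hbij W hW (r + 1) n (by omega)).1 (by
          refine (shiftFunctor (DerivedCategory X.Modules) (1 : ℤ)).map_injective ?_
          have h31 : δ ≫ (i n)⟦(1 : ℤ)⟧' = 0 := comp_distTriang_mor_zero₃₁ _ hT
          simp [hk, h31])
        rw [hk0, Functor.map_zero] at hk
        exact (cancel_epi e.hom).mp (hk.symm.trans comp_zero.symm)
      obtain ⟨k, hk⟩ := Triangle.coyoneda_exact₃ _ hT f hfδ
      obtain ⟨l, hl⟩ := (hbij W hW r n (by omega)).2 k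
      have h12 : i n ≫ g = 0 := comp_distTriang_mor_zero₁₂ _ hT
      refine hk.trans ?_
      change k ≫ g = 0
      rw [← hl]
      change (l ≫ i n) ≫ g = 0
      rw [Category.assoc, h12, comp_zero]
    have h₁ : IsIso ((homologyFunctor X.Modules p).map (i n)) :=
      isIso_homology_mor₁ hT (p - 1) p (by omega) (hZ _ le_rfl) (hZ _ (by omega))
    have h₂ := isIso_homology_truncGEπ M (q - n) p (by omega)
    have h₃ : (homologyFunctor X.Modules p).map φ ≫ (homologyFunctor X.Modules p).map (i n) =
        (homologyFunctor X.Modules p).map ((t.truncGEπ (q - n)).app M) := by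
      rw [← CategoryTheory.Functor.map_comp, hφ]
    exact @IsIso.of_isIso_fac_right _ _ _ _ _ _ _ _ h₁ h₂ h₃
  have h0 := hbij V hV q 0 (by simp)
  have h1 : Function.Bijective (fun f : zeroExtD q V ⟶ M =>
      f ≫ (t.truncGEπ (q - ((0 : ℕ) : ℤ))).app M) := by
    have : (fun f : zeroExtD q V ⟶ M => f ≫ (t.truncGEπ (q - ((0 : ℕ) : ℤ))).app M) =
        (fun f : zeroExtD q V ⟶ I => f ≫ i 0) ∘ (fun f : zeroExtD q V ⟶ M => f ≫ φ) := by
      ext f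
      simp [hφ]
    rw [this]
    exact h0.comp (asIso φ).homToEquiv.bijective
  rwa [Nat.cast_zero, sub_zero] at h1

/-- For complexes with localizing homology, maps from an affine open are sections of homology. -/
theorem zeroExtD_homology_map_bijective {V : X.Opens} (hV : IsAffineOpen V)
    {M : DerivedCategory X.Modules} (hM : DLoc M) (q : ℤ) :
    Function.Bijective (fun f : zeroExtD q V ⟶ M => (homologyFunctor X.Modules q).map f) := by
  have := isIso_homology_truncGEπ M q q le_rfl
  have hGE : ((t.truncGE q).obj M).IsGE q :=
    inferInstanceAs (t.IsGE ((t.truncGE q).obj M) q)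
  have h := (homology_map_bijective (zeroExtO V) ((t.truncGE q).obj M) q).comp
    (zeroExtD_comp_truncGEπ_bijective hV hM q)
  refine (Function.Bijective.of_comp_iff'
    (asIso ((homologyFunctor X.Modules q).map ((t.truncGEπ q).app M))).homToEquiv.bijective _).mp ?_
  convert h using 1
  ext f
  simp

end HomologySections

end AlgebraicGeometry.Scheme.Modules

section SingleFunctor

open DerivedCategory Pretriangulated

variable {C : Type*} [Category C] [Abelian C] [HasDerivedCategory C]

lemma exists_single_triangle {S : ShortComplex C} (hS : S.ShortExact) (q : ℤ) :
    ∃ δ, Triangle.mk ((singleFunctor C q).map S.f) ((singleFunctor C q).map S.g) δ ∈ distTriang _ :=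
  ⟨_, triangleOfSES_distinguished (hS.map_of_exact (HomologicalComplex.single C (.up ℤ) q))⟩

variable {F : C ⥤ C} [F.Additive] [PreservesFiniteLimits F] [PreservesFiniteColimits F]

lemma mapNatD_counitD_single (α : F ⟶ F) (ε : F ⟶ 𝟭 C) {A : C} (μ : A ⟶ A)
    (h : α.app A ≫ ε.app A = ε.app A ≫ μ) (q : ℤ) :
    (mapNatD α).app ((singleFunctor C q).obj A) ≫ (counitD ε).app _ =
      (counitD ε).app _ ≫ (singleFunctor C q).map μ := by
  let K := (HomologicalComplex.single C (.up ℤ) q).obj A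
  let m : K ⟶ K := (HomologicalComplex.single C (.up ℤ) q).map μ
  have hK : (α.mapHomologicalComplex _).app K ≫ (counitCx ε).app K = (counitCx ε).app K ≫ m := by
    ext n
    change α.app (K.X n) ≫ ε.app (K.X n) = ε.app (K.X n) ≫ m.f n
    by_cases hn : n = q
    · subst hn
      let e : K.X n ≅ A := HomologicalComplex.singleObjXSelf (.up ℤ) n A
      have hm : m.f n = e.hom ≫ μ ≫ e.inv := by
        exact HomologicalComplex.single_map_f_self _ _ μ
      rw [← cancel_mono e.hom, hm]
      simp only [Category.assoc, Iso.inv_hom_id, Category.comp_id]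
      have h₁ : ε.app (K.X n) ≫ e.hom = F.map e.hom ≫ ε.app A := (ε.naturality e.hom).symm
      rw [h₁, reassoc_of% h₁, ← h, α.naturality_assoc]
    · exact (HomologicalComplex.isZero_single_obj_X (.up ℤ) q A n hn).eq_of_tgt _ _
  change (mapNatD α).app (Q.obj K) ≫ (counitD ε).app (Q.obj K) =
    (counitD ε).app (Q.obj K) ≫ Q.map m
  rw [mapNatD_app, counitD_app]
  simp only [Category.assoc, Iso.inv_hom_id_app_assoc]
  rw [← Q.map_comp, ← Q.map_comp]
  exact congrArg (fun x => _ ≫ Q.map x) hK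

end SingleFunctor

namespace AlgebraicGeometry.Scheme.Modules

section Good

open DerivedCategory Pretriangulated DerivedCategory.TStructure ZeroExtSystem

variable {X : Scheme.{u}}

section Inclusion

variable {V W : X.Opens} (h : W ≤ V)

/-- The inclusion of extensions by zero of structure sheaves. -/
noncomputable def zeroExtOMap : zeroExtO W ⟶ zeroExtO V :=
  ofSection ((zeroExtO V).res h (zeroExtOne V))

lemma zeroExtOMap_comp_ofSection {N : X.Modules} (s : Γ(N, V)) :
    zeroExtOMap h ≫ ofSection s = ofSection (N.res h s) := by
  rw [zeroExtOMap, ofSection_comp, app_res, ofSection_one]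

lemma zeroExtVal_zeroExtOMap {U : X.Opens} (hU : U ≤ W) (s : Γ(zeroExtO W, U)) :
    zeroExtVal ((zeroExtOMap h).app U s) = zeroExtVal s := by
  rw [zeroExtOMap, ofSection_app _ hU, zeroExtVal_smul, zeroExtVal_res, zeroExtVal_res,
    zeroExtVal_one, map_one, map_one, mul_one]

lemma zeroExtOMap_comp_zeroExtι :
    zeroExtOMap h ≫ (zeroExtι V).app (structureModule X) = (zeroExtι W).app _ := by
  refine zeroExtO_hom_ext (unitVal.injective ?_)
  exact zeroExtVal_zeroExtOMap h le_rfl (zeroExtOne W)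

/-- The extension by zero from `V ⊓ V'` as an iterated extension. -/
lemma exists_iso_zeroExt_zeroExtO (V V' : X.Opens) :
    ∃ e : zeroExtO (V ⊓ V') ≅ (zeroExt V).obj (zeroExtO V'),
      e.hom ≫ (zeroExtι V).app (zeroExtO V') = zeroExtOMap inf_le_right := by
  let j := zeroExtOMap (X := X) (V := V') (W := V ⊓ V') inf_le_right
  have h₁ : IsIso ((zeroExtι V).app (zeroExtO (V ⊓ V'))) :=
    isIso_zeroExtι_app_zeroExt inf_le_left _
  have h₂ : IsIso ((zeroExt V).map j) := by
    have h₃ := isIso_zeroExt_map_zeroExtι (V := V ⊓ V') inf_le_right (structureModule X)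
    have h₄ := isIso_zeroExt_map_zeroExtι (le_refl (V ⊓ V')) (structureModule X)
    have h₅ : (zeroExt (V ⊓ V')).map j ≫ (zeroExt (V ⊓ V')).map ((zeroExtι V').app _) =
        (zeroExt (V ⊓ V')).map ((zeroExtι (V ⊓ V')).app (structureModule X)) := by
      rw [← CategoryTheory.Functor.map_comp]
      exact congrArg _ (zeroExtOMap_comp_zeroExtι _)
    have h₆ : IsIso ((zeroExt (V ⊓ V')).map j) := @IsIso.of_isIso_fac_right _ _ _ _ _ _ _ _ h₃ h₄ h₅
    have h₇ : IsIso ((zeroExtι (V ⊓ V')).app ((zeroExt V).obj (zeroExtO V'))) :=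
      isIso_zeroExtι_inf V V' (structureModule X)
    have h₈ : IsIso ((zeroExtι (V ⊓ V')).app ((zeroExt V).obj (zeroExtO (V ⊓ V')))) := by
      have : IsIso ((zeroExtι (V ⊓ V')).app (zeroExtO (V ⊓ V'))) :=
        isIso_zeroExtι_app_zeroExt le_rfl _
      exact (NatTrans.isIso_app_iff_of_iso (zeroExtι (V ⊓ V'))
        (@asIso _ _ _ _ _ h₁ : (zeroExt V).obj (zeroExtO (V ⊓ V')) ≅ zeroExtO (V ⊓ V'))).mpr this
    have h₉ : IsIso ((zeroExt (V ⊓ V')).map ((zeroExt V).map j)) := by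
      have a := isIso_zeroExt_map_zeroExtι (V := V ⊓ V') inf_le_left (zeroExtO V')
      have b := isIso_zeroExt_map_zeroExtι (V := V ⊓ V') inf_le_left (zeroExtO (V ⊓ V'))
      have c : (zeroExt (V ⊓ V')).map ((zeroExt V).map j) ≫
          (zeroExt (V ⊓ V')).map ((zeroExtι V).app _) =
          (zeroExt (V ⊓ V')).map ((zeroExtι V).app _) ≫ (zeroExt (V ⊓ V')).map j := by
        exact ((zeroExt _).map_comp _ _).symm.trans ((congrArg _ ((zeroExtι V).naturality j)).trans
          ((zeroExt _).map_comp _ _))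
      have d : IsIso ((zeroExt (V ⊓ V')).map ((zeroExtι V).app (zeroExtO (V ⊓ V'))) ≫
        (zeroExt (V ⊓ V')).map j) := inferInstance
      exact @IsIso.of_isIso_fac_right _ _ _ _ _ _ _ _ a d c
    have c := (zeroExtι (V ⊓ V')).naturality ((zeroExt V).map j)
    have d : IsIso ((zeroExt (V ⊓ V')).map ((zeroExt V).map j) ≫
      (zeroExtι (V ⊓ V')).app ((zeroExt V).obj (zeroExtO V'))) := inferInstance
    exact @IsIso.of_isIso_fac_left _ _ _ _ _ _ _ _ h₈ d c.symm
  refine ⟨(@asIso _ _ _ _ _ h₁).symm ≪≫ @asIso _ _ _ _ _ h₂, ?_⟩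
  change (inv ((zeroExtι V).app (zeroExtO (V ⊓ V'))) ≫ (zeroExt V).map j) ≫ _ = j
  rw [Category.assoc, IsIso.inv_comp_eq]
  exact (zeroExtι V).naturality j

end Inclusion

lemma zeroExtAct_comp_zeroExtι {V W : X.Opens} (h : W ≤ V) (g : Γ(X, V)) :
    (zeroExtAct g).app (zeroExtO W) ≫ (zeroExtι V).app (zeroExtO W) =
      (zeroExtι V).app (zeroExtO W) ≫
        ofSection (X.presheaf.map (homOfLE h).op g • zeroExtOne W) := by
  let i : (zeroExt V).obj (zeroExtO W) ⟶ zeroExtO W := (zeroExtι V).app (zeroExtO W)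
  have hi : IsIso i := isIso_zeroExtι_app_zeroExt h _
  rw [← cancel_epi (inv i)]
  refine Eq.trans (zeroExtO_hom_ext ?_) (IsIso.inv_hom_id_assoc i _).symm
  let s : Γ((zeroExt V).obj (zeroExtO W), W) := (inv i).app W (zeroExtOne W)
  have hs : i.app W s = zeroExtOne W := by
    change (inv i ≫ i).app W (zeroExtOne W) = _
    rw [IsIso.inv_hom_id]
    rfl
  rw [ofSection_one]
  change i.app W (((zeroExtAct g).app (zeroExtO W)).app W s) = _
  rw [zeroExtAct_app g h s, Hom.app_smul, hs]

variable [HasDerivedCategory.{w} X.Modules]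

lemma DLoc.shift {M : DerivedCategory X.Modules} (hM : DLoc M) (p : ℤ) : DLoc (M⟦p⟧) := fun n =>
  (hM (p + n)).of_iso (((homologyFunctor X.Modules 0).shiftIso p n (p + n) rfl).app M).symm

/-- Maps from an affine open correspond to maps into the homology. -/
noncomputable def zeroExtDHom {V : X.Opens} (hV : IsAffineOpen V)
    {M : DerivedCategory X.Modules} (hM : DLoc M) (q : ℤ) :
    (zeroExtD q V ⟶ M) ≃+ (zeroExtO V ⟶ (homologyFunctor X.Modules q).obj M) :=
  (AddEquiv.ofBijective ((homologyFunctor X.Modules q).mapAddHom)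
    (zeroExtD_homology_map_bijective hV hM q)).trans <|
  AddEquiv.ofBijective (Preadditive.leftComp ((homologyFunctor X.Modules q).obj M)
    ((singleFunctorCompHomologyFunctorIso X.Modules q).inv.app (zeroExtO V)))
    ((singleFunctorCompHomologyFunctorIso X.Modules q).symm.app (zeroExtO V)).symm.homFromEquiv.bijective

lemma zeroExtDHom_apply {V : X.Opens} (hV : IsAffineOpen V)
    {M : DerivedCategory X.Modules} (hM : DLoc M) (q : ℤ) (f : zeroExtD q V ⟶ M) :
    zeroExtDHom hV hM q f = (singleFunctorCompHomologyFunctorIso X.Modules q).inv.app (zeroExtO V) ≫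
      (homologyFunctor X.Modules q).map f := rfl

lemma zeroExtDHom_map_comp {V W : X.Opens} (hV : IsAffineOpen V) (hW : IsAffineOpen W)
    {M : DerivedCategory X.Modules} (hM : DLoc M) (q : ℤ) (α : zeroExtO W ⟶ zeroExtO V)
    (f : zeroExtD q V ⟶ M) :
    zeroExtDHom hW hM q ((singleFunctor X.Modules q).map α ≫ f) = α ≫ zeroExtDHom hV hM q f := by
  rw [zeroExtDHom_apply, zeroExtDHom_apply, CategoryTheory.Functor.map_comp]
  exact (((singleFunctorCompHomologyFunctorIso X.Modules q).inv.naturality_assoc α _).symm)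

lemma zeroExtDHom_comp {V : X.Opens} (hV : IsAffineOpen V)
    {M N : DerivedCategory X.Modules} (hM : DLoc M) (hN : DLoc N) (q : ℤ)
    (f : zeroExtD q V ⟶ M) (g : M ⟶ N) :
    zeroExtDHom hV hN q (f ≫ g) = zeroExtDHom hV hM q f ≫ (homologyFunctor X.Modules q).map g := by
  rw [zeroExtDHom_apply, zeroExtDHom_apply, CategoryTheory.Functor.map_comp, Category.assoc]

lemma supp_single {V : X.Opens} {F : X.Modules} (q : ℤ) (h : IsIso ((zeroExtι V).app F)) :
    (zeroExtSystem X).Supp V ((singleFunctor X.Modules q).obj F) :=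
  ((zeroExtSystem X).triClosed_supp V).iso
    (((zeroExt V).mapDerivedCategorySingleFunctor q).app F ≪≫
      (singleFunctor X.Modules q).mapIso (asIso ((zeroExtι V).app F))) (supp_L le_rfl _)

lemma supp_zeroExtD {V W : X.Opens} (h : W ≤ V) (q : ℤ) :
    (zeroExtSystem X).Supp V (zeroExtD q W) :=
  supp_single q (isIso_zeroExtι_app_zeroExt h _)

variable [IsNoetherian X]

lemma act_one_zeroExtD {V W : X.Opens} (hV : IsAffineOpen V) (h : W ≤ V) (q : ℤ)
    (g : (chart hV).G) :
    (chart hV).act g 1 (supp_zeroExtD h q) = (singleFunctor X.Modules q).map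
      (ofSection (X.presheaf.map (homOfLE h).op g • zeroExtOne W)) := by
  have := mapNatD_counitD_single _ _ _ (zeroExtAct_comp_zeroExtι h g) q
  rw [Chart.act, Chart.pow_one, Iso.inv_comp_eq]
  exact this

lemma zeroExtDHom_act {V W : X.Opens} (hV : IsAffineOpen V) (hW : IsAffineOpen W) (h : W ≤ V)
    {M : DerivedCategory X.Modules} (hM : DLoc M) (q : ℤ) (g : (chart hV).G) (k : ℕ)
    (f : zeroExtD q W ⟶ M) (s : Γ((homologyFunctor X.Modules q).obj M, W))
    (hs : zeroExtDHom hW hM q f = ofSection s) :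
    zeroExtDHom hW hM q ((chart hV).act g k (supp_zeroExtD h q) ≫ f) =
      ofSection ((X.presheaf.map (homOfLE h).op g) ^ k • s) := by
  induction k with
  | zero => rw [Chart.act_zero, Category.id_comp, hs, _root_.pow_zero, one_smul]
  | succ k ih =>
    rw [Chart.act_succ, act_one_zeroExtD, Category.assoc, zeroExtDHom_map_comp hW hW, ih,
      ofSection_comp, Hom.app_smul, ofSection_one, smul_smul, ← pow_succ']

end Good

end AlgebraicGeometry.Scheme.Modules

namespace ZeroExtSystem.Chart

open Pretriangulated

variable {T : Type*} [Category* T] [HasZeroObject T] [HasShift T ℤ] [Preadditive T]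
  [∀ n : ℤ, (shiftFunctor T n).Additive] [Pretriangulated T]
  {ι : Type*} [DistribLattice ι] [BoundedOrder ι] {S : ZeroExtSystem T ι} {v : ι} (c : S.Chart v)

lemma act_add (g : c.G) (k l : ℕ) {P : T} (hP : S.Supp v P) :
    c.act g (k + l) hP = c.act g k hP ≫ c.act g l hP := by
  induction k with
  | zero => rw [zero_add, act_zero, Category.id_comp]
  | succ k ih => rw [add_right_comm, act_succ, ih, act_succ c g k, Category.assoc]

/-- A criterion for morphisms from the third object of a distinguished triangle to be annihilated
by powers of a function. -/
lemma exists_act_comp_eq_zero_of_triangle (g : c.G) {t : Triangle T} (ht : t ∈ distTriang T)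
    (h₁ : S.Supp v t.obj₁) (h₂ : S.Supp v t.obj₂) (h₃ : S.Supp v t.obj₃) {M : T}
    (inj : ∀ f : t.obj₂ ⟶ M, t.mor₁ ≫ f = 0 → ∃ k, c.act g k h₂ ≫ f = 0)
    (surj : ∀ f : t.obj₁⟦(1 : ℤ)⟧ ⟶ M, ∃ (k : ℕ) (f' : t.obj₂⟦(1 : ℤ)⟧ ⟶ M),
      c.act g k ((S.triClosed_supp v).shift 1 h₁) ≫ f = t.mor₁⟦(1 : ℤ)⟧' ≫ f')
    (f : t.obj₃ ⟶ M) : ∃ k, c.act g k h₃ ≫ f = 0 := by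
  have h₁' := (S.triClosed_supp v).shift 1 h₁
  obtain ⟨k, hk⟩ := inj (t.mor₂ ≫ f)
    (by rw [comp_distTriang_mor_zero₁₂_assoc _ ht, zero_comp])
  rw [c.act_naturality_assoc g k h₂ h₃] at hk
  obtain ⟨f₁, hf₁⟩ := Triangle.yoneda_exact₃ _ ht _ hk
  obtain ⟨l, f', hf'⟩ := surj f₁
  refine ⟨l + k, ?_⟩
  rw [act_add, Category.assoc, hf₁, c.act_naturality_assoc g l h₃ h₁', hf',
    comp_distTriang_mor_zero₃₁_assoc _ ht, zero_comp]

end ZeroExtSystem.Chart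

namespace AlgebraicGeometry.Scheme.Modules

section Good

open DerivedCategory Pretriangulated DerivedCategory.TStructure ZeroExtSystem

variable {X : Scheme.{u}}

lemma _root_.AlgebraicGeometry.IsAffineOpen.basicOpen_inf {V W : X.Opens} (hW : IsAffineOpen W)
    (h : W ≤ V) (g : Γ(X, V)) : IsAffineOpen (X.basicOpen g ⊓ W) := by
  have := hW.basicOpen (X.presheaf.map (homOfLE h).op g)
  rwa [X.basicOpen_res, inf_comm] at this

lemma Localizing.exists_res_inf_eq {F : X.Modules} (hF : Localizing F) {V W U : X.Opens}
    (hW : IsAffineOpen W) (h : W ≤ V) (g : Γ(X, V)) (hU : U = X.basicOpen g ⊓ W)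
    (t : Γ(F, U)) : ∃ (m : ℕ) (s : Γ(F, W)), F.res (hU.le.trans inf_le_right) s =
      X.presheaf.map (homOfLE (hU.le.trans (inf_le_right.trans h))).op g ^ m • t := by
  obtain rfl : U = X.basicOpen (X.presheaf.map (homOfLE h).op g) := by
    rw [X.basicOpen_res, hU]; exact inf_comm _ _
  obtain ⟨m, s, hs⟩ := (hF W hW _).1 t
  refine ⟨m, s, hs.trans ?_⟩
  rw [map_pow, ← ConcreteCategory.comp_apply, ← X.presheaf.map_comp]
  rfl

lemma Localizing.exists_pow_smul_eq_zero {F : X.Modules} (hF : Localizing F) {V W U : X.Opens}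
    (hW : IsAffineOpen W) (h : W ≤ V) (g : Γ(X, V)) (hU : U = X.basicOpen g ⊓ W)
    (s : Γ(F, W)) (hs : F.res (hU.le.trans inf_le_right) s = 0) :
    ∃ k : ℕ, X.presheaf.map (homOfLE h).op g ^ k • s = 0 := by
  obtain rfl : U = X.basicOpen (X.presheaf.map (homOfLE h).op g) := by
    rw [X.basicOpen_res, hU]; exact inf_comm _ _
  exact (hF W hW _).2 s hs

lemma eq_ofSection {V : X.Opens} {N : X.Modules} (α : zeroExtO V ⟶ N) :
    α = ofSection (α.app V (zeroExtOne V)) := zeroExtO_hom_ext (ofSection_one _).symm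

variable [HasDerivedCategory.{w} X.Modules]

lemma exists_zeroExtDHom {V : X.Opens} (hV : IsAffineOpen V)
    {M : DerivedCategory X.Modules} (hM : DLoc M) (q : ℤ) (f : zeroExtD q V ⟶ M) :
    ∃ s, zeroExtDHom hV hM q f = ofSection s := ⟨_, eq_ofSection _⟩

variable [IsNoetherian X]

lemma exists_act_single_zeroQuot_comp_eq_zero {V W : X.Opens} (hV : IsAffineOpen V)
    (hW : IsAffineOpen W) (h : W ≤ V) {M : DerivedCategory X.Modules} (hM : DLoc M)
    (g : Γ(X, V)) (q : ℤ)
    (hP : (zeroExtSystem X).Supp V ((singleFunctor X.Modules q).obj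
      ((zeroQuot (X.basicOpen g)).obj (zeroExtO W))))
    (f : (singleFunctor X.Modules q).obj ((zeroQuot (X.basicOpen g)).obj (zeroExtO W)) ⟶ M) :
    ∃ k, (chart hV).act g k hP ≫ f = 0 := by
  obtain ⟨δ, hδ⟩ := exists_single_triangle (zeroSeq_shortExact (X.basicOpen g) (zeroExtO W)) q
  obtain ⟨e, he⟩ := exists_iso_zeroExt_zeroExtO (X.basicOpen g) W
  have hU : IsAffineOpen (X.basicOpen g ⊓ W) := hW.basicOpen_inf h g
  have hUV : X.basicOpen g ⊓ W ≤ V := inf_le_right.trans h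
  have hUW : X.basicOpen g ⊓ W ≤ W := inf_le_right
  have hS₂ := supp_zeroExtD h q
  have hS₁ : (zeroExtSystem X).Supp V ((singleFunctor X.Modules q).obj
      ((zeroExt (X.basicOpen g)).obj (zeroExtO W))) :=
    ((zeroExtSystem X).triClosed_supp V).iso ((singleFunctor X.Modules q).mapIso e)
      (supp_zeroExtD hUV q)
  refine (chart hV).exists_act_comp_eq_zero_of_triangle g hδ hS₁ hS₂ hP ?_ ?_ f
  · intro (f : zeroExtD q W ⟶ M) hf
    obtain ⟨s, hs⟩ := exists_zeroExtDHom hW hM q f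
    have h₁ : (singleFunctor X.Modules q).map (zeroExtOMap hUW) ≫ f = 0 := by
      rw [← he, CategoryTheory.Functor.map_comp, Category.assoc]
      exact (congrArg _ hf).trans comp_zero
    have h₂ := zeroExtDHom_map_comp hW hU hM q (zeroExtOMap hUW) f
    rw [h₁, map_zero, hs, zeroExtOMap_comp_ofSection] at h₂
    have h₃ : ((homologyFunctor X.Modules q).obj M).res hUW s = 0 := by
      rw [← ofSection_one (Modules.res _ _ s), ← h₂]
      rfl
    obtain ⟨k, hk⟩ := (hM q).exists_pow_smul_eq_zero hW h g rfl s h₃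
    refine ⟨k, (zeroExtDHom hW hM q).injective ?_⟩
    refine (zeroExtDHom_act hV hW h hM q g k f s hs).trans ?_
    rw [hk]
    exact (zeroExtOHomEquiv _).symm.map_zero.trans (map_zero _).symm
  · intro f
    let σ := (singleFunctors X.Modules).shiftIso 1 (q - 1) q (by omega)
    let f' : zeroExtD (q - 1) (X.basicOpen g ⊓ W) ⟶ M :=
      (singleFunctor X.Modules (q - 1)).map e.hom ≫ σ.inv.app _ ≫ f
    obtain ⟨t, ht⟩ := exists_zeroExtDHom hU hM (q - 1) f'
    obtain ⟨m, s, hs⟩ := (hM (q - 1)).exists_res_inf_eq hW h g rfl t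
    obtain ⟨f₂, hf₂⟩ := (zeroExtDHom hW hM (q - 1)).surjective (ofSection s)
    have h₁ : (chart hV).act g m (supp_zeroExtD hUV (q - 1)) ≫ f' =
        (singleFunctor X.Modules (q - 1)).map (zeroExtOMap hUW) ≫ f₂ := by
      apply (zeroExtDHom hU hM (q - 1)).injective
      rw [zeroExtDHom_act hV hU hUV hM (q - 1) g m f' t ht, zeroExtDHom_map_comp hW hU, hf₂,
        zeroExtOMap_comp_ofSection, hs]
    refine ⟨m, σ.hom.app _ ≫ f₂, ?_⟩
    have hS : (zeroExtSystem X).Supp V ((singleFunctor X.Modules (q - 1)).obj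
        ((zeroExt (X.basicOpen g)).obj (zeroExtO W))) :=
      ((zeroExtSystem X).triClosed_supp V).iso ((singleFunctor X.Modules (q - 1)).mapIso e)
        (supp_zeroExtD hUV (q - 1))
    have hS' := ((zeroExtSystem X).triClosed_supp V).shift 1 hS₁
    have h₂ := (chart hV).act_naturality_assoc g m (supp_zeroExtD hUV (q - 1)) hS
      ((singleFunctor X.Modules (q - 1)).map e.hom) (σ.inv.app _ ≫ f)
    have h₃ := (chart hV).act_naturality_assoc g m hS hS'
      (σ.inv.app ((zeroExt (X.basicOpen g)).obj (zeroExtO W))) f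
    have h₄ : (singleFunctor X.Modules (q - 1)).map e.hom ≫
        σ.inv.app ((zeroExt (X.basicOpen g)).obj (zeroExtO W)) ≫ (chart hV).act g m hS' ≫ f =
        (singleFunctor X.Modules (q - 1)).map e.hom ≫ (singleFunctor X.Modules (q - 1)).map
          ((zeroExtι (X.basicOpen g)).app (zeroExtO W)) ≫ f₂ := by
      rw [← h₃]
      refine h₂.symm.trans (h₁.trans ?_)
      rw [← he, CategoryTheory.Functor.map_comp, Category.assoc]
    rw [cancel_epi] at h₄
    refine ((Iso.eq_inv_comp (σ.app _)).mp h₄.symm).symm.trans ?_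
    exact (σ.hom.naturality_assoc ((zeroExtι (X.basicOpen g)).app (zeroExtO W)) f₂).symm

end Good

end AlgebraicGeometry.Scheme.Modules

lemma ZeroExtSystem.Chart.kill_of_act {T : Type*} [Category* T] [HasZeroObject T] [HasShift T ℤ]
    [Preadditive T] [∀ n : ℤ, (shiftFunctor T n).Additive] [Pretriangulated T]
    {ι : Type*} [DistribLattice ι] [BoundedOrder ι] {S : ZeroExtSystem T ι} {v : ι} (c : S.Chart v)
    (g : c.G) {M Y : T} {Z : ℤ → T} (hZ : ∀ n, S.Supp v (Z n)) (e : ∀ n, Y⟦n⟧ ≅ Z n)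
    (h : ∀ (n p : ℤ) (f : Z n ⟶ M⟦p⟧), ∃ k, c.act g k (hZ n) ≫ f = 0) : c.Kill g M Y := by
  intro n p f
  obtain ⟨k, hk⟩ := h n p ((hZ n).isoL.inv ≫ (S.L v).map (e n).inv ≫ f)
  refine ⟨k, ?_⟩
  rw [act, Category.assoc, Category.assoc, ← (hZ n).isoL_hom, Iso.hom_inv_id_assoc,
    ← NatTrans.naturality_assoc] at hk
  rw [← cancel_epi ((S.L v).map (e n).inv), ← cancel_epi (hZ n).isoL.inv, hk, comp_zero,
    comp_zero]

namespace AlgebraicGeometry.Scheme.Modules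

section Good

open DerivedCategory Pretriangulated DerivedCategory.TStructure ZeroExtSystem

variable {X : Scheme.{u}} [HasDerivedCategory.{w} X.Modules]

variable (X) in
/-- The structure sheaf as an object of the derived category. -/
noncomputable abbrev structureD : DerivedCategory X.Modules :=
  (singleFunctor X.Modules 0).obj (structureModule X)

/-- The extension by zero of the structure sheaf. -/
noncomputable def zeroExtStructureDIso (V : X.Opens) :
    ((zeroExtSystem X).L V).obj (structureD X) ≅ zeroExtD 0 V :=
  ((zeroExt V).mapDerivedCategorySingleFunctor 0).app (structureModule X)

/-- A shift of an object concentrated in one degree. -/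
noncomputable def singleShiftIso (F : X.Modules) (n : ℤ) :
    ((singleFunctor X.Modules 0).obj F)⟦n⟧ ≅ (singleFunctor X.Modules (-n)).obj F :=
  ((singleFunctors X.Modules).shiftIso n (-n) 0 (by omega)).app F

variable [IsNoetherian X]

theorem good_of_dLoc {V : X.Opens} (hV : IsAffineOpen V) (w : X.Opens)
    {M : DerivedCategory X.Modules} (hM : DLoc M) :
    (chart hV).Good (structureD X) w M := by
  intro (g : Γ(X, V)) (h : Γ(X, V)) _
  let Z := (zeroQuot (X.basicOpen g)).obj (zeroExtO (X.basicOpen h))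
  let e : ((zeroExtSystem X).C (X.basicOpen g)).obj
      (((zeroExtSystem X).L (X.basicOpen h)).obj (structureD X)) ≅
      (singleFunctor X.Modules 0).obj Z :=
    ((zeroExtSystem X).C (X.basicOpen g)).mapIso (zeroExtStructureDIso (X.basicOpen h)) ≪≫
      ((zeroQuot (X.basicOpen g)).mapDerivedCategorySingleFunctor 0).app _
  refine ((chart hV).triClosed_kill_left g M).iso e.symm ?_
  have hs := ((zeroExtSystem X).triClosed_supp V).iso e
    ((supp_L (X.basicOpen_le h) (structureD X)).C (X.basicOpen g))
  have hZ (n : ℤ) : (zeroExtSystem X).Supp V ((singleFunctor X.Modules (-n)).obj Z) :=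
    ((zeroExtSystem X).triClosed_supp V).iso (singleShiftIso Z n)
      (((zeroExtSystem X).triClosed_supp V).shift n hs)
  exact (chart hV).kill_of_act g hZ (fun n => singleShiftIso Z n) fun n p f =>
    exists_act_single_zeroQuot_comp_eq_zero hV (hV.basicOpen h) (X.basicOpen_le h) (hM.shift p)
      g (-n) (hZ n) f

end Good

end AlgebraicGeometry.Scheme.Modules

section

open DerivedCategory

variable {C : Type*} [Category C] [Abelian C] [HasDerivedCategory C]

lemma isZero_of_homology {M : DerivedCategory C}
    (h : ∀ n, IsZero ((homologyFunctor C n).obj M)) : IsZero M := by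
  obtain ⟨Z, hZ⟩ := HasZeroObject.zero (C := DerivedCategory C)
  have : IsIso (0 : M ⟶ Z) := (DerivedCategory.isIso_iff C _).mpr fun n =>
    ⟨0, (h n).eq_of_src _ _, ((homologyFunctor C n).map_isZero hZ).eq_of_src _ _⟩
  exact hZ.of_iso (asIso (0 : M ⟶ Z))

lemma isZero_homology_single (F : C) {n q : ℤ} (h : n ≠ q) :
    IsZero ((homologyFunctor C n).obj ((singleFunctor C q).obj F)) := by
  rcases lt_or_gt_of_ne h with h | h
  · exact isZero_of_isGE _ q n h
  · exact isZero_of_isLE _ q n h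

variable (F : C ⥤ C) [F.Additive] [PreservesFiniteLimits F] [PreservesFiniteColimits F]

lemma isZero_mapDerivedCategory_of_homology (M : DerivedCategory C)
    (h : ∀ n, IsZero (F.obj ((homologyFunctor C n).obj M))) :
    IsZero (F.mapDerivedCategory.obj M) := by
  obtain ⟨K, ⟨e⟩⟩ := exists_Q_obj_iso M
  refine isZero_of_homology fun n => ?_
  refine IsZero.of_iso ?_ ((homologyFunctor C n).mapIso
    ((F.mapDerivedCategory.mapIso e).symm ≪≫ F.mapDerivedCategoryFactors.app K) ≪≫
    (homologyFunctorFactors C n).app _ ≪≫ (K.sc n).mapHomologyIso F)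
  exact (h n).of_iso (F.mapIso ((homologyFunctorFactors C n).symm.app K ≪≫
    (homologyFunctor C n).mapIso e))

end

namespace AlgebraicGeometry.Scheme.Modules

section Detection

open DerivedCategory Pretriangulated DerivedCategory.TStructure ZeroExtSystem

variable {X : Scheme.{u}}

lemma Localizing.of_isZero {F : X.Modules} (h : IsZero F) : Localizing F := fun _ _ _ =>
  ⟨fun _ => ⟨0, 0, (zeroExt_section_eq_zero_of_isZero h _).trans
    (zeroExt_section_eq_zero_of_isZero h _).symm⟩,
    fun _ _ => ⟨0, zeroExt_section_eq_zero_of_isZero h _⟩⟩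

lemma localizing_structureModule : Localizing (structureModule X) := by
  intro V hV g
  have := hV.isLocalization_basicOpen g
  refine ⟨fun t => ?_, fun s hs => ?_⟩
  · obtain ⟨⟨s, ⟨_, m, rfl⟩⟩, h⟩ := IsLocalization.surj (.powers g) (unitVal t)
    refine ⟨m, unitVal.symm s, unitVal.injective ?_⟩
    rw [_root_.map_smul, smul_eq_mul, mul_comm]
    exact h.symm
  · obtain ⟨⟨_, k, rfl⟩, h⟩ :=
      (IsLocalization.map_eq_zero_iff (.powers g) Γ(X, X.basicOpen g) (unitVal s)).mp hs
    exact ⟨k, unitVal.injective ((_root_.map_smul _ _ _).trans h)⟩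

lemma Localizing.isZero_zeroExt {F : X.Modules} (hF : Localizing F) {V : X.Opens}
    (hV : IsAffineOpen V) (h : ∀ s : Γ(F, V), s = 0) : IsZero ((zeroExt V).obj F) := by
  have h₁ (g : Γ(X, V)) (t : Γ(F, X.basicOpen g)) : t = 0 := by
    obtain ⟨m, s, hs⟩ := (hF V hV g).1 t
    rw [h s, map_zero] at hs
    have hu : IsUnit (X.presheaf.map (homOfLE (X.basicOpen_le g)).op (g ^ m)) := by
      rw [map_pow]
      exact (RingedSpace.isUnit_res_basicOpen _ g).pow m
    exact hu.smul_eq_zero.mp hs.symm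
  have h₂ {U : X.Opens} (hU : U ≤ V) (s : Γ(F, U)) : s = 0 := by
    refine eq_of_res_mem fun x hx => ?_
    obtain ⟨g, hg, hx'⟩ := hV.exists_basicOpen_le (⟨x, hx⟩ : U) (hU hx)
    exact ⟨X.basicOpen g, hg, hx', (h₁ g _).trans (h₁ g _).symm⟩
  refine isZero_of_sections fun U s => ?_
  obtain ⟨W, hW, hU, e⟩ := zeroExtι_mem V s
  refine eq_of_res₂ inf_le_left hW (le_inf_sup hU) ?_ (e.trans (map_zero _).symm)
  apply zeroExtι_injective V
  exact (h₂ inf_le_right _).trans (h₂ inf_le_right _).symm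

lemma exists_list_isAffineOpen_le [IsNoetherian X] (U : X.Opens) :
    ∃ l : List X.Opens, lsup l = U ∧ ∀ V ∈ l, IsAffineOpen V := by
  choose V hV hx hVU using fun x : U => exists_isAffineOpen_mem_and_subset (U := U) (x := x.1) x.2
  obtain ⟨t, ht⟩ := (NoetherianSpace.isCompact (U : Set X)).elim_finite_subcover
    (fun x : U => (V x : Set X)) (fun x => (V x).2)
    fun x hxU => Set.mem_iUnion.mpr ⟨⟨x, hxU⟩, hx ⟨x, hxU⟩⟩
  refine ⟨t.toList.map V, le_antisymm (lsup_le fun a ha => ?_) fun x hxU => ?_, fun W hW => ?_⟩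
  · obtain ⟨y, -, rfl⟩ := List.mem_map.mp ha
    exact hVU y
  · obtain ⟨y, hy, hxy⟩ := Set.mem_iUnion₂.mp (ht hxU)
    have h : V y ≤ lsup (t.toList.map V) :=
      le_lsup (List.mem_map_of_mem (Finset.mem_toList.mpr hy))
    exact h hxy
  · obtain ⟨y, -, rfl⟩ := List.mem_map.mp hW
    exact hV y

variable [HasDerivedCategory.{w} X.Modules]

lemma dLoc_structureD : DLoc (structureD X) := fun n => by
  by_cases h : n = 0
  · subst h
    exact localizing_structureModule.of_iso
      ((singleFunctorCompHomologyFunctorIso X.Modules 0).symm.app (structureModule X))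
  · exact .of_isZero (isZero_homology_single _ h)

lemma zeroExtD_hom_eq_zero {V : X.Opens} {M : DerivedCategory X.Modules}
    (h : LeftOrth M (((zeroExtSystem X).L V).obj (structureD X))) (q : ℤ)
    (f : zeroExtD q V ⟶ M) : f = 0 := by
  apply (shiftFunctor _ q).map_injective
  let e : (zeroExtD q V)⟦q⟧ ≅ zeroExtD 0 V :=
    ((singleFunctors X.Modules).shiftIso q 0 q (by omega)).app _
  rw [← cancel_epi ((zeroExtStructureDIso V).hom ≫ e.inv), Functor.map_zero, comp_zero]
  exact h q _

theorem isZero_L_of_leftOrth {V : X.Opens} (hV : IsAffineOpen V) {M : DerivedCategory X.Modules}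
    (hM : DLoc M) (h : LeftOrth M (((zeroExtSystem X).L V).obj (structureD X))) :
    IsZero (((zeroExtSystem X).L V).obj M) := by
  refine isZero_mapDerivedCategory_of_homology _ _ fun q => (hM q).isZero_zeroExt hV fun s => ?_
  obtain ⟨f, hf⟩ := (zeroExtDHom hV hM q).surjective (ofSection s)
  rw [zeroExtD_hom_eq_zero h q f, map_zero] at hf
  rw [← ofSection_one s, ← hf]
  rfl

variable (X) in
theorem exists_structureD_generator [IsNoetherian X] : ∃ P : DerivedCategory X.Modules,
    (zeroExtSystem X).LocFin (structureD X) ⊤ P ∧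
      ∀ M, DLoc M → LeftOrth M P → IsZero M := by
  obtain ⟨l, hl, hV⟩ := exists_list_isAffineOpen_le (⊤ : X.Opens)
  obtain ⟨P, -, hP, h⟩ := exists_locFin_generator (O := structureD X) DLoc l fun V hVl =>
    ⟨chart (hV V hVl), good_of_dLoc _ _ dLoc_structureD, fun M hM =>
      ⟨good_of_dLoc _ _ hM, isZero_L_of_leftOrth (hV V hVl) hM⟩⟩
  rw [hl] at hP h
  refine ⟨P, hP, fun M hM hMP => (h M hM hMP).of_iso ?_⟩
  exact ((supp_top M : (zeroExtSystem X).Supp ⊤ M).isoL).symm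

end Detection

end AlgebraicGeometry.Scheme.Modules

section SigmaComplex

open DerivedCategory

variable {C : Type*} [Category* C] [Abelian C] {J : Type*}

/-- A family of complexes, as a complex of families. -/
@[simps]
noncomputable def famCx (K : J → CochainComplex C ℤ) : CochainComplex (Discrete J ⥤ C) ℤ where
  X n := Discrete.functor fun j => (K j).X n
  d n m := Discrete.natTrans fun j => (K j.as).d n m
  shape n m h := by ext j; exact (K j.as).shape n m h
  d_comp_d' n m p _ _ := by ext j; exact (K j.as).d_comp_d n m p

/-- A family of morphisms of complexes, as a morphism of complexes of families. -/
noncomputable def famCxMap {K L : J → CochainComplex C ℤ} (f : ∀ j, K j ⟶ L j) :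
    famCx K ⟶ famCx L where
  f n := Discrete.natTrans fun j => (f j.as).f n
  comm' n m _ := by ext j; exact (f j.as).comm n m

lemma quasiIso_famCxMap {K L : J → CochainComplex C ℤ} (f : ∀ j, K j ⟶ L j)
    (h : ∀ j, QuasiIso (f j)) : QuasiIso (famCxMap f) := by
  rw [quasiIso_iff]
  intro n
  rw [quasiIsoAt_iff_isIso_homologyMap, NatTrans.isIso_iff_isIso_app]
  intro j
  have h₁ := (quasiIsoAt_iff_isIso_homologyMap (f j.as) n).mp inferInstance
  have h₂ := ShortComplex.mapHomologyIso_hom_naturality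
    ((HomologicalComplex.shortComplexFunctor _ (ComplexShape.up ℤ) n).map (famCxMap f))
    ((evaluation (Discrete J) C).obj j)
  have h₃ : IsIso (ShortComplex.homologyMap (((evaluation (Discrete J) C).obj j).mapShortComplex.map
    ((HomologicalComplex.shortComplexFunctor _ (ComplexShape.up ℤ) n).map (famCxMap f)))) := h₁
  have h₄ := @IsIso.comp_isIso' _ _ _ _ _ _ _ h₃ (ShortComplex.mapHomologyIso
    ((HomologicalComplex.shortComplexFunctor _ (ComplexShape.up ℤ) n).obj (famCx L))
    ((evaluation (Discrete J) C).obj j)).isIso_hom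
  exact @IsIso.of_isIso_comp_left _ _ _ _ _ _ _ (ShortComplex.mapHomologyIso
    ((HomologicalComplex.shortComplexFunctor _ (ComplexShape.up ℤ) n).obj (famCx K))
    ((evaluation (Discrete J) C).obj j)).isIso_hom (h₂ ▸ h₄)

variable [HasColimitsOfShape (Discrete J) C]

/-- The inclusion of a member of a family in its coproduct. -/
noncomputable def evalToColim (j : J) : (evaluation (Discrete J) C).obj ⟨j⟩ ⟶ colim where
  app F := colimit.ι F ⟨j⟩

instance : (colim : (Discrete J ⥤ C) ⥤ C).Additive :=
  Functor.additive_of_preserves_binary_products _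

/-- The coproduct of a family of complexes. -/
noncomputable def sigmaCx (K : J → CochainComplex C ℤ) : CochainComplex C ℤ :=
  ((colim : (Discrete J ⥤ C) ⥤ C).mapHomologicalComplex _).obj (famCx K)

/-- The inclusion of a member of a family of complexes in its coproduct. -/
noncomputable def sigmaCxι (K : J → CochainComplex C ℤ) (j : J) : K j ⟶ sigmaCx K where
  f n := colimit.ι ((famCx K).X n) ⟨j⟩
  comm' n m _ := ((evalToColim j).naturality ((famCx K).d n m)).symm

/-- The morphism of coproducts of complexes induced by a family of morphisms. -/
noncomputable def sigmaCxMap {K L : J → CochainComplex C ℤ} (f : ∀ j, K j ⟶ L j) :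
    sigmaCx K ⟶ sigmaCx L :=
  ((colim : (Discrete J ⥤ C) ⥤ C).mapHomologicalComplex _).map (famCxMap f)

lemma sigmaCxι_comp_sigmaCxMap {K L : J → CochainComplex C ℤ} (f : ∀ j, K j ⟶ L j) (j : J) :
    sigmaCxι K j ≫ sigmaCxMap f = f j ≫ sigmaCxι L j := by
  ext n
  exact ((evalToColim j).naturality ((famCxMap f).f n)).symm

/-- The morphism from a coproduct of complexes given by a family of morphisms. -/
noncomputable def sigmaCxDesc {K : J → CochainComplex C ℤ} {L : CochainComplex C ℤ}
    (f : ∀ j, K j ⟶ L) : sigmaCx K ⟶ L where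
  f n := Sigma.desc (f := fun j => (K j).X n) fun j => (f j).f n
  comm' n m _ := by
    refine Sigma.hom_ext (f := fun j => (K j).X n) _ _ fun j => ?_
    have h₁ := congrArg (· ≫ Sigma.desc (f := fun j => (K j).X m) fun j => (f j).f m)
      ((sigmaCxι K j).comm n m)
    have h₂ := congrArg ((K j).d n m ≫ ·)
      (Sigma.ι_desc (f := fun j => (K j).X m) (fun j => (f j).f m) j)
    have h₃ := congrArg (· ≫ L.d n m)
      (Sigma.ι_desc (f := fun j => (K j).X n) (fun j => (f j).f n) j)
    exact ((Category.assoc _ _ _).symm.trans (h₃.trans ((f j).comm n m))).trans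
      (((Category.assoc _ _ _).symm.trans (h₁.trans ((Category.assoc _ _ _).trans h₂)))).symm

lemma sigmaCxι_comp_sigmaCxDesc {K : J → CochainComplex C ℤ} {L : CochainComplex C ℤ}
    (f : ∀ j, K j ⟶ L) (j : J) : sigmaCxι K j ≫ sigmaCxDesc f = f j := by
  ext n
  exact colimit.ι_desc _ _

variable [HasExactColimitsOfShape (Discrete J) C]

lemma quasiIso_sigmaCxMap {K L : J → CochainComplex C ℤ} (f : ∀ j, K j ⟶ L j)
    (h : ∀ j, QuasiIso (f j)) : QuasiIso (sigmaCxMap f) := by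
  have := quasiIso_famCxMap f h
  exact inferInstanceAs (QuasiIso
    (((colim : (Discrete J ⥤ C) ⥤ C).mapHomologicalComplex _).map (famCxMap f)))

/-- The family of homologies of a family of complexes. -/
noncomputable def famHomology (K : J → CochainComplex C ℤ) (n : ℤ) : Discrete J ⥤ C :=
  ((famCx K).sc n).homology

/-- The homology of a member of a family of complexes. -/
noncomputable def famHomologyIso (K : J → CochainComplex C ℤ) (n : ℤ) (j : J) :
    (K j).homology n ≅ (famHomology K n).obj ⟨j⟩ :=
  ((famCx K).sc n).mapHomologyIso ((evaluation (Discrete J) C).obj ⟨j⟩)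

/-- The homology of a coproduct of complexes. -/
noncomputable def sigmaCxHomologyIso (K : J → CochainComplex C ℤ) (n : ℤ) :
    (sigmaCx K).homology n ≅ colimit (famHomology K n) :=
  ((famCx K).sc n).mapHomologyIso colim

lemma homologyMap_sigmaCxι (K : J → CochainComplex C ℤ) (n : ℤ) (j : J) :
    HomologicalComplex.homologyMap (sigmaCxι K j) n ≫ (sigmaCxHomologyIso K n).hom =
      (famHomologyIso K n j).hom ≫ colimit.ι (famHomology K n) ⟨j⟩ :=
  ((famHomologyIso K n j).inv_comp_eq).mp
    (NatTrans.app_homology (evalToColim (C := C) j) ((famCx K).sc n)).symm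

lemma homologyMap_sigmaCxι_assoc (K : J → CochainComplex C ℤ) (n : ℤ) (j : J) {A : C}
    (h : colimit (famHomology K n) ⟶ A) :
    HomologicalComplex.homologyMap (sigmaCxι K j) n ≫ (sigmaCxHomologyIso K n).hom ≫ h =
      (famHomologyIso K n j).hom ≫ colimit.ι (famHomology K n) ⟨j⟩ ≫ h := by
  rw [← Category.assoc, homologyMap_sigmaCxι, Category.assoc]

lemma sigmaCx_homology_hom_ext {K : J → CochainComplex C ℤ} {n : ℤ} {A : C}
    {f g : (sigmaCx K).homology n ⟶ A}
    (h : ∀ j, HomologicalComplex.homologyMap (sigmaCxι K j) n ≫ f =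
      HomologicalComplex.homologyMap (sigmaCxι K j) n ≫ g) : f = g := by
  rw [← cancel_epi (sigmaCxHomologyIso K n).inv]
  refine colimit.hom_ext fun j => ?_
  rw [← cancel_epi (famHomologyIso K n j.as).hom, ← homologyMap_sigmaCxι_assoc,
    ← homologyMap_sigmaCxι_assoc, Iso.hom_inv_id_assoc, Iso.hom_inv_id_assoc, h]

lemma exists_sigmaCx_homology_desc (K : J → CochainComplex C ℤ) (n : ℤ) {A : C}
    (f : ∀ j, (K j).homology n ⟶ A) : ∃ g : (sigmaCx K).homology n ⟶ A,
      ∀ j, HomologicalComplex.homologyMap (sigmaCxι K j) n ≫ g = f j := by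
  refine ⟨(sigmaCxHomologyIso K n).hom ≫ colimit.desc (famHomology K n)
    ⟨A, Discrete.natTrans fun j => (famHomologyIso K n j.as).inv ≫ f j.as⟩, fun j => ?_⟩
  rw [homologyMap_sigmaCxι_assoc, colimit.ι_desc]
  exact Iso.hom_inv_id_assoc _ _

variable [HasDerivedCategory C]

lemma exists_Q_sigmaCx_desc (K : J → CochainComplex C ℤ) {M : DerivedCategory C}
    (f : ∀ j, Q.obj (K j) ⟶ M) : ∃ g : Q.obj (sigmaCx K) ⟶ M,
      ∀ j, Q.map (sigmaCxι K j) ≫ g = f j := by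
  obtain ⟨N, ⟨e⟩⟩ := exists_Q_obj_iso M
  choose K' s hs f' hf' using fun j => right_fac (f j ≫ e.inv)
  have hs' : ∀ j, QuasiIso (s j) := fun j => (isIso_Q_map_iff_quasiIso C (s j)).mp (hs j)
  have := (isIso_Q_map_iff_quasiIso C (sigmaCxMap s)).mpr (quasiIso_sigmaCxMap s hs')
  refine ⟨inv (Q.map (sigmaCxMap s)) ≫ Q.map (sigmaCxDesc f') ≫ e.hom, fun j => ?_⟩
  have hj := hs j
  rw [← cancel_mono e.inv, hf' j, ← cancel_epi (Q.map (s j)), ← Category.assoc, ← Category.assoc,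
    ← Q.map_comp, ← sigmaCxι_comp_sigmaCxMap, Q.map_comp]
  simp only [Category.assoc, IsIso.hom_inv_id_assoc, Iso.hom_inv_id, Category.comp_id]
  rw [← Q.map_comp, sigmaCxι_comp_sigmaCxDesc]

/-- The homology of a coproduct in the derived category is a retract of the coproduct of the
homologies. -/
lemma exists_homology_sigma_section (Y : J → DerivedCategory C) [HasCoproduct Y] (n : ℤ) :
    ∃ σ : (homologyFunctor C n).obj (∐ Y) ⟶ ∐ fun j => (homologyFunctor C n).obj (Y j),
      σ ≫ Sigma.desc (fun j => (homologyFunctor C n).map (Sigma.ι Y j)) = 𝟙 _ := by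
  choose K e using fun j => exists_Q_obj_iso (Y j)
  replace e := fun j => (e j).some
  obtain ⟨d, hd⟩ := exists_Q_sigmaCx_desc K fun j => (e j).hom ≫ Sigma.ι Y j
  let c : ∐ Y ⟶ Q.obj (sigmaCx K) := Sigma.desc fun j => (e j).inv ≫ Q.map (sigmaCxι K j)
  have hcd : c ≫ d = 𝟙 _ := by
    refine Sigma.hom_ext _ _ fun j => ?_
    rw [Sigma.ι_desc_assoc, Category.assoc, hd, Iso.inv_hom_id_assoc, Category.comp_id]
  let φ (L : CochainComplex C ℤ) : (homologyFunctor C n).obj (Q.obj L) ≅ L.homology n :=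
    (homologyFunctorFactors C n).app L
  have hφ (j : J) : HomologicalComplex.homologyMap (sigmaCxι K j) n ≫ (φ (sigmaCx K)).inv =
      (φ (K j)).inv ≫ (homologyFunctor C n).map (Q.map (sigmaCxι K j)) :=
    (homologyFunctorFactors C n).inv.naturality (sigmaCxι K j)
  obtain ⟨g, hg⟩ := exists_sigmaCx_homology_desc K n
    fun j => (φ (K j)).inv ≫ (homologyFunctor C n).map (e j).hom ≫
      Sigma.ι (fun j => (homologyFunctor C n).obj (Y j)) j
  refine ⟨(homologyFunctor C n).map c ≫ (φ (sigmaCx K)).hom ≫ g, ?_⟩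
  have key : g ≫ Sigma.desc (fun j => (homologyFunctor C n).map (Sigma.ι Y j)) =
      (φ (sigmaCx K)).inv ≫ (homologyFunctor C n).map d := by
    refine sigmaCx_homology_hom_ext fun j => ?_
    rw [reassoc_of% (hg j), Sigma.ι_desc, ← Functor.map_comp, ← hd j, Functor.map_comp,
      reassoc_of% (hφ j)]
  rw [Category.assoc, Category.assoc, key, Iso.hom_inv_id_assoc, ← Functor.map_comp, hcd,
    CategoryTheory.Functor.map_id]

end SigmaComplex

section FiniteFactorization

open Pretriangulated

variable {T : Type (u + 1)} [Category.{w} T] [Preadditive T] (S : T → Prop)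

/-- Every morphism from `E` to a coproduct of objects satisfying `S` factors through a finite
subsum. -/
def FinFactor (E : T) : Prop :=
  ∀ (J : Type u) [DecidableEq J] (Y : J → T) [HasCoproduct Y], (∀ j, S (Y j)) →
    ∀ f : E ⟶ ∐ Y, ∃ F : Finset J, f ≫ sigmaTrunc Y F = f

variable {S}

lemma FinFactor.isCompactObjIn {E : T} (h : FinFactor S E) : IsCompactObjIn S E :=
  fun J _ Y _ hY => ⟨coproductComparison_injective E Y, fun f => by
    obtain ⟨F, hF⟩ := h J Y hY f
    exact coproductComparison_mem_range F hF⟩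

lemma FinFactor.of_iso {E E' : T} (h : FinFactor S E) (e : E ≅ E') : FinFactor S E' := by
  intro J _ Y _ hY f
  obtain ⟨F, hF⟩ := h J Y hY (e.hom ≫ f)
  exact ⟨F, by rwa [Category.assoc, cancel_epi] at hF⟩

variable [HasZeroObject T] [HasShift T ℤ] [∀ n : ℤ, (shiftFunctor T n).Additive] [Pretriangulated T]

lemma FinFactor.ext {t : Triangle T} (ht : t ∈ distTriang T) (h₁ : FinFactor S t.obj₁)
    (h₃ : FinFactor S t.obj₃) : FinFactor S t.obj₂ := by
  intro J _ Y _ hY f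
  obtain ⟨F, hF⟩ := h₁ J Y hY (t.mor₁ ≫ f)
  obtain ⟨f', hf'⟩ := t.yoneda_exact₂ ht (f - f ≫ sigmaTrunc Y F) (by
    rw [Preadditive.comp_sub, ← Category.assoc, hF, sub_self])
  obtain ⟨G, hG⟩ := h₃ J Y hY f'
  refine ⟨F ∪ G, ?_⟩
  have hf : f = t.mor₂ ≫ f' ≫ sigmaTrunc Y G + f ≫ sigmaTrunc Y F := by
    rw [hG, ← hf', sub_add_cancel]
  conv_lhs => rw [hf]
  conv_rhs => rw [hf]
  simp only [Preadditive.add_comp, Category.assoc,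
    sigmaTrunc_comp Y (Finset.subset_union_left : F ⊆ F ∪ G),
    sigmaTrunc_comp Y (Finset.subset_union_right : G ⊆ F ∪ G)]

lemma triClosed_finFactor : TriClosed fun E : T => ∀ n : ℤ, FinFactor S (E⟦n⟧) where
  iso e h n := (h n).of_iso ((shiftFunctor T n).mapIso e)
  shift m h n := (h (m + n)).of_iso ((shiftFunctorAdd T m n).app _)
  ext ht h₁ h₃ n := FinFactor.ext (Triangle.shift_distinguished _ ht n) (h₁ n) (h₃ n)

end FiniteFactorization

namespace AlgebraicGeometry.Scheme.Modules

section Compactness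

open DerivedCategory ZeroExtSystem

variable {X}

lemma Localizing.of_retract {F G : X.Modules} (hG : Localizing G) (i : F ⟶ G) (r : G ⟶ F)
    (h : i ≫ r = 𝟙 F) : Localizing F := by
  intro V hV g
  have h' (U : X.Opens) (s : Γ(F, U)) : r.app U (i.app U s) = s := congr(($h).app U s)
  refine ⟨fun t => ?_, fun s hs => ?_⟩
  · obtain ⟨m, s, hs⟩ := (hG V hV g).1 (i.app _ t)
    refine ⟨m, r.app V s, ?_⟩
    rw [← app_res, hs, Hom.app_smul, h']
  · obtain ⟨k, hk⟩ := (hG V hV g).2 (i.app _ s) (by rw [← app_res, hs, app_zero_sec])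
    refine ⟨k, ?_⟩
    rw [← h' V s, ← Hom.app_smul, hk, app_zero_sec]

lemma Localizing.sigma {J : Type u} {N : J → X.Modules} (hN : ∀ j, Localizing (N j)) :
    Localizing (∐ N) := by
  classical
  intro V hV g
  have hins (F : Finset J) (j : J) (hj : j ∉ F) (U : X.Opens) (t : Γ(∐ N, U)) :
      (sigmaTrunc N (insert j F)).app U t =
        (Sigma.ι N j).app U ((Sigma.π N j).app U t) + (sigmaTrunc N F).app U t := by
    rw [sigmaTrunc, Finset.sum_insert hj]
    rfl
  refine ⟨fun t => ?_, fun s hs => ?_⟩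
  · obtain ⟨F, hF⟩ := exists_sigmaTrunc_app N (hV.basicOpen g).isCompact t
    rw [← hF]
    clear hF
    induction F using Finset.induction with
    | empty => exact ⟨0, 0, by simp [sigmaTrunc]⟩
    | insert j F hj ih =>
      obtain ⟨m, s, hs⟩ := ih
      obtain ⟨m', s', hs'⟩ := (hN j V hV g).1 ((Sigma.π N j).app _ t)
      refine ⟨m + m', g ^ m • (Sigma.ι N j).app V s' + g ^ m' • s, ?_⟩
      rw [hins F j hj, map_add, res_smul, res_smul, hs, ← app_res, hs', Hom.app_smul, smul_smul,
        smul_smul, smul_add, ← map_mul, ← map_mul, ← pow_add, ← pow_add, add_comm m' m]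
  · obtain ⟨F, hF⟩ := exists_sigmaTrunc_app N hV.isCompact s
    rw [← hF]
    clear hF
    induction F using Finset.induction with
    | empty => exact ⟨0, by simp [sigmaTrunc]⟩
    | insert j F hj ih =>
      obtain ⟨k, hk⟩ := ih
      obtain ⟨k', hk'⟩ := (hN j V hV g).2 ((Sigma.π N j).app _ s) (by
        rw [← app_res, hs, app_zero_sec])
      refine ⟨k + k', ?_⟩
      rw [hins F j hj, smul_add, pow_add, mul_smul, mul_smul, smul_comm _ _ (Hom.app _ _ s), hk,
        ← Hom.app_smul, hk', app_zero_sec, smul_zero, smul_zero, add_zero]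

variable [HasDerivedCategory.{w} X.Modules]

lemma dLoc_sigma {J : Type u} {Y : J → DerivedCategory X.Modules} [HasCoproduct Y]
    (hY : ∀ j, DLoc (Y j)) : DLoc (∐ Y) := fun n => by
  obtain ⟨σ, hσ⟩ := exists_homology_sigma_section Y n
  exact (Localizing.sigma fun j => hY j n).of_retract σ _ hσ

lemma finFactor_zeroExtD {V : X.Opens} (hV : IsAffineOpen V) (q : ℤ) :
    FinFactor DLoc (zeroExtD q V) := by
  intro J _ Y _ hY f
  obtain ⟨σ, hσ⟩ := exists_homology_sigma_section Y q
  let N (j : J) := (homologyFunctor X.Modules q).obj (Y j)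
  let η : ∐ N ⟶ (homologyFunctor X.Modules q).obj (∐ Y) :=
    Sigma.desc fun j => (homologyFunctor X.Modules q).map (Sigma.ι Y j)
  have hM := dLoc_sigma hY
  obtain ⟨F, hF⟩ := exists_comp_sigmaTrunc
    ((coproductComparison_zeroExtO_bijective N hV.isCompact).2 (zeroExtDHom hV hM q f ≫ σ))
  have hη : sigmaTrunc N F ≫ η = η ≫ (homologyFunctor X.Modules q).map (sigmaTrunc Y F) := by
    refine Sigma.hom_ext _ _ fun j => ?_
    rw [← Category.assoc, ι_sigmaTrunc, Sigma.ι_desc_assoc, ← Functor.map_comp, ι_sigmaTrunc]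
    split_ifs
    · rw [Sigma.ι_desc]
    · rw [zero_comp, Functor.map_zero]
  refine ⟨F, (zeroExtDHom hV hM q).injective ?_⟩
  have hσ' : zeroExtDHom hV hM q f = (zeroExtDHom hV hM q f ≫ σ) ≫ η :=
    ((Category.assoc _ _ _).trans ((congrArg _ hσ).trans (Category.comp_id _))).symm
  rw [zeroExtDHom_comp hV hM hM, hσ', Category.assoc, ← hη, ← Category.assoc, hF]

lemma finFactor_of_isAffineOpen {V : X.Opens} (hV : IsAffineOpen V) (n : ℤ) :
    FinFactor DLoc ((((zeroExtSystem X).L V).obj (structureD X))⟦n⟧) :=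
  (finFactor_zeroExtD hV (-n)).of_iso
    ((singleShiftIso _ n).symm ≪≫ (shiftFunctor _ n).mapIso (zeroExtStructureDIso V).symm)

variable [IsNoetherian X]

lemma finFactor_of_le {V U : X.Opens} (hV : IsAffineOpen V) (hU : U ≤ V) (n : ℤ) :
    FinFactor DLoc ((((zeroExtSystem X).L U).obj (structureD X))⟦n⟧) := by
  obtain ⟨l, rfl⟩ := exists_list_basicOpen hV hU
  refine mayerVietoris (S := zeroExtSystem X) (P := structureD X) triClosed_finFactor
    (B := Set.range (X.basicOpen (U := V))) ?_ ?_ ⟨_, finFactor_of_isAffineOpen hV⟩ ?_ n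
  · rintro _ ⟨f, rfl⟩ _ ⟨g, rfl⟩
    exact ⟨f * g, X.basicOpen_mul f g⟩
  · rintro _ ⟨f, rfl⟩
    exact finFactor_of_isAffineOpen (hV.basicOpen f)
  · intro a ha
    obtain ⟨f, -, rfl⟩ := List.mem_map.mp ha
    exact ⟨f, rfl⟩

lemma finFactor_L (U : X.Opens) (n : ℤ) :
    FinFactor DLoc ((((zeroExtSystem X).L U).obj (structureD X))⟦n⟧) := by
  obtain ⟨l, rfl, hl⟩ := exists_list_isAffineOpen_le U
  exact mayerVietoris (S := zeroExtSystem X) (P := structureD X) triClosed_finFactor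
    (B := {U | ∃ V : X.Opens, IsAffineOpen V ∧ U ≤ V})
    (fun _ ⟨V, hV, h⟩ _ _ => ⟨V, hV, inf_le_left.trans h⟩)
    (fun _ ⟨V, hV, h⟩ => finFactor_of_le hV h) ⟨_, finFactor_of_le (isAffineOpen_bot X) le_rfl⟩
    (fun V hV => ⟨V, hl V hV, le_rfl⟩) n

theorem isCompactObjIn_of_locFin {P : DerivedCategory X.Modules}
    (hP : (zeroExtSystem X).LocFin (structureD X) ⊤ P) : IsCompactObjIn DLoc P :=
  ((hP.mem triClosed_finFactor finFactor_L 0).of_iso ((shiftFunctorZero _ ℤ).app P)).isCompactObjIn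

end Compactness

end AlgebraicGeometry.Scheme.Modules

section FullyFaithfulOnSpan

open Pretriangulated

variable {T T' : Type*} [Category* T] [Category* T'] (F : T ⥤ T')

/-- A functor is bijective on the morphisms between two given objects. -/
def HomBijective (A B : T) : Prop := Function.Bijective (F.map : (A ⟶ B) → (F.obj A ⟶ F.obj B))

variable {F}

lemma HomBijective.of_iso {A A' B B' : T} (h : HomBijective F A B) (e : A ≅ A') (e' : B ≅ B') :
    HomBijective F A' B' := by
  refine ⟨fun f g hfg => ?_, fun f => ?_⟩
  · have : e.hom ≫ f ≫ e'.inv = e.hom ≫ g ≫ e'.inv := h.1 (by simp [hfg])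
    simpa using this
  · obtain ⟨g, hg⟩ := h.2 (F.map e.hom ≫ f ≫ F.map e'.inv)
    exact ⟨e.inv ≫ g ≫ e'.hom, by simp [hg, ← F.map_comp_assoc, ← F.map_comp]⟩

variable [HasShift T ℤ] [HasShift T' ℤ]

lemma HomBijective.shift [F.CommShift ℤ] {A B : T} (h : HomBijective F A B) (n : ℤ) :
    HomBijective F (A⟦n⟧) (B⟦n⟧) := by
  have key (f : A ⟶ B) : F.map (f⟦n⟧') =
      (F.commShiftIso n).hom.app A ≫ (F.map f)⟦n⟧' ≫ (F.commShiftIso n).inv.app B := by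
    have := (F.commShiftIso n).hom.naturality f
    dsimp at this
    rw [← reassoc_of% this]
    simp
  refine ⟨fun f g hfg => ?_, fun f => ?_⟩
  · obtain ⟨f, rfl⟩ := (shiftFunctor T n).map_surjective f
    obtain ⟨g, rfl⟩ := (shiftFunctor T n).map_surjective g
    rw [key, key, cancel_epi, cancel_mono] at hfg
    rw [h.1 ((shiftFunctor T' n).map_injective hfg)]
  · obtain ⟨g, hg⟩ := (shiftFunctor T' n).map_surjective
      ((F.commShiftIso n).inv.app A ≫ f ≫ (F.commShiftIso n).hom.app B)
    obtain ⟨g, rfl⟩ := h.2 g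
    exact ⟨g⟦n⟧', by rw [key, hg]; simp⟩

lemma HomBijective.shift_left [F.CommShift ℤ] {A B : T} {n : ℤ} (h : HomBijective F A (B⟦-n⟧)) :
    HomBijective F (A⟦n⟧) B :=
  (h.shift n).of_iso (Iso.refl _) ((shiftFunctorCompIsoId T (-n) n (neg_add_cancel n)).app B)

variable [HasZeroObject T] [Preadditive T]
  [∀ n : ℤ, (shiftFunctor T n).Additive] [Pretriangulated T] [HasZeroObject T'] [Preadditive T']
  [∀ n : ℤ, (shiftFunctor T' n).Additive] [Pretriangulated T']
  [F.CommShift ℤ] [F.Additive] [F.IsTriangulated]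

lemma HomBijective.ext_right {S : T} {t : Triangle T} (ht : t ∈ distTriang T)
    (h₁ : HomBijective F S t.obj₁) (h₃ : HomBijective F S t.obj₃)
    (h₁' : HomBijective F S (t.obj₁⟦(1 : ℤ)⟧)) (h₃' : HomBijective F S (t.obj₃⟦(-1 : ℤ)⟧)) :
    HomBijective F S t.obj₂ := by
  have hF := F.map_distinguished _ ht
  obtain ⟨r, s, hi⟩ : ∃ (r : t.obj₃⟦(-1 : ℤ)⟧ ⟶ t.obj₁) (s : t.obj₂ ⟶ t.obj₃⟦(-1 : ℤ)⟧⟦(1 : ℤ)⟧),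
    Triangle.mk r t.mor₁ s ∈ distTriang T := ⟨_, _, inv_rot_of_distTriang _ ht⟩
  have hFi := F.map_distinguished _ hi
  refine ⟨?_, fun g => ?_⟩
  · suffices ∀ g : S ⟶ t.obj₂, F.map g = 0 → g = 0 from fun f g hfg =>
      sub_eq_zero.mp (this _ (by rw [F.map_sub, sub_eq_zero]; exact hfg))
    intro g hg
    have e : g ≫ t.mor₂ = 0 := h₃.1 (by rw [F.map_comp, hg, zero_comp, F.map_zero])
    obtain ⟨a, rfl⟩ := Triangle.coyoneda_exact₂ _ ht g e
    obtain ⟨c, hc⟩ := Triangle.coyoneda_exact₂ _ hFi (F.map a)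
      (by rw [F.map_comp] at hg; exact hg)
    obtain ⟨c, rfl⟩ := h₃'.2 c
    have hc' : a = c ≫ r := h₁.1 (by rw [F.map_comp]; exact hc)
    have h0 : r ≫ t.mor₁ = 0 := comp_distTriang_mor_zero₁₂ _ hi
    rw [hc', Category.assoc, h0, comp_zero]
  · obtain ⟨h, hh⟩ := h₃.2 (g ≫ F.map t.mor₂)
    have e : h ≫ t.mor₃ = 0 := h₁'.1 (by
      rw [F.map_comp, hh, Category.assoc, ← F.map_comp, comp_distTriang_mor_zero₂₃ _ ht,
        F.map_zero, F.map_zero, comp_zero])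
    obtain ⟨k, rfl⟩ := Triangle.coyoneda_exact₃ _ ht h e
    obtain ⟨a, ha⟩ := Triangle.coyoneda_exact₂ _ hF (g - F.map k)
      (by
        change (g - F.map k) ≫ F.map t.mor₂ = 0
        rw [Preadditive.sub_comp, ← hh, F.map_comp, sub_self])
    obtain ⟨a, rfl⟩ := h₁.2 a
    refine ⟨a ≫ t.mor₁ + k, ?_⟩
    rw [F.map_add, F.map_comp]
    exact (sub_eq_iff_eq_add.mp ha).symm

lemma HomBijective.ext_left {B : T} {t : Triangle T} (ht : t ∈ distTriang T)
    (h₁ : HomBijective F t.obj₁ B) (h₃ : HomBijective F t.obj₃ B)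
    (h₁' : HomBijective F (t.obj₁⟦(1 : ℤ)⟧) B) (h₃' : HomBijective F (t.obj₃⟦(-1 : ℤ)⟧) B) :
    HomBijective F t.obj₂ B := by
  have hF := F.map_distinguished _ ht
  obtain ⟨r, s, hi⟩ : ∃ (r : t.obj₃⟦(-1 : ℤ)⟧ ⟶ t.obj₁) (s : t.obj₂ ⟶ t.obj₃⟦(-1 : ℤ)⟧⟦(1 : ℤ)⟧),
    Triangle.mk r t.mor₁ s ∈ distTriang T := ⟨_, _, inv_rot_of_distTriang _ ht⟩
  refine ⟨?_, fun g => ?_⟩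
  · suffices ∀ g : t.obj₂ ⟶ B, F.map g = 0 → g = 0 from fun f g hfg =>
      sub_eq_zero.mp (this _ (by rw [F.map_sub, sub_eq_zero]; exact hfg))
    intro g hg
    have e : t.mor₁ ≫ g = 0 := h₁.1 (by rw [F.map_comp, hg, comp_zero, F.map_zero])
    obtain ⟨a, rfl⟩ := Triangle.yoneda_exact₂ _ ht g e
    obtain ⟨c, hc⟩ := Triangle.yoneda_exact₃ _ hF (F.map a)
      (by rw [F.map_comp] at hg; exact hg)
    obtain ⟨c', hc'⟩ := h₁'.2 ((F.commShiftIso (1 : ℤ)).hom.app _ ≫ c)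
    have e' : a = t.mor₃ ≫ c' := h₃.1 (by
      rw [F.map_comp, hc', hc]
      exact Category.assoc _ _ _)
    rw [e', ← Category.assoc, comp_distTriang_mor_zero₂₃ _ ht, zero_comp]
  · obtain ⟨h, hh⟩ := h₁.2 (F.map t.mor₁ ≫ g)
    have h0 : r ≫ t.mor₁ = 0 := comp_distTriang_mor_zero₁₂ _ hi
    have e : r ≫ h = 0 := h₃'.1 (by
      rw [F.map_comp, hh, ← Category.assoc, ← F.map_comp, h0, F.map_zero, zero_comp, F.map_zero])
    obtain ⟨k, hk⟩ : ∃ k : t.obj₂ ⟶ B, h = t.mor₁ ≫ k := Triangle.yoneda_exact₂ _ hi h e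
    obtain ⟨a, ha⟩ := Triangle.yoneda_exact₂ _ hF (g - F.map k)
      (by
        change F.map t.mor₁ ≫ (g - F.map k) = 0
        rw [Preadditive.comp_sub, ← hh, hk, ← F.map_comp, sub_self])
    obtain ⟨a, rfl⟩ := h₃.2 a
    refine ⟨t.mor₂ ≫ a + k, ?_⟩
    rw [F.map_add, F.map_comp]
    exact (sub_eq_iff_eq_add.mp ha).symm

lemma homBijective_of_triSpan {S : T} (hS : ∀ n : ℤ, HomBijective F S (S⟦n⟧)) {A B : T}
    (hA : TriSpan S A) (hB : TriSpan S B) : HomBijective F A B := by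
  have h₁ : TriClosed fun B : T => ∀ n : ℤ, HomBijective F S (B⟦n⟧) :=
    { iso e h n := (h n).of_iso (Iso.refl _) ((shiftFunctor T n).mapIso e)
      shift m h n := (h (m + n)).of_iso (Iso.refl _) ((shiftFunctorAdd T m n).app _)
      ext ht h₁ h₃ n := by
        have := Triangle.shift_distinguished _ ht n
        exact HomBijective.ext_right this (h₁ n) (h₃ n)
          ((h₁ (n + 1)).of_iso (Iso.refl _) ((shiftFunctorAdd T n 1).app _))
          ((h₃ (n + -1)).of_iso (Iso.refl _) ((shiftFunctorAdd T n (-1)).app _)) }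
  have h₂ : TriClosed fun A : T => ∀ B : T, TriSpan S B → HomBijective F A B :=
    { iso e h B hB := (h B hB).of_iso e (Iso.refl _)
      shift n h B hB := (h _ (hB.shift (-n))).shift_left
      ext ht h₁ h₃ B hB := HomBijective.ext_left ht (h₁ B hB) (h₃ B hB)
        (h₁ _ (hB.shift _)).shift_left (h₃ _ (hB.shift _)).shift_left }
  refine hA.le h₂ (fun B hB => ?_) B hB
  exact (hB.le h₁ hS 0).of_iso (Iso.refl _) ((shiftFunctorZero T ℤ).app B)

lemma TriSpan.exists_iso_map {S : T} (hS : ∀ n : ℤ, HomBijective F S (S⟦n⟧)) {P : T'}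
    (hP : TriSpan (F.obj S) P) : ∃ A : T, TriSpan S A ∧ Nonempty (F.obj A ≅ P) := by
  refine hP.le (P := fun P => ∃ A : T, TriSpan S A ∧ Nonempty (F.obj A ≅ P)) ?_
    ⟨S, .base, ⟨Iso.refl _⟩⟩
  refine ⟨fun e => ?_, fun n => ?_, fun {t} ht => ?_⟩
  · rintro ⟨A, hA, ⟨i⟩⟩
    exact ⟨A, hA, ⟨i ≪≫ e⟩⟩
  · rintro ⟨A, hA, ⟨i⟩⟩
    exact ⟨A⟦n⟧, hA.shift n, ⟨(F.commShiftIso n).app A ≪≫ (shiftFunctor T' n).mapIso i⟩⟩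
  · rintro ⟨A, hA, ⟨i⟩⟩ ⟨C, hC, ⟨j⟩⟩
    obtain ⟨h, hh⟩ := (homBijective_of_triSpan hS hC (hA.shift 1)).2
      (j.hom ≫ t.mor₃ ≫ i.inv⟦(1 : ℤ)⟧' ≫ (F.commShiftIso (1 : ℤ)).inv.app A)
    obtain ⟨B, f, g, hB⟩ := distinguished_cocone_triangle₂ h
    have hc : (F.map h ≫ (F.commShiftIso (1 : ℤ)).hom.app A) ≫ i.hom⟦(1 : ℤ)⟧' =
        j.hom ≫ t.mor₃ := by
      rw [hh]
      simp only [Category.assoc, Iso.inv_hom_id_app_assoc]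
      rw [← Functor.map_comp, Iso.inv_hom_id, CategoryTheory.Functor.map_id]
      exact congr(j.hom ≫ $(Category.comp_id _))
    obtain ⟨b, hb₁, hb₂⟩ := complete_distinguished_triangle_morphism₂ _ _
      (F.map_distinguished _ hB) ht i.hom j.hom hc
    have : IsIso b := isIso₂_of_isIso₁₃ (T := F.mapTriangle.obj (Triangle.mk f g h)) (T' := t)
      { hom₁ := i.hom, hom₂ := b, hom₃ := j.hom, comm₁ := hb₁, comm₂ := hb₂, comm₃ := hc }
      (F.map_distinguished _ hB) ht i.isIso_hom j.isIso_hom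
    exact ⟨B, TriSpan.ext hB hA hC, ⟨@asIso _ _ _ _ b this⟩⟩

end FullyFaithfulOnSpan

section BoundedComplexes

open Pretriangulated HomologicalComplex

/-- A class of objects of an additive category closed under isomorphisms and finite direct sums. -/
structure AddClosed {C : Type*} [Category* C] [Preadditive C] [HasBinaryBiproducts C]
    (𝒞 : C → Prop) : Prop where
  iso {M N : C} (e : M ≅ N) : 𝒞 M → 𝒞 N
  zero {M : C} (hM : IsZero M) : 𝒞 M
  biprod {M N : C} : 𝒞 M → 𝒞 N → 𝒞 (M ⊞ N)

/-- Bounded complexes whose terms belong to a given class. -/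
def BoundedIn {C : Type*} [Category* C] [Preadditive C] (𝒞 : C → Prop) (L : CochainComplex C ℤ) :
    Prop :=
  (∃ a b : ℤ, ∀ n : ℤ, (n < a ∨ b < n) → IsZero (L.X n)) ∧ ∀ n : ℤ, 𝒞 (L.X n)

variable {C : Type*} [Category* C] [Abelian C] {𝒞 : C → Prop}

lemma BoundedIn.shift {L : CochainComplex C ℤ} (hL : BoundedIn 𝒞 L) (m : ℤ) :
    BoundedIn 𝒞 (L⟦m⟧) := by
  obtain ⟨⟨a, b, h⟩, h'⟩ := hL
  exact ⟨⟨a - m, b - m, fun n hn => h (n + m) (by lia)⟩, fun n => h' (n + m)⟩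

lemma BoundedIn.mappingCone (h𝒞 : AddClosed 𝒞) {L L' : CochainComplex C ℤ} (hL : BoundedIn 𝒞 L)
    (hL' : BoundedIn 𝒞 L') (φ : L ⟶ L') : BoundedIn 𝒞 (CochainComplex.mappingCone φ) := by
  obtain ⟨⟨a, b, h⟩, h₁⟩ := hL
  obtain ⟨⟨a', b', h'⟩, h₁'⟩ := hL'
  let e (n : ℤ) : (CochainComplex.mappingCone φ).X n ≅ L.X (n + 1) ⊞ L'.X n :=
    homotopyCofiber.XIsoBiprod φ n (n + 1) rfl
  refine ⟨⟨min (a - 1) a', max b b', fun n hn => ?_⟩,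
    fun n => h𝒞.iso (e n).symm (h𝒞.biprod (h₁ _) (h₁' _))⟩
  refine IsZero.of_iso ?_ (e n)
  rw [biprod_isZero_iff]
  exact ⟨h _ (by lia), h' _ (by lia)⟩

lemma BoundedIn.single (h𝒞 : AddClosed 𝒞) {M : C} (hM : 𝒞 M) (n : ℤ) :
    BoundedIn 𝒞 ((HomologicalComplex.single C (.up ℤ) n).obj M) := by
  refine ⟨⟨n, n, fun m hm => isZero_single_obj_X _ _ _ _ (by lia)⟩, fun m => ?_⟩
  by_cases h : m = n
  · subst h
    exact h𝒞.iso (singleObjXSelf _ _ _).symm hM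
  · exact h𝒞.zero (isZero_single_obj_X _ _ _ _ h)

lemma triClosed_boundedIn (h𝒞 : AddClosed 𝒞) : TriClosed fun A : HomotopyCategory C (.up ℤ) =>
    ∃ L, BoundedIn 𝒞 L ∧ Nonempty ((HomotopyCategory.quotient C (.up ℤ)).obj L ≅ A) := by
  let q := HomotopyCategory.quotient C (.up ℤ)
  have hs (A : HomotopyCategory C (.up ℤ)) (n : ℤ) :
      (∃ L, BoundedIn 𝒞 L ∧ Nonempty (q.obj L ≅ A)) →
        ∃ L, BoundedIn 𝒞 L ∧ Nonempty (q.obj L ≅ A⟦n⟧) := by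
    rintro ⟨L, hL, ⟨e⟩⟩
    exact ⟨L⟦n⟧, hL.shift n, ⟨(q.commShiftIso n).app L ≪≫ (shiftFunctor _ n).mapIso e⟩⟩
  have hc (t : Triangle (HomotopyCategory C (.up ℤ))) (ht : t ∈ distTriang _) :
      (∃ L, BoundedIn 𝒞 L ∧ Nonempty (q.obj L ≅ t.obj₁)) →
      (∃ L, BoundedIn 𝒞 L ∧ Nonempty (q.obj L ≅ t.obj₂)) →
        ∃ L, BoundedIn 𝒞 L ∧ Nonempty (q.obj L ≅ t.obj₃) := by
    rintro ⟨L, hL, ⟨e⟩⟩ ⟨L', hL', ⟨e'⟩⟩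
    obtain ⟨φ, hφ⟩ := q.map_surjective (e.hom ≫ t.mor₁ ≫ e'.inv)
    refine ⟨_, hL.mappingCone h𝒞 hL' φ, ⟨Triangle.π₃.mapIso (isoTriangleOfIso₁₂ _ _
      (HomotopyCategory.mappingCone_triangleh_distinguished φ) ht e e' ?_)⟩⟩
    change q.map φ ≫ e'.hom = e.hom ≫ t.mor₁
    rw [hφ]
    simp
  refine ⟨fun e => ?_, fun n => hs _ n, fun {t} ht h₁ h₃ => ?_⟩
  · rintro ⟨L, hL, ⟨i⟩⟩
    exact ⟨L, hL, ⟨i ≪≫ e⟩⟩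
  · obtain ⟨L, hL, ⟨e⟩⟩ := hs _ (-1) (hc _ (rot_of_distTriang _ (rot_of_distTriang _ ht)) h₃
      (hs _ 1 h₁))
    exact ⟨L, hL, ⟨e ≪≫ (shiftFunctorCompIsoId _ (1 : ℤ) (-1) (by lia)).app t.obj₂⟩⟩

lemma homBijective_single [HasDerivedCategory C] {M : C}
    (hM : ∀ m : ℤ, m ≠ 0 → ∀ f : (DerivedCategory.singleFunctor C 0).obj M ⟶
      (DerivedCategory.singleFunctor C m).obj M, f = 0) (m : ℤ) :
    HomBijective (DerivedCategory.Qh (C := C)) ((HomotopyCategory.singleFunctor C 0).obj M)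
      ((HomotopyCategory.singleFunctor C m).obj M) := by
  by_cases h : m = 0
  · subst h
    refine ⟨fun f g hfg => ?_, fun f => ?_⟩
    · obtain ⟨φ, rfl⟩ := (HomotopyCategory.quotient C (.up ℤ)).map_surjective f
      obtain ⟨ψ, rfl⟩ := (HomotopyCategory.quotient C (.up ℤ)).map_surjective g
      obtain ⟨φ, rfl⟩ := (HomologicalComplex.single C (.up ℤ) 0).map_surjective φ
      obtain ⟨ψ, rfl⟩ := (HomologicalComplex.single C (.up ℤ) 0).map_surjective ψ
      rw [(DerivedCategory.singleFunctor C 0).map_injective hfg]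
    · obtain ⟨φ, rfl⟩ := (DerivedCategory.singleFunctor C 0).map_surjective f
      exact ⟨(HomotopyCategory.singleFunctor C 0).map φ, rfl⟩
  · refine ⟨fun f g _ => ?_, fun f => ⟨0, (Functor.map_zero _ _ _).trans (hM m h f).symm⟩⟩
    obtain ⟨φ, rfl⟩ := (HomotopyCategory.quotient C (.up ℤ)).map_surjective f
    obtain ⟨ψ, rfl⟩ := (HomotopyCategory.quotient C (.up ℤ)).map_surjective g
    congr 1
    exact from_single_hom_ext ((isZero_single_obj_X _ _ _ _ (Ne.symm h)).eq_of_tgt _ _)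

/-- If an object has no self-extensions, then the objects of the triangulated subcategory it spans
are represented by bounded complexes of finite sums of copies of it. -/
lemma exists_boundedIn_of_triSpan (h𝒞 : AddClosed 𝒞) [HasDerivedCategory C] {M : C} (h𝒞M : 𝒞 M)
    (hM : ∀ m : ℤ, m ≠ 0 → ∀ f : (DerivedCategory.singleFunctor C 0).obj M ⟶
      (DerivedCategory.singleFunctor C m).obj M, f = 0) {P : DerivedCategory C}
    (hP : TriSpan ((DerivedCategory.singleFunctor C 0).obj M) P) :
    ∃ L, BoundedIn 𝒞 L ∧ Nonempty (DerivedCategory.Q.obj L ≅ P) := by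
  obtain ⟨A, hA, ⟨e⟩⟩ := TriSpan.exists_iso_map (F := DerivedCategory.Qh (C := C))
    (S := (HomotopyCategory.singleFunctor C 0).obj M)
    (fun n => (homBijective_single hM (-n)).of_iso (Iso.refl _)
      (((HomotopyCategory.singleFunctors C).shiftIso n (-n) 0 (by lia)).app M).symm) hP
  obtain ⟨L, hL, ⟨i⟩⟩ := hA.le (triClosed_boundedIn h𝒞)
    ⟨_, BoundedIn.single h𝒞 h𝒞M 0, ⟨Iso.refl _⟩⟩
  exact ⟨L, hL, ⟨DerivedCategory.Qh.mapIso i ≪≫ e⟩⟩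

end BoundedComplexes

section AddClosedClasses

lemma AddClosed.inverseImage {C D : Type*} [Category* C] [Category* D] [Preadditive C]
    [Preadditive D] [HasBinaryBiproducts C] [HasBinaryBiproducts D] {𝒟 : D → Prop}
    (h : AddClosed 𝒟) (F : C ⥤ D) [F.Additive] : AddClosed fun M => 𝒟 (F.obj M) where
  iso e := h.iso (F.mapIso e)
  zero hM := h.zero (F.map_isZero hM)
  biprod {M N} hM hN := by
    have := preservesBinaryBiproduct_of_preservesBiproduct F M N
    exact h.iso (F.mapBiprod M N).symm (h.biprod hM hN)

lemma AddClosed.and {C : Type*} [Category* C] [Preadditive C] [HasBinaryBiproducts C]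
    {𝒞 𝒟 : C → Prop} (h : AddClosed 𝒞) (h' : AddClosed 𝒟) :
    AddClosed fun M => 𝒞 M ∧ 𝒟 M where
  iso e := And.imp (h.iso e) (h'.iso e)
  zero hM := ⟨h.zero hM, h'.zero hM⟩
  biprod hM hN := ⟨h.biprod hM.1 hN.1, h'.biprod hM.2 hN.2⟩

/-- Free sheaves of modules of finite rank. -/
def IsFreeFin {V : Opens X} (M : SheafOfModules.{u} (X.ringCatSheaf.over V)) : Prop :=
  ∃ n, Nonempty (M ≅ SheafOfModules.free (ULift.{u} (Fin n)))

lemma addClosed_isFreeFin (V : Opens X) : AddClosed (IsFreeFin X (V := V)) where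
  iso := fun e ⟨n, ⟨f⟩⟩ => ⟨n, ⟨e.symm ≪≫ f⟩⟩
  zero {M} hM := by
    refine ⟨0, ⟨hM.iso ?_⟩⟩
    rw [IsZero.iff_id_eq_zero]
    exact (SheafOfModules.freeHomEquiv _).injective (funext fun i => i.down.elim0)
  biprod := fun ⟨m, ⟨f⟩⟩ ⟨n, ⟨g⟩⟩ => ⟨m + n, ⟨biprod.mapIso f g ≪≫ biprod.isoCoprod _ _ ≪≫
    SheafOfModules.freeSumIso _ _ ≪≫ SheafOfModules.freeFunctor.mapIso
      (((Equiv.sumCongr Equiv.ulift Equiv.ulift).trans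
        (finSumFinEquiv.trans Equiv.ulift.symm)).toIso)⟩⟩

lemma addClosed_essImage_tilde (R : CommRingCat.{u}) :
    AddClosed (tilde.functor R).essImage where
  iso e h := (tilde.functor R).essImage.prop_of_iso e h
  zero hM := ⟨_, ⟨((tilde.functor R).map_isZero (isZero_zero _)).iso hM⟩⟩
  biprod := fun ⟨M, ⟨f⟩⟩ ⟨N, ⟨g⟩⟩ => by
    have := preservesBinaryBiproduct_of_preservesBiproduct (tilde.functor R) M N
    exact ⟨M ⊞ N, ⟨(tilde.functor R).mapBiprod M N ≪≫ biprod.mapIso f g⟩⟩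

end AddClosedClasses

namespace AlgebraicGeometry.Scheme.Modules

section

open DerivedCategory ZeroExtSystem

variable {X}

instance (V : Opens X) : PreservesFiniteColimits (resF X V) := by
  have : (resF X V).IsLeftAdjoint := inferInstanceAs
    (SheafOfModules.pushforward (𝟙 (X.ringCatSheaf.over V))).IsLeftAdjoint
  infer_instance

lemma isIso_resF_map {V : X.Opens} {M N : X.Modules} (f : M ⟶ N)
    (h : ∀ U ≤ V, Function.Bijective (f.app U)) : IsIso ((resF X V).map f) := by
  rw [← isIso_iff_of_reflects_iso _ (SheafOfModules.forget _),
    ← isIso_iff_of_reflects_iso _ (_root_.PresheafOfModules.toPresheaf _),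
    NatTrans.isIso_iff_isIso_app]
  intro U
  exact (ConcreteCategory.isIso_iff_bijective _).mpr (h U.unop.left (leOfHom U.unop.hom))

instance {Y : Scheme.{u}} (j : Y ⟶ X) [IsOpenImmersion j] : (restrictFunctor j).Additive :=
  (restrictAdjunction j).left_adjoint_additive

lemma isIso_restrict_map {Y : Scheme.{u}} (j : Y ⟶ X) [IsOpenImmersion j] {M N : X.Modules}
    (f : M ⟶ N) (h : ∀ U ≤ j.opensRange, Function.Bijective (f.app U)) :
    IsIso ((restrictFunctor j).map f) :=
  isIso_of_bijective _ fun U => h (j ''ᵁ U) (j.image_le_opensRange U)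

lemma isFreeFin_resF_zeroExtO (V : X.Opens) : IsFreeFin X ((resF X V).obj (zeroExtO V)) := by
  have := isIso_resF_map ((zeroExtι V).app (structureModule X))
    fun U hU => zeroExtι_bijective hU
  refine ⟨1, ⟨asIso ((resF X V).map ((zeroExtι V).app (structureModule X))) ≪≫ ?_⟩⟩
  exact (coproductUniqueIso (fun _ : ULift.{u} (Fin 1) =>
    SheafOfModules.unit (X.ringCatSheaf.over V))).symm

lemma essImage_tilde_restrict_zeroExtO {V : X.Opens} (hV : IsAffineOpen V) :
    (tilde.functor Γ(X, V)).essImage ((restrictFunctor hV.fromSpec).obj (zeroExtO V)) := by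
  have : IsIso ((restrictFunctor hV.fromSpec).map ((zeroExtι V).app (structureModule X))) := by
    refine isIso_restrict_map _ _ fun U hU => zeroExtι_bijective (M := structureModule X) ?_
    exact hU.trans hV.opensRange_fromSpec.le
  exact ⟨_, ⟨tildeSelf ≪≫ (restrictUnitIso hV.fromSpec).symm ≪≫
    (@asIso _ _ _ _ _ this).symm⟩⟩

variable [HasDerivedCategory.{w} X.Modules]

lemma zeroExtD_hom_zeroExtD_eq_zero {V : X.Opens} (hV : IsAffineOpen V) (m : ℤ) (hm : m ≠ 0)
    (f : zeroExtD 0 V ⟶ zeroExtD m V) : f = 0 := by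
  let e : ((zeroExtSystem X).L V).obj ((singleFunctor X.Modules m).obj (structureModule X)) ≅
      zeroExtD m V := ((zeroExt V).mapDerivedCategorySingleFunctor m).app (structureModule X)
  rw [← cancel_mono e.inv, zero_comp]
  exact Supp.lift_unique (supp_zeroExtD le_rfl 0) <|
    zeroExtD_hom_single_eq_zero hV localizing_structureModule 0 m hm _

/-- On an affine open subset `V`, an object of the triangulated subcategory generated by the
structure sheaf of `V` extended by zero is represented by a bounded complex whose restriction to
`V` consists of free modules of finite rank. -/
theorem exists_boundedIn_of_fin {V : X.Opens} (hV : IsAffineOpen V)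
    {P : DerivedCategory X.Modules} (hP : (zeroExtSystem X).Fin (structureD X) V P) :
    ∃ L : CochainComplex X.Modules ℤ, BoundedIn (fun M => IsFreeFin X ((resF X V).obj M) ∧
      (tilde.functor Γ(X, V)).essImage ((restrictFunctor hV.fromSpec).obj M)) L ∧
      Nonempty (Q.obj L ≅ P) :=
  exists_boundedIn_of_triSpan
    (((addClosed_isFreeFin X V).inverseImage (resF X V)).and
      ((addClosed_essImage_tilde Γ(X, V)).inverseImage (restrictFunctor hV.fromSpec)))
    ⟨isFreeFin_resF_zeroExtO V, essImage_tilde_restrict_zeroExtO hV⟩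
    (zeroExtD_hom_zeroExtD_eq_zero hV)
    (TriSpan.le (triSpan_triClosed _) (.iso (zeroExtStructureDIso V).symm .base) hP)

end

end AlgebraicGeometry.Scheme.Modules

section Perfect

lemma CategoryTheory.Functor.preservesFiniteLimits_of_preservesMono {C D : Type*} [Category* C]
    [Category* D] [Abelian C] [Abelian D] (F : C ⥤ D) [F.Additive] [PreservesFiniteColimits F]
    (h : ∀ {M N : C} (f : M ⟶ N) [Mono f], Mono (F.map f)) : PreservesFiniteLimits F := by
  have : F.PreservesMonomorphisms := ⟨h⟩
  have := F.preservesHomology_of_preservesMonos_and_cokernels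
  exact F.preservesFiniteLimits_of_preservesHomology

open AlgebraicGeometry.Scheme.Modules

instance (V : Opens X) : PreservesFiniteLimits (resF X V) := by
  refine (resF X V).preservesFiniteLimits_of_preservesMono fun f _ => ?_
  have : Mono ((_root_.PresheafOfModules.toPresheaf _).map
      ((SheafOfModules.forget _).map ((resF X V).map f))) := by
    rw [NatTrans.mono_iff_mono_app]
    exact fun U => (AddCommGrpCat.mono_iff_injective _).mpr (injective_of_mono f U.unop.left)
  exact (SheafOfModules.forget _).mono_of_mono_map
    ((_root_.PresheafOfModules.toPresheaf _).mono_of_mono_map this)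

instance {Y : Scheme.{u}} (j : Y ⟶ X) [IsOpenImmersion j] :
    PreservesFiniteLimits (restrictFunctor j) :=
  (restrictFunctor j).preservesFiniteLimits_of_preservesMono fun f _ =>
    mono_of_injective _ fun U => injective_of_mono f (j ''ᵁ U)

lemma IsFreeFin.isLocFreeFin {V : Opens X} {M : SheafOfModules.{u} (X.ringCatSheaf.over V)}
    (h : IsFreeFin X M) : IsLocFreeFin X M := by
  obtain ⟨n, ⟨e⟩⟩ := h
  refine ⟨PUnit, fun _ => Over.mk (𝟙 V), fun Y => ?_, fun _ => n, fun _ => ⟨?_⟩⟩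
  · have : Sieve.ofObjects (fun _ : PUnit => Over.mk (𝟙 V)) Y = ⊤ := by
      ext Z f
      exact ⟨fun _ => trivial, fun _ => ⟨PUnit.unit, ⟨Over.homMk Z.hom⟩⟩⟩
    rw [this]
    exact GrothendieckTopology.top_mem _ _
  · have : HasBinaryProducts (Over V) := Over.ConstructProducts.over_binaryProduct_of_pullback
    have : (SheafOfModules.overFunctor (X.ringCatSheaf.over V) (Over.mk (𝟙 V))).IsLeftAdjoint :=
      inferInstanceAs (SheafOfModules.pushforward
        (𝟙 ((X.ringCatSheaf.over V).over (Over.mk (𝟙 V))))).IsLeftAdjoint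
    exact (SheafOfModules.overFunctor _ (Over.mk (𝟙 V))).mapIso e ≪≫
      (SheafOfModules.mapFreeIso (SheafOfModules.overFunctor _ (Over.mk (𝟙 V))) _
        (Iso.refl _)).symm

open DerivedCategory

lemma nonempty_Q_mapHomologicalComplex_iso {C D : Type*} [Category* C] [Category* D] [Abelian C]
    [Abelian D] [HasDerivedCategory C] [HasDerivedCategory D] (F : C ⥤ D) [F.Additive]
    [PreservesFiniteLimits F] [PreservesFiniteColimits F] {K L : CochainComplex C ℤ}
    (e : Q.obj K ≅ Q.obj L) :
    Nonempty (Q.obj ((F.mapHomologicalComplex (.up ℤ)).obj K) ≅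
      Q.obj ((F.mapHomologicalComplex (.up ℤ)).obj L)) :=
  ⟨(F.mapDerivedCategoryFactors.app K).symm ≪≫ F.mapDerivedCategory.mapIso e ≪≫
    F.mapDerivedCategoryFactors.app L⟩

variable {X}

lemma mem_lsup_iff {l : List X.Opens} {x : X} :
    x ∈ ZeroExtSystem.lsup l ↔ ∃ b ∈ l, x ∈ b := by
  induction l with
  | nil => simp
  | cons a l ih => simp [ih]

/-- An object which is locally in the triangulated subcategories generated by the extensions by
zero of the structure sheaf is locally represented by bounded complexes of free modules. -/
theorem exists_boundedIn_of_locFin [IsNoetherian X] [HasDerivedCategory.{w} X.Modules]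
    {P : DerivedCategory X.Modules} (hP : (zeroExtSystem X).LocFin (structureD X) ⊤ P) (x : X) :
    ∃ (V : X.Opens) (hV : IsAffineOpen V) (L : CochainComplex X.Modules ℤ), x ∈ V ∧
      BoundedIn (fun M => IsFreeFin X ((resF X V).obj M) ∧
        (tilde.functor Γ(X, V)).essImage ((restrictFunctor hV.fromSpec).obj M)) L ∧
      Nonempty (Q.obj L ≅ ((zeroExtSystem X).L V).obj P) := by
  obtain ⟨l, hl, h⟩ := hP
  obtain ⟨b, hb, hx⟩ : ∃ b ∈ l, x ∈ b := mem_lsup_iff.mp (hl ▸ trivial)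
  obtain ⟨V, hV, hxV, hVb⟩ := exists_isAffineOpen_mem_and_subset hx
  obtain ⟨L, hL, ⟨e⟩⟩ := exists_boundedIn_of_fin hV ((h b hb).L hVb)
  exact ⟨V, hV, L, hxV, hL, ⟨e ≪≫ (zeroExtSystem X).mapIso hVb P⟩⟩

/-- Locally finite objects are represented by perfect complexes. -/
theorem isPerfectCplx_of_locFin [IsNoetherian X] [HasDerivedCategory.{w} X.Modules]
    [∀ V : Opens X, HasDerivedCategory.{w'} (SheafOfModules.{u} (X.ringCatSheaf.over V))]
    {K : CochainComplex X.Modules ℤ}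
    (hK : (zeroExtSystem X).LocFin (structureD X) ⊤ (Q.obj K)) : IsPerfectCplx X K := by
  intro x
  obtain ⟨V, hV, L, hx, hL, ⟨e⟩⟩ := exists_boundedIn_of_locFin hK x
  have e' : Q.obj ((zeroExt V).cx.obj K) ≅ Q.obj L :=
    ((zeroExt V).mapDerivedCategoryFactors.app K).symm ≪≫ e.symm
  obtain ⟨e''⟩ := nonempty_Q_mapHomologicalComplex_iso (resF X V) e'
  refine ⟨V, hx, ((resF X V).mapHomologicalComplex (.up ℤ)).obj L, ?_,
    fun n => (hL.2 n).1.isLocFreeFin, ⟨?_⟩⟩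
  · obtain ⟨a, b, hab⟩ := hL.1
    exact ⟨a, b, fun n hn => (resF X V).map_isZero (hab n hn)⟩
  · have := isIso_Q_map (((resF X V).mapHomologicalComplex (.up ℤ)).map
      ((counitCx (zeroExtι V)).app K)) fun n => isIso_resF_map _ fun U hU => zeroExtι_bijective hU
    exact (asIso (Q.map (((resF X V).mapHomologicalComplex (.up ℤ)).map
      ((counitCx (zeroExtι V)).app K)))).symm ≪≫ e''

end Perfect

section Quasicoherent

open AlgebraicGeometry.Scheme.Modules

instance (R : CommRingCat.{u}) : PreservesFiniteLimits (tilde.functor R) :=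
  (tilde.functor R).preservesFiniteLimits_of_preservesMono fun f hf =>
    mono_of_injective _ fun _ _ _ h => Subtype.ext (funext fun y =>
      LocalizedModule.map_injective (show PrimeSpectrum R from y.1).asIdeal.primeCompl f.hom
        ((ModuleCat.mono_iff_injective f).mp hf) (congrFun (congrArg Subtype.val h) y))

lemma CategoryTheory.Functor.essImage_homology {C D : Type*} [Category* C] [Category* D]
    [Abelian C] [Abelian D] (F : C ⥤ D) [F.Additive] [F.Full] [F.Faithful]
    [PreservesFiniteLimits F] [PreservesFiniteColimits F] (S : ShortComplex D)
    (h₁ : F.essImage S.X₁) (h₂ : F.essImage S.X₂) (h₃ : F.essImage S.X₃) :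
    F.essImage S.homology := by
  obtain ⟨M₁, ⟨e₁⟩⟩ := h₁
  obtain ⟨M₂, ⟨e₂⟩⟩ := h₂
  obtain ⟨M₃, ⟨e₃⟩⟩ := h₃
  let T : ShortComplex C :=
    ShortComplex.mk (F.preimage (e₁.hom ≫ S.f ≫ e₂.inv)) (F.preimage (e₂.hom ≫ S.g ≫ e₃.inv))
      (F.map_injective (by simp))
  have h₁ : e₁.hom ≫ S.f = F.map T.f ≫ e₂.hom := by
    rw [F.map_preimage, Category.assoc, Category.assoc, e₂.inv_hom_id, Category.comp_id]
  have h₂ : e₂.hom ≫ S.g = F.map T.g ≫ e₃.hom := by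
    rw [F.map_preimage, Category.assoc, Category.assoc, e₃.inv_hom_id, Category.comp_id]
  exact ⟨T.homology, ⟨(T.mapHomologyIso F).symm ≪≫ ShortComplex.homologyMapIso
    (ShortComplex.isoMk e₁ e₂ e₃ h₁ h₂)⟩⟩

open DerivedCategory

variable {X}

lemma essImage_tilde_restrict_homology {V : X.Opens} (hV : IsAffineOpen V)
    [HasDerivedCategory.{w} X.Modules] {K L : CochainComplex X.Modules ℤ}
    (hL : ∀ n, (tilde.functor Γ(X, V)).essImage ((restrictFunctor hV.fromSpec).obj (L.X n)))
    (e : Q.obj L ≅ Q.obj ((zeroExt V).cx.obj K)) (n : ℤ) :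
    (tilde.functor Γ(X, V)).essImage ((restrictFunctor hV.fromSpec).obj (K.homology n)) := by
  let F := restrictFunctor hV.fromSpec
  let Fc := F.mapHomologicalComplex (.up ℤ)
  have (m : ℤ) : IsIso ((Fc.map ((counitCx (zeroExtι V)).app K)).f m) :=
    isIso_restrict_map _ _ fun U hU => zeroExtι_bijective (hU.trans hV.opensRange_fromSpec.le)
  have : IsIso (Fc.map ((counitCx (zeroExtι V)).app K)) :=
    HomologicalComplex.Hom.isIso_of_components _
  let e₁ : L.homology n ≅ ((zeroExt V).cx.obj K).homology n :=
    ((homologyFunctorFactors _ n).app L).symm ≪≫ (homologyFunctor _ n).mapIso e ≪≫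
      (homologyFunctorFactors _ n).app _
  let e₂ : (Fc.obj ((zeroExt V).cx.obj K)).homology n ≅ (Fc.obj K).homology n :=
    (HomologicalComplex.homologyFunctor _ _ n).mapIso
      (asIso (Fc.map ((counitCx (zeroExtι V)).app K)))
  have h := (tilde.functor Γ(X, V)).essImage_homology ((L.sc n).map F) (hL _) (hL _) (hL _)
  exact Functor.essImage.ofIso ((L.sc n).mapHomologyIso F ≪≫ F.mapIso e₁ ≪≫
    ((((zeroExt V).cx.obj K).sc n).mapHomologyIso F).symm ≪≫ e₂ ≪≫ (K.sc n).mapHomologyIso F) h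

/-- A sheaf of modules is quasi-coherent if it is so on an affine open cover. -/
theorem isQuasicoherent_of_essImage_tilde {M : X.Modules}
    (h : ∀ x : X, ∃ (V : X.Opens) (hV : IsAffineOpen V), x ∈ V ∧
      (tilde.functor Γ(X, V)).essImage ((restrictFunctor hV.fromSpec).obj M)) :
    M.IsQuasicoherent := by
  choose V hV hx N hN using h
  let pres (x : X) : SheafOfModules.Presentation (M.over (V x)) := by
    let p : (tilde (N x)).Presentation :=
      presentationTilde (M := N x) .univ (by simp) _ (Submodule.span_eq _)
    let e₁ : (restrictFunctor (hV x).isoSpec.hom).obj (tilde (N x)) ≅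
        (overEquiv (V x)).functor.obj (M.over (V x)) :=
      (restrictFunctor _).mapIso (hN x).some ≪≫ (restrictFunctorComp _ _).symm.app M ≪≫
        (restrictFunctorCongr (by simp)).app M ≪≫ (overFunctorEquiv (V x)).symm.app M
    let G : SheafOfModules.{u} (V x : Scheme.{u}).ringCatSheaf ⥤
      SheafOfModules.{u} (X.ringCatSheaf.over (V x)) := (overEquiv (V x)).inverse
    have : PreservesColimitsOfSize.{u, u} G :=
      inferInstanceAs (PreservesColimitsOfSize.{u, u} (overEquiv (V x)).inverse)
    let η : SheafOfModules.unit (X.ringCatSheaf.over (V x)) ≅ G.obj (SheafOfModules.unit _) :=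
      (overEquiv (V x)).unitIso.app _ ≪≫ (overEquiv (V x)).inverse.mapIso
        ((overFunctorEquiv (V x)).app (SheafOfModules.unit X.ringCatSheaf) ≪≫
          restrictUnitIso (V x).ι)
    let e₂ : G.obj ((restrictFunctor (hV x).isoSpec.hom).obj (tilde (N x))) ≅ M.over (V x) :=
      (overEquiv (V x)).inverse.mapIso e₁ ≪≫ (overEquiv (V x)).unitIso.symm.app _
    exact SheafOfModules.Presentation.ofIsIso.{u, u, u} e₂.hom
      (SheafOfModules.Presentation.map (presentationRestrict _ p) G η)
  refine SheafOfModules.QuasicoherentData.isQuasicoherent.{u, u, u, u} (M := M)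
    { I := X, X := V, coversTop := ?_, presentation := pres }
  rw [Opens.coversTop_iff, IsOpenCover, eq_top_iff]
  exact fun x _ => Opens.mem_iSup.mpr ⟨x, hx x⟩

end Quasicoherent

section Generator

variable {X}

open AlgebraicGeometry.Scheme.Modules DerivedCategory

/-- Locally finite objects have quasi-coherent homology. -/
theorem dqcX_of_locFin [IsNoetherian X] [HasDerivedCategory.{w} X.Modules]
    {K : CochainComplex X.Modules ℤ}
    (hK : (zeroExtSystem X).LocFin (structureD X) ⊤ (Q.obj K)) : DqcX X (Q.obj K) := by
  intro n
  refine (SheafOfModules.isQuasicoherent.{u, u, u} X.ringCatSheaf).prop_of_iso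
    ((homologyFunctorFactors _ n).app K).symm (isQuasicoherent_of_essImage_tilde fun x => ?_)
  obtain ⟨V, hV, L, hx, hL, ⟨e⟩⟩ := exists_boundedIn_of_locFin hK x
  exact ⟨V, hV, hx, essImage_tilde_restrict_homology hV (fun m => (hL.2 m).2)
    (e ≪≫ (zeroExt V).mapDerivedCategoryFactors.app K) n⟩

lemma DqcX.dLoc [HasDerivedCategory.{w} X.Modules] {M : DerivedCategory X.Modules}
    (hM : DqcX X M) : DLoc M := fun n =>
  have := hM n
  localizing_of_isQuasicoherent _

end Generator

theorem Dqc_has_single_compact_perfect_generator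
    [IsNoetherian X] [HasDerivedCategory.{w} X.Modules]
    [∀ V : Opens X, HasDerivedCategory.{w'} (SheafOfModules.{u} (X.ringCatSheaf.over V))] :
    ∃ K : CochainComplex X.Modules ℤ,
      IsPerfectCplx X K ∧
      DqcX X (DerivedCategory.Q.obj K) ∧
      IsCompactObjIn (DqcX X) (DerivedCategory.Q.obj K) ∧
      (∀ M : DerivedCategory X.Modules, DqcX X M →
        (∀ (i : ℤ) (f : (DerivedCategory.Q.obj K)⟦i⟧ ⟶ M), f = 0) → IsZero M) := by
  obtain ⟨P, hP, hgen⟩ := AlgebraicGeometry.Scheme.Modules.exists_structureD_generator X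
  obtain ⟨K, ⟨e⟩⟩ := exists_Q_obj_iso P
  have hK : (AlgebraicGeometry.Scheme.Modules.zeroExtSystem X).LocFin
      (AlgebraicGeometry.Scheme.Modules.structureD X) ⊤ (DerivedCategory.Q.obj K) := by
    obtain ⟨l, hl, h⟩ := hP
    exact ⟨l, hl, fun b hb => (ZeroExtSystem.fin_triClosed b).iso
      ((ZeroExtSystem.L _ b).mapIso e.symm) (h b hb)⟩
  refine ⟨K, isPerfectCplx_of_locFin hK, dqcX_of_locFin hK, fun J _ Y _ hY =>
    AlgebraicGeometry.Scheme.Modules.isCompactObjIn_of_locFin hK J Y fun j => (hY j).dLoc,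
    fun M hM h => hgen M hM.dLoc ?_⟩
  exact (triClosed_leftOrth M).iso e ((leftOrth_iff M _).mpr h)
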